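/- arXiv:1309.4032 — 8 statements merged into one kernel-verified Lean document; each statement's English description precedes it below -/
import Mathlib

section
/- Let H be an infinite-dimensional complex Hilbert space, let r and s be positive rational numbers with r + s > 1, and let φ : S(H) → S(H) be a surjective map satisfying σ(|A|^r B |A|^s) = σ(|φ(A)|^r φ(B) |φ(A)|^s) for every A in P₁(H) ∪ {I} and every B ∈ S(H). Then there exists a bounded linear or conjugate-linear bijection T : H → H with T* = T⁻¹ such that φ(A) = T A T* for all A ∈ S(H). -/
/-- The absolute value `|A| = (A* A)^(1/2)`, via the continuous functional calculus. -/
noncomputable def absOp {H : Type*} [NormedAddCommGroup H] [InnerProductSpace ℂ H]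
    [CompleteSpace H] (A : H →L[ℂ] H) : H →L[ℂ] H :=
  cfc (fun t : ℝ => Real.sqrt t) (star A * A)

/-- The power `|A|^r`, via the continuous functional calculus. -/
noncomputable def absPow {H : Type*} [NormedAddCommGroup H] [InnerProductSpace ℂ H]
    [CompleteSpace H] (A : H →L[ℂ] H) (r : ℝ) : H →L[ℂ] H :=
  cfc (fun t : ℝ => t ^ r) (absOp A)

/-- An operator has rank one when its range is a one-dimensional subspace. -/
def IsRankOne {H : Type*} [NormedAddCommGroup H] [InnerProductSpace ℂ H]
    (A : H →L[ℂ] H) : Prop :=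
  Module.finrank ℂ (LinearMap.range (A : H →ₗ[ℂ] H)) = 1

/-- A rank-one projection: a self-adjoint idempotent of rank one. -/
def IsRankOneProjection {H : Type*} [NormedAddCommGroup H] [InnerProductSpace ℂ H]
    [CompleteSpace H] (A : H →L[ℂ] H) : Prop :=
  IsSelfAdjoint A ∧ A * A = A ∧ IsRankOne A

open scoped InnerProductSpace
set_option linter.unusedSectionVars false

namespace SpecPres

variable {H : Type*} [NormedAddCommGroup H] [InnerProductSpace ℂ H] [CompleteSpace H]

/-- The rank one operator `|z⟩⟨z|`. -/
noncomputable def R (z : H) : selfAdjoint (H →L[ℂ] H) :=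
  ⟨InnerProductSpace.rankOne ℂ z z, by
    rw [selfAdjoint.mem_iff, ContinuousLinearMap.star_eq_adjoint,
      InnerProductSpace.adjoint_rankOne]⟩

lemma R_apply (z v : H) : (R z : H →L[ℂ] H) v = inner ℂ z v • z := rfl

lemma R_smul (c : ℂ) (z : H) : R (c • z) = (‖c‖ ^ 2 : ℝ) • R z := by
  ext v
  have : (‖c‖ ^ 2 : ℝ) • (R z : H →L[ℂ] H) v = ((‖c‖ ^ 2 : ℝ) : ℂ) • (R z : H →L[ℂ] H) v := rfl
  change (R (c • z) : H →L[ℂ] H) v = (‖c‖ ^ 2 : ℝ) • (R z : H →L[ℂ] H) v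
  rw [this]
  simp only [R_apply, inner_smul_left, smul_smul]
  congr 1
  have := Complex.conj_mul' c
  push_cast
  rw [← this]; ring

lemma R_zero : (R 0 : selfAdjoint (H →L[ℂ] H)) = 0 := by
  ext v
  change (R (0 : H) : H →L[ℂ] H) v = 0
  rw [R_apply, smul_zero]

lemma sm_one (A : selfAdjoint (H →L[ℂ] H)) : (1 : ℝ) • A = A := by
  apply Subtype.ext
  change (1 : ℝ) • (A : H →L[ℂ] H) = A
  rw [one_smul]

lemma R_par (x y : H) : R (x + y) + R (x - y) = (2:ℝ) • R x + (2:ℝ) • R y := by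
  ext v
  change (R (x + y) : H →L[ℂ] H) v + (R (x - y) : H →L[ℂ] H) v =
    ((2:ℝ):ℂ) • (R x : H →L[ℂ] H) v + ((2:ℝ):ℂ) • (R y : H →L[ℂ] H) v
  simp only [R_apply, inner_add_left, inner_sub_left]
  push_cast
  module

lemma R_inj {z w : H} (h : R z = R w) : ∃ c : ℂ, ‖c‖ = 1 ∧ w = c • z := by
  have hn : ‖z‖ = ‖w‖ := by
    have := congrArg (fun A : selfAdjoint (H →L[ℂ] H) => ‖(A : H →L[ℂ] H)‖) h
    simp only [R, InnerProductSpace.norm_rankOne] at this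
    nlinarith [norm_nonneg z, norm_nonneg w, sq_nonneg (‖z‖ - ‖w‖)]
  by_cases hz : z = 0
  · subst hz
    refine ⟨1, by simp, ?_⟩
    simp at hn
    simp [norm_eq_zero.1 hn.symm]
  have hw : w ≠ 0 := by
    rintro rfl; simp at hn; exact hz hn
  have h1 : inner ℂ z w • z = inner ℂ w w • w := by
    rw [← R_apply, h, R_apply]
  have hww : (inner ℂ w w : ℂ) ≠ 0 := by simpa using hw
  have h2 : w = ((inner ℂ w w : ℂ)⁻¹ * inner ℂ z w) • z := by
    rw [mul_smul, h1, smul_smul, inv_mul_cancel₀ hww, one_smul]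
  refine ⟨_, ?_, h2⟩
  have h3 := congrArg norm h2
  rw [norm_smul, hn] at h3
  have : ‖w‖ ≠ 0 := by simpa using hw
  exact (mul_right_cancel₀ this (by rw [one_mul]; exact h3)).symm

lemma sa_symm (B : selfAdjoint (H →L[ℂ] H)) (x y : H) :
    inner ℂ ((B : H →L[ℂ] H) x) y = inner ℂ x ((B : H →L[ℂ] H) y) := by
  have := B.2
  rw [selfAdjoint.mem_iff, ContinuousLinearMap.star_eq_adjoint] at this
  conv_rhs => rw [← this]
  rw [ContinuousLinearMap.adjoint_inner_right]

lemma sa_ext {B C : selfAdjoint (H →L[ℂ] H)}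
    (h : ∀ x : H, inner ℂ x ((B : H →L[ℂ] H) x) = inner ℂ x ((C : H →L[ℂ] H) x)) : B = C := by
  apply Subtype.ext
  apply ContinuousLinearMap.coe_injective
  rw [← ext_inner_map]
  intro x
  have := h x
  rw [← sa_symm, ← sa_symm] at this
  exact this

lemma spec_real {A : H →L[ℂ] H} {t : ℝ} : t ∈ spectrum ℝ A ↔ (t : ℂ) ∈ spectrum ℂ A := by
  rw [← spectrum.preimage_algebraMap (S := ℂ) (R := ℝ)]; rfl

lemma spec_idem {P : H →L[ℂ] H} (hP : P * P = P) (a l : ℂ) (h : l ∈ spectrum ℂ (a • P)) :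
    l = 0 ∨ l = a := by
  by_contra hc
  push Not at hc
  obtain ⟨h0, ha⟩ := hc
  have ha' : l - a ≠ 0 := sub_ne_zero.2 ha
  apply h
  rw [spectrum.mem_resolventSet_iff, Algebra.algebraMap_eq_smul_one]
  have e1 : (l • (1 : H →L[ℂ] H) - a • P) * (l⁻¹ • (1 : H →L[ℂ] H) + (l⁻¹ * a / (l - a)) • P) = 1 := by
    simp only [sub_mul, mul_add, smul_mul_smul_comm, one_mul, mul_one, hP]
    have : l * l⁻¹ = 1 := mul_inv_cancel₀ h0
    rw [this, one_smul, ← sub_smul, sub_add, ← sub_smul, sub_eq_self]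
    convert zero_smul ℂ P using 2
    field_simp
    ring
  have e2 : (l⁻¹ • (1 : H →L[ℂ] H) + (l⁻¹ * a / (l - a)) • P) * (l • (1 : H →L[ℂ] H) - a • P) = 1 := by
    simp only [mul_sub, add_mul, smul_mul_smul_comm, one_mul, mul_one, hP]
    have : l⁻¹ * l = 1 := inv_mul_cancel₀ h0
    rw [this, one_smul, add_sub_assoc, add_eq_left, ← add_smul, ← sub_smul]
    convert zero_smul ℂ P using 2
    field_simp
    ring
  exact ⟨⟨_, _, e1, e2⟩, rfl⟩

lemma spec_eig {A : H →L[ℂ] H} {x : H} (hx : x ≠ 0) {l : ℂ} (h : A x = l • x) :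
    l ∈ spectrum ℂ A := by
  intro hu
  obtain ⟨u, hu⟩ := hu
  apply hx
  have h1 : (u : H →L[ℂ] H) x = 0 := by
    rw [hu, Algebra.algebraMap_eq_smul_one]
    simp [h]
  have h2 : ((↑u⁻¹ * ↑u : H →L[ℂ] H)) x = x := by simp
  rw [mul_apply_eq_comp, h1, map_zero] at h2
  exact h2.symm

lemma proj_of_spec (Q : selfAdjoint (H →L[ℂ] H))
    (h : ∀ l ∈ spectrum ℂ (Q : H →L[ℂ] H), l = 0 ∨ l = 1) :
    (Q : H →L[ℂ] H) * Q = Q := by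
  have hQ : IsSelfAdjoint (Q : H →L[ℂ] H) := Q.2
  have h1 : cfc (fun t : ℝ => t * t) (Q : H →L[ℂ] H) = cfc (fun t : ℝ => t) (Q : H →L[ℂ] H) := by
    apply cfc_congr
    intro t ht
    rcases h _ (spec_real.1 ht) with h | h
    · have : t = 0 := by exact_mod_cast h
      simp [this]
    · have : t = 1 := by exact_mod_cast h
      simp [this]
  rw [cfc_mul (fun t : ℝ => t) (fun t : ℝ => t) (Q : H →L[ℂ] H), cfc_id' ℝ (Q : H →L[ℂ] H)] at h1
  exact h1

lemma cfc_proj {Q : H →L[ℂ] H} (hQ : IsSelfAdjoint Q) (hP : Q * Q = Q) (f : ℝ → ℝ)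
    (h0 : f 0 = 0) (h1 : f 1 = 1) : cfc f Q = Q := by
  conv_rhs => rw [← cfc_id' ℝ Q]
  apply cfc_congr
  intro t ht
  have := spec_idem hP 1 t (by rw [one_smul]; exact spec_real.1 ht)
  rcases this with h | h
  · have : t = 0 := by exact_mod_cast h
    simp [this, h0]
  · have : t = 1 := by exact_mod_cast h
    simp [this, h1]

lemma absPow_proj {Q : H →L[ℂ] H} (hQ : IsSelfAdjoint Q) (hP : Q * Q = Q) {r : ℝ} (hr : 0 < r) :
    absPow Q r = Q := by
  have : absOp Q = Q := by
    rw [absOp, hQ.star_eq, hP]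
    exact cfc_proj hQ hP _ (by simp) (by simp)
  rw [absPow, this]
  exact cfc_proj hQ hP _ (by simp [hr.ne']) (by simp)

lemma absPow_sa {C : H →L[ℂ] H} (hC : IsSelfAdjoint C) {r : ℝ} (hr : 0 < r) :
    absPow C r = cfc (fun t : ℝ => |t| ^ r) C := by
  have h1 : absOp C = cfc (fun t : ℝ => |t|) C := by
    rw [absOp, hC.star_eq]
    have : C * C = cfc (fun t : ℝ => t * t) C := by
      rw [cfc_mul (fun t : ℝ => t) (fun t : ℝ => t) C, cfc_id' ℝ C]
    rw [this, ← cfc_comp' (fun t : ℝ => Real.sqrt t) (fun t : ℝ => t * t) C]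
    simp only [Real.sqrt_mul_self_eq_abs]
  rw [absPow, h1, ← cfc_comp' (fun t : ℝ => t ^ r) (fun t : ℝ => |t|) C
    (Real.continuous_rpow_const hr.le).continuousOn]

lemma eq_one_of_spec {C : H →L[ℂ] H} (hC : IsSelfAdjoint C) {r s : ℝ} (hr : 0 < r) (hs : 0 < s)
    (h : ∀ l ∈ spectrum ℂ (absPow C r * C * absPow C s), l = 1) : C = 1 := by
  have c1 : Continuous (fun t : ℝ => |t| ^ r) :=
    (Real.continuous_rpow_const hr.le).comp continuous_abs
  have c2 : Continuous (fun t : ℝ => |t| ^ s) :=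
    (Real.continuous_rpow_const hs.le).comp continuous_abs
  have e : absPow C r * C * absPow C s = cfc (fun t : ℝ => |t| ^ r * t * |t| ^ s) C := by
    rw [cfc_mul (fun t : ℝ => |t| ^ r * t) (fun t : ℝ => |t| ^ s) C
      (c1.mul continuous_id).continuousOn c2.continuousOn,
      cfc_mul (fun t : ℝ => |t| ^ r) (fun t : ℝ => t) C c1.continuousOn continuousOn_id,
      cfc_id' ℝ C, absPow_sa hC hr, absPow_sa hC hs]
  have key : ∀ t ∈ spectrum ℝ C, t = 1 := by
    intro t ht
    have h1 : (|t| ^ r * t * |t| ^ s) ∈ spectrum ℝ (absPow C r * C * absPow C s) := by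
      rw [e, cfc_map_spectrum (fun t : ℝ => |t| ^ r * t * |t| ^ s) C hC
        ((c1.mul continuous_id).mul c2).continuousOn]
      exact ⟨t, ht, rfl⟩
    have h2 : |t| ^ r * t * |t| ^ s = 1 := by exact_mod_cast h _ (spec_real.1 h1)
    have hr0 : 0 ≤ |t| ^ r := Real.rpow_nonneg (abs_nonneg t) _
    have hs0 : 0 ≤ |t| ^ s := Real.rpow_nonneg (abs_nonneg t) _
    have ht0 : 0 < t := by
      by_contra hc
      push Not at hc
      nlinarith [mul_nonneg (mul_nonneg hr0 (neg_nonneg.2 hc)) hs0]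
    rw [abs_of_pos ht0] at h2
    rcases lt_trichotomy t 1 with h | h | h
    · have a1 := Real.rpow_lt_one ht0.le h hr
      have a2 := Real.rpow_lt_one ht0.le h hs
      have b1 := Real.rpow_pos_of_pos ht0 r
      have b2 := Real.rpow_pos_of_pos ht0 s
      have : t ^ r * t < 1 := by nlinarith
      have : t ^ r * t * t ^ s < 1 := by nlinarith [mul_pos b1 ht0]
      linarith
    · exact h
    · have a1 := Real.one_lt_rpow h hr
      have a2 := Real.one_lt_rpow h hs
      have : 1 < t ^ r * t := by nlinarith
      have : 1 < t ^ r * t * t ^ s := by nlinarith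
      linarith
  rw [← cfc_id' ℝ C, ← cfc_one ℝ C]
  apply cfc_congr
  intro t ht
  simpa using key t ht

lemma R_unit_idem {z : H} (hz : ‖z‖ = 1) : (R z : H →L[ℂ] H) * (R z : H →L[ℂ] H) = R z := by
  ext v
  simp [R_apply, hz]

lemma R_unit_rankOne {z : H} (hz : ‖z‖ = 1) : IsRankOneProjection (R z : H →L[ℂ] H) := by
  refine ⟨(R z).2, R_unit_idem hz, ?_⟩
  have hz0 : z ≠ 0 := by rintro rfl; simp at hz
  have := InnerProductSpace.rank_rankOne (𝕜 := ℂ) hz0 hz0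
  rw [LinearMap.rank, Module.rank_eq_one_iff_finrank_eq_one] at this
  exact this

lemma R_sandwich (z : H) (B : H →L[ℂ] H) :
    (R z : H →L[ℂ] H) * B * (R z : H →L[ℂ] H) = (inner ℂ z (B z) : ℂ) • (R z : H →L[ℂ] H) := by
  ext v
  simp [R_apply, smul_smul, mul_comm]

lemma R_unit_self {z : H} (hz : ‖z‖ = 1) : (R z : H →L[ℂ] H) z = z := by
  simp [R_apply, hz]

end SpecPres
namespace SpecPres

variable {H : Type*} [NormedAddCommGroup H] [InnerProductSpace ℂ H] [CompleteSpace H]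

lemma exists_unit_fix {Q : selfAdjoint (H →L[ℂ] H)} (hQ : (Q : H →L[ℂ] H) * Q = Q)
    (h1 : (1 : ℂ) ∈ spectrum ℂ (Q : H →L[ℂ] H)) :
    ∃ w : H, ‖w‖ = 1 ∧ (Q : H →L[ℂ] H) w = w := by
  have hne : (Q : H →L[ℂ] H) ≠ 0 := by
    intro h0
    have := spec_idem (P := (Q : H →L[ℂ] H)) hQ 0 1 (by
      rw [h0] at h1 ⊢; simpa using h1)
    simp at this
  obtain ⟨v, hv⟩ : ∃ v, (Q : H →L[ℂ] H) v ≠ 0 := by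
    by_contra hc
    push Not at hc
    exact hne (ContinuousLinearMap.ext hc)
  refine ⟨((‖(Q : H →L[ℂ] H) v‖⁻¹ : ℝ) : ℂ) • (Q : H →L[ℂ] H) v, ?_, ?_⟩
  · rw [norm_smul]; simp [hv]
  · rw [map_smul, ← mul_apply_eq_comp, hQ]

lemma R_spec {z : H} (hz : ‖z‖ = 1) : ∀ l ∈ spectrum ℂ (R z : H →L[ℂ] H), l = 0 ∨ l = 1 := by
  intro l hl
  exact spec_idem (R_unit_idem hz) 1 l (by rwa [one_smul])

lemma R_spec_one {z : H} (hz : ‖z‖ = 1) : (1 : ℂ) ∈ spectrum ℂ (R z : H →L[ℂ] H) :=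
  spec_eig (x := z) (by rintro rfl; simp at hz) (by rw [R_unit_self hz, one_smul])

lemma R_phase {c : ℂ} (hc : ‖c‖ = 1) (z : H) : R (c • z) = R z := by
  rw [R_smul, hc, one_pow, sm_one]

lemma R_eq_of_inner {z w : H} (hz : ‖z‖ = 1) (hw : ‖w‖ = 1) (h : ‖(inner ℂ z w : ℂ)‖ = 1) :
    R z = R w := by
  have hz0 : z ≠ 0 := by rintro rfl; simp at hz
  have : w = (inner ℂ z w : ℂ) • z := by
    rw [← sub_eq_zero, ← inner_self_eq_zero (𝕜 := ℂ)]
    have h1 := Complex.conj_mul' (inner ℂ z w)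
    rw [h, inner_conj_symm] at h1
    have hzz : (inner ℂ z z : ℂ) = 1 := by simp [inner_self_eq_norm_sq_to_K, hz]
    have hww : (inner ℂ w w : ℂ) = 1 := by simp [inner_self_eq_norm_sq_to_K, hw]
    simp only [inner_sub_left, inner_sub_right, inner_smul_left, inner_smul_right,
      hzz, hww, inner_conj_symm]
    simp at h1
    linear_combination -h1
  rw [this, R_phase h]

section
variable (φ : selfAdjoint (H →L[ℂ] H) → selfAdjoint (H →L[ℂ] H))
    (hφ : Function.Surjective φ)
    (h1 : ∀ B : selfAdjoint (H →L[ℂ] H), spectrum ℂ (B : H →L[ℂ] H) = spectrum ℂ (φ B : H →L[ℂ] H))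
    (h2 : ∀ z : H, ‖z‖ = 1 → ∀ B : selfAdjoint (H →L[ℂ] H),
      spectrum ℂ ((R z : H →L[ℂ] H) * B * (R z : H →L[ℂ] H)) =
      spectrum ℂ ((φ (R z) : H →L[ℂ] H) * φ B * (φ (R z) : H →L[ℂ] H)))

include h2 in
lemma form_eq {z w : H} (hz : ‖z‖ = 1) (hw : ‖w‖ = 1) (h : φ (R z) = R w)
    (B : selfAdjoint (H →L[ℂ] H)) :
    inner ℂ z ((B : H →L[ℂ] H) z) = inner ℂ w ((φ B : H →L[ℂ] H) w) := by
  have e := h2 z hz B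
  rw [h, R_sandwich, R_sandwich] at e
  have hz0 : z ≠ 0 := by rintro rfl; simp at hz
  have hw0 : w ≠ 0 := by rintro rfl; simp at hw
  set a := inner ℂ z ((B : H →L[ℂ] H) z)
  set b := inner ℂ w ((φ B : H →L[ℂ] H) w)
  have ha : a ∈ spectrum ℂ (a • (R z : H →L[ℂ] H)) :=
    spec_eig hz0 (by rw [smul_apply, R_unit_self hz])
  have hb : b ∈ spectrum ℂ (b • (R w : H →L[ℂ] H)) :=
    spec_eig hw0 (by rw [smul_apply, R_unit_self hw])
  rw [e] at ha
  rw [← e] at hb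
  rcases spec_idem (R_unit_idem hw) _ _ ha with h | h
  · rcases spec_idem (R_unit_idem hz) _ _ hb with h' | h'
    · rw [h, h']
    · exact h'.symm
  · exact h

include hφ h1 h2 in
lemma exists_image {z : H} (hz : ‖z‖ = 1) : ∃ w : H, ‖w‖ = 1 ∧ φ (R z) = R w := by
  have hQ : (φ (R z) : H →L[ℂ] H) * φ (R z) = φ (R z) := by
    apply proj_of_spec
    rw [← h1]
    exact R_spec hz
  obtain ⟨w, hw, hQw⟩ := exists_unit_fix hQ (by rw [← h1]; exact R_spec_one hz)
  refine ⟨w, hw, ?_⟩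
  apply Subtype.ext
  by_contra hne
  obtain ⟨v, hv⟩ : ∃ v, (φ (R z) : H →L[ℂ] H) v ≠ (R w : H →L[ℂ] H) v := by
    by_contra hc
    push Not at hc
    exact hne (ContinuousLinearMap.ext hc)
  have hw0 : w ≠ 0 := by rintro rfl; simp at hw
  set y := (φ (R z) : H →L[ℂ] H) v - (R w : H →L[ℂ] H) v with hy
  have hy0 : y ≠ 0 := sub_ne_zero.2 hv
  have hwy : inner ℂ w y = 0 := by
    rw [hy, inner_sub_right, ← sa_symm, hQw, ← sa_symm, R_unit_self hw, sub_self]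
  have hQy : (φ (R z) : H →L[ℂ] H) y = y := by
    rw [hy, map_sub, ← mul_apply_eq_comp, hQ, R_apply, map_smul, hQw]
  have hyw : inner ℂ y w = 0 := by rw [← inner_conj_symm, hwy, map_zero]
  obtain ⟨B, hB⟩ := hφ (R w + (2 / ‖y‖ ^ 2 : ℝ) • R y)
  have hBv : ∀ v, (φ B : H →L[ℂ] H) v = (R w : H →L[ℂ] H) v +
      ((2 / ‖y‖ ^ 2 : ℝ) : ℂ) • (R y : H →L[ℂ] H) v := by
    intro v; rw [hB]; rfl
  have hyn : (‖y‖ : ℂ) ≠ 0 := by simpa using hy0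
  have e := h2 z hz B
  rw [R_sandwich] at e
  have m1 : (1 : ℂ) ∈ spectrum ℂ ((φ (R z) : H →L[ℂ] H) * φ B * (φ (R z) : H →L[ℂ] H)) := by
    apply spec_eig hw0
    rw [mul_apply_eq_comp, mul_apply_eq_comp, hQw, hBv, R_unit_self hw, R_apply, hyw]
    simp [hQw]
  have m2 : (2 : ℂ) ∈ spectrum ℂ ((φ (R z) : H →L[ℂ] H) * φ B * (φ (R z) : H →L[ℂ] H)) := by
    apply spec_eig hy0
    rw [mul_apply_eq_comp, mul_apply_eq_comp, hQy, hBv, R_apply, R_apply, hwy,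
      inner_self_eq_norm_sq_to_K, smul_smul, zero_smul, zero_add, map_smul, hQy]
    congr 1
    push_cast
    exact div_mul_cancel₀ _ (pow_ne_zero 2 hyn)
  rw [← e] at m1 m2
  rcases spec_idem (R_unit_idem hz) _ _ m1 with h | h
  · simp at h
  rcases spec_idem (R_unit_idem hz) _ _ m2 with h' | h'
  · simp at h'
  rw [← h] at h'
  norm_num at h'

include hφ h1 h2 in
lemma exists_preimage {w : H} (hw : ‖w‖ = 1) : ∃ z : H, ‖z‖ = 1 ∧ φ (R z) = R w := by
  obtain ⟨B, hB⟩ := hφ (R w)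
  have hP : (B : H →L[ℂ] H) * B = B := by
    apply proj_of_spec
    rw [h1, hB]
    exact R_spec hw
  obtain ⟨z, hz, hBz⟩ := exists_unit_fix hP (by rw [h1, hB]; exact R_spec_one hw)
  obtain ⟨w', hw', h⟩ := exists_image φ hφ h1 h2 hz
  refine ⟨z, hz, ?_⟩
  rw [h]
  apply R_eq_of_inner hw' hw
  have e := form_eq φ h2 hz hw' h B
  rw [hBz, hB, R_apply, inner_smul_right, inner_self_eq_norm_sq_to_K, hz] at e
  have e2 := congrArg norm e
  rw [norm_mul, norm_inner_symm w w'] at e2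
  simp at e2
  nlinarith [norm_nonneg (inner ℂ w' w : ℂ)]

include hφ h1 h2 in
lemma preimage_form (w : H) : ∃ z : H,
    ∀ B : selfAdjoint (H →L[ℂ] H),
    inner ℂ z ((B : H →L[ℂ] H) z) = inner ℂ w ((φ B : H →L[ℂ] H) w) := by
  by_cases hw : w = 0
  · exact ⟨0, by simp [hw]⟩
  have hn : (‖w‖ : ℂ) ≠ 0 := by simpa using hw
  obtain ⟨z, hz, h⟩ := exists_preimage φ hφ h1 h2 (w := ((‖w‖⁻¹ : ℝ) : ℂ) • w) (by
    rw [norm_smul]; simp [hw])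
  refine ⟨(‖w‖ : ℂ) • z, fun B => ?_⟩
  have := form_eq φ h2 hz (by rw [norm_smul]; simp [hw]) h B
  simp only [map_smul, inner_smul_left, inner_smul_right] at this ⊢
  rw [this]
  simp
  field_simp

include hφ h1 h2 in
lemma phi_add (A B : selfAdjoint (H →L[ℂ] H)) : φ (A + B) = φ A + φ B := by
  apply sa_ext
  intro w
  obtain ⟨z, h⟩ := preimage_form φ hφ h1 h2 w
  rw [← h]
  change inner ℂ z ((A : H →L[ℂ] H) z + (B : H →L[ℂ] H) z) =
    inner ℂ w ((φ A : H →L[ℂ] H) w + (φ B : H →L[ℂ] H) w)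
  rw [inner_add_right, inner_add_right, h, h]

include hφ h1 h2 in
lemma phi_smul (c : ℝ) (B : selfAdjoint (H →L[ℂ] H)) : φ (c • B) = c • φ B := by
  apply sa_ext
  intro w
  obtain ⟨z, h⟩ := preimage_form φ hφ h1 h2 w
  rw [← h]
  change inner ℂ z ((c : ℂ) • (B : H →L[ℂ] H) z) =
    inner ℂ w ((c : ℂ) • (φ B : H →L[ℂ] H) w)
  rw [inner_smul_right, inner_smul_right, h]

include hφ h1 h2 in
lemma phi_zero : φ 0 = 0 := by
  have := phi_add φ hφ h1 h2 0 0
  rw [add_zero] at this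
  exact left_eq_add.1 this

include hφ h1 h2 in
lemma image_R (z : H) : ∃ w : H, φ (R z) = R w := by
  by_cases hz : z = 0
  · exact ⟨0, by rw [hz, R_zero, phi_zero φ hφ h1 h2]⟩
  obtain ⟨w, hw, h⟩ := exists_image φ hφ h1 h2 (z := ((‖z‖⁻¹ : ℝ) : ℂ) • z) (by
    rw [norm_smul]; simp [hz])
  refine ⟨(‖z‖ : ℂ) • w, ?_⟩
  have hn : (‖z‖ : ℂ) ≠ 0 := by simpa using hz
  have e : z = (‖z‖ : ℂ) • (((‖z‖⁻¹ : ℝ) : ℂ) • z) := by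
    rw [smul_smul]; push_cast; rw [mul_inv_cancel₀ hn, one_smul]
  conv_lhs => rw [e]
  rw [R_smul, phi_smul φ hφ h1 h2, h, R_smul]

include hφ h1 h2 in
lemma preimage_R (w : H) : ∃ z : H, φ (R z) = R w := by
  by_cases hz : w = 0
  · exact ⟨0, by rw [hz, R_zero, phi_zero φ hφ h1 h2]⟩
  obtain ⟨z, hw, h⟩ := exists_preimage φ hφ h1 h2 (w := ((‖w‖⁻¹ : ℝ) : ℂ) • w) (by
    rw [norm_smul]; simp [hz])
  refine ⟨(‖w‖ : ℂ) • z, ?_⟩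
  have hn : (‖w‖ : ℂ) ≠ 0 := by simpa using hz
  have e : w = (‖w‖ : ℂ) • (((‖w‖⁻¹ : ℝ) : ℂ) • w) := by
    rw [smul_smul]; push_cast; rw [mul_inv_cancel₀ hn, one_smul]
  conv_rhs => rw [e]
  rw [R_smul, phi_smul φ hφ h1 h2, h, ← R_smul]

include hφ h1 h2 in
lemma form_eq_gen {z w : H} (h : φ (R z) = R w) (B : selfAdjoint (H →L[ℂ] H)) :
    inner ℂ z ((B : H →L[ℂ] H) z) = inner ℂ w ((φ B : H →L[ℂ] H) w) := by
  by_cases hz : z = 0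
  · have : R w = R 0 := by
      rw [← h, hz, R_zero, phi_zero φ hφ h1 h2]
    obtain ⟨c, -, hc⟩ := R_inj this.symm
    rw [hc, hz]; simp
  have hn : (‖z‖ : ℂ) ≠ 0 := by simpa using hz
  have hu : ‖((‖z‖⁻¹ : ℝ) : ℂ) • z‖ = 1 := by rw [norm_smul]; simp [hz]
  obtain ⟨u, hu1, hu2⟩ := exists_image φ hφ h1 h2 hu
  have e : R u = R (((‖z‖⁻¹ : ℝ) : ℂ) • w) := by
    rw [R_smul, ← h, ← phi_smul φ hφ h1 h2, ← R_smul, hu2]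
  have hw1 : ‖((‖z‖⁻¹ : ℝ) : ℂ) • w‖ = 1 := by
    obtain ⟨c, hc, hcu⟩ := R_inj e
    rw [hcu, norm_smul, hc, hu1, one_mul]
  have := form_eq φ h2 hu hw1 (hu2.trans e) B
  simp only [map_smul, inner_smul_left, inner_smul_right, Complex.conj_ofReal] at this
  have hn' : ((‖z‖⁻¹ : ℝ) : ℂ) ≠ 0 := by simpa using hz
  exact mul_left_cancel₀ hn' (mul_left_cancel₀ hn' this)

end

end SpecPres
namespace SpecPres

variable {H : Type*} [NormedAddCommGroup H] [InnerProductSpace ℂ H] [CompleteSpace H]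

/-- The symmetrised rank two operator. -/
noncomputable def S (e x : H) : selfAdjoint (H →L[ℂ] H) :=
  ⟨InnerProductSpace.rankOne ℂ e x + InnerProductSpace.rankOne ℂ x e, by
    rw [selfAdjoint.mem_iff, star_add, ContinuousLinearMap.star_eq_adjoint,
      ContinuousLinearMap.star_eq_adjoint, InnerProductSpace.adjoint_rankOne,
      InnerProductSpace.adjoint_rankOne, add_comm]⟩

lemma S_apply (e x v : H) :
    (S e x : H →L[ℂ] H) v = inner ℂ x v • e + inner ℂ e v • x := rfl

lemma S_add (e x y : H) : S e (x + y) = S e x + S e y := by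
  ext v
  change (S e (x + y) : H →L[ℂ] H) v = (S e x : H →L[ℂ] H) v + (S e y : H →L[ℂ] H) v
  simp only [S_apply, inner_add_left]
  module

lemma S_smul (e x : H) (t : ℝ) : S e ((t : ℂ) • x) = t • S e x := by
  ext v
  change (S e ((t : ℂ) • x) : H →L[ℂ] H) v = (t : ℂ) • (S e x : H →L[ℂ] H) v
  simp only [S_apply, inner_smul_left, Complex.conj_ofReal]
  module

lemma R_add (e x : H) : R (e + x) = R e + S e x + R x := by
  ext v
  change (R (e + x) : H →L[ℂ] H) v =
    (R e : H →L[ℂ] H) v + (S e x : H →L[ℂ] H) v + (R x : H →L[ℂ] H) v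
  simp only [R_apply, S_apply, inner_add_left]
  module

lemma two_cancel {A B C : selfAdjoint (H →L[ℂ] H)}
    (h : (2 : ℝ) • A + (2 : ℝ) • B = (2 : ℝ) • A + (2 : ℝ) • C) : B = C := by
  have h' := add_left_cancel h
  apply Subtype.ext
  have h2 : (2 : ℝ) • (B : H →L[ℂ] H) = (2 : ℝ) • (C : H →L[ℂ] H) := congrArg Subtype.val h'
  exact smul_right_injective _ (two_ne_zero : (2 : ℝ) ≠ 0) h2

section
variable (φ : selfAdjoint (H →L[ℂ] H) → selfAdjoint (H →L[ℂ] H))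
    (ha : ∀ A B, φ (A + B) = φ A + φ B)
    (hm : ∀ (t : ℝ) A, φ (t • A) = t • φ A)
    (hI : ∀ z : H, ∃ w : H, φ (R z) = R w)
    (hF : ∀ z w : H, φ (R z) = R w → ∀ B : selfAdjoint (H →L[ℂ] H),
      inner ℂ z ((B : H →L[ℂ] H) z) = inner ℂ w ((φ B : H →L[ℂ] H) w))
    (e f : H) (he : ‖e‖ = 1) (hf : ‖f‖ = 1) (hef : φ (R e) = R f)

/-- The linear map on the complement of `e`. -/
noncomputable def V (x : H) : H := (φ (S e x) : H →L[ℂ] H) f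

include ha in
lemma V_add (x y : H) : V φ e f (x + y) = V φ e f x + V φ e f y := by
  rw [V, S_add, ha]; rfl

include hm in
lemma V_smul (t : ℝ) (x : H) : V φ e f ((t : ℂ) • x) = (t : ℂ) • V φ e f x := by
  rw [V, S_smul, hm]; rfl

include hI hF hef in
lemma phi_R_perp {x : H} (hx : inner ℂ e x = 0) : (φ (R x) : H →L[ℂ] H) f = 0 := by
  obtain ⟨y, hy⟩ := hI x
  have h := hF e f hef (R x)
  rw [hy, R_apply, R_apply, inner_smul_right, inner_smul_right, hx, mul_zero] at h
  have : inner ℂ y f = 0 := by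
    rcases mul_eq_zero.1 h.symm with h | h
    · exact h
    · rw [← inner_conj_symm, h, map_zero]
  rw [hy, R_apply, this, zero_smul]

include ha hI hF hef he hf in
lemma phi_R_e_add {x : H} (hx : inner ℂ e x = 0) : φ (R (e + x)) = R (f + V φ e f x) := by
  obtain ⟨w, hw⟩ := hI (e + x)
  have h := hF e f hef (R (e + x))
  rw [hw, R_apply, R_apply, inner_smul_right, inner_smul_right] at h
  have hee : (inner ℂ e e : ℂ) = 1 := by simp [inner_self_eq_norm_sq_to_K, he]
  have hx' : inner ℂ x e = 0 := by rw [← inner_conj_symm, hx, map_zero]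
  rw [inner_add_left, inner_add_right, hx, hx', hee] at h
  have hn := congrArg norm h
  rw [norm_mul, norm_mul, norm_inner_symm f w] at hn
  have hn' : ‖(inner ℂ w f : ℂ)‖ = 1 := by
    simp at hn
    nlinarith [norm_nonneg (inner ℂ w f : ℂ)]
  have hu : (φ (R (e + x)) : H →L[ℂ] H) f = f + V φ e f x := by
    rw [R_add, ha, ha, hef]
    change (R f : H →L[ℂ] H) f + V φ e f x + (φ (R x) : H →L[ℂ] H) f = _
    rw [phi_R_perp φ hI hF e f hef hx, R_unit_self hf, add_zero]
  rw [← hu, hw, R_apply, R_phase hn']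

include ha hm hI hF hef he hf in
lemma phi_R_V {x : H} (hx : inner ℂ e x = 0) : φ (R x) = R (V φ e f x) := by
  have h1 := phi_R_e_add φ ha hI hF e f he hf hef hx
  have hx2 : inner ℂ e (((-1 : ℝ) : ℂ) • x) = 0 := by rw [inner_smul_right, hx, mul_zero]
  have h2 := phi_R_e_add φ ha hI hF e f he hf hef hx2
  rw [V_smul φ hm] at h2
  have e1 : e + ((-1 : ℝ) : ℂ) • x = e - x := by push_cast; module
  have e2 : f + ((-1 : ℝ) : ℂ) • V φ e f x = f - V φ e f x := by push_cast; module
  rw [e1, e2] at h2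
  have h3 := congrArg φ (R_par e x)
  rw [ha, ha, hm, hm, h1, h2, R_par, hef] at h3
  exact (two_cancel h3).symm

include ha hm hI hF hef he hf in
lemma V_I {x : H} (hx : inner ℂ e x = 0) :
    V φ e f (Complex.I • x) = Complex.I • V φ e f x ∨
    V φ e f (Complex.I • x) = -(Complex.I • V φ e f x) := by
  have hix : inner ℂ e (Complex.I • x) = 0 := by rw [inner_smul_right, hx, mul_zero]
  have h1 := phi_R_V φ ha hm hI hF e f he hf hef hx
  have h2 := phi_R_V φ ha hm hI hF e f he hf hef hix
  rw [R_phase Complex.norm_I, h1] at h2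
  obtain ⟨c, hc, hcV⟩ := R_inj h2
  by_cases hV : V φ e f x = 0
  · left; rw [hcV, hV]; simp
  have hs : inner ℂ e ((1 + Complex.I) • x) = 0 := by rw [inner_smul_right, hx, mul_zero]
  have h3 := phi_R_V φ ha hm hI hF e f he hf hef hs
  have e3 : V φ e f ((1 + Complex.I) • x) = (1 + c) • V φ e f x := by
    rw [add_smul, V_add φ ha, one_smul, hcV, add_smul, one_smul]
  rw [e3, R_smul, hm, h1, R_smul] at h3
  have h4 : ‖1 + Complex.I‖ ^ 2 = ‖1 + c‖ ^ 2 := by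
    have h5 := congrArg (fun A : selfAdjoint (H →L[ℂ] H) => (A : H →L[ℂ] H)) h3
    change (‖1 + Complex.I‖ ^ 2) • (R (V φ e f x) : H →L[ℂ] H) =
      (‖1 + c‖ ^ 2) • (R (V φ e f x) : H →L[ℂ] H) at h5
    have h6 : (R (V φ e f x) : H →L[ℂ] H) ≠ 0 := by
      rw [R, ← norm_ne_zero_iff, InnerProductSpace.norm_rankOne]
      simpa using hV
    exact smul_left_injective ℝ h6 h5
  rw [← Complex.normSq_eq_norm_sq, ← Complex.normSq_eq_norm_sq, Complex.normSq_apply,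
    Complex.normSq_apply] at h4
  have h7 : c.re * c.re + c.im * c.im = 1 := by
    rw [← Complex.normSq_apply, Complex.normSq_eq_norm_sq, hc]; norm_num
  simp at h4
  have hre : c.re = 0 := by nlinarith
  rw [hre] at h7
  have him : (c.im - 1) * (c.im + 1) = 0 := by linarith
  rcases mul_eq_zero.1 him with h | h
  · left
    have : c = Complex.I := by
      apply Complex.ext
      · simpa using hre
      · simp; linarith
    rw [hcV, this]
  · right
    have : c = -Complex.I := by
      apply Complex.ext
      · simpa using hre
      · simp; linarith
    rw [hcV, this, neg_smul]

include ha hm hI hF hef he hf in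
lemma V_I_unif :
    (∀ x : H, inner ℂ e x = 0 → V φ e f (Complex.I • x) = Complex.I • V φ e f x) ∨
    (∀ x : H, inner ℂ e x = 0 → V φ e f (Complex.I • x) = -(Complex.I • V φ e f x)) := by
  by_contra hc
  push Not at hc
  obtain ⟨⟨x, hx, hx'⟩, ⟨y, hy, hy'⟩⟩ := hc
  have h1 := (V_I φ ha hm hI hF e f he hf hef hx).resolve_left hx'
  have h2 := (V_I φ ha hm hI hF e f he hf hef hy).resolve_right hy'
  have hxy : inner ℂ e (x + y) = 0 := by rw [inner_add_right, hx, hy, add_zero]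
  have h3 := V_I φ ha hm hI hF e f he hf hef hxy
  rw [smul_add, V_add φ ha, V_add φ ha, smul_add] at h3
  rcases h3 with h3 | h3
  · rw [h2] at h3
    exact hx' (add_right_cancel h3)
  · rw [h1, neg_add] at h3
    exact hy' (add_left_cancel h3)

include ha hm hI hF hef he hf in
lemma T_gen (k : ℂ →+* ℂ) (hk : ∀ c, ‖k c‖ = ‖c‖)
    (hV : ∀ (c : ℂ) (x : H), inner ℂ e x = 0 → V φ e f (c • x) = k c • V φ e f x) :
    ∃ T : H → H, (∀ x y, T (x + y) = T x + T y) ∧ (∀ (c : ℂ) x, T (c • x) = k c • T x) ∧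
      ∀ z, φ (R z) = R (T z) := by
  have hee : (inner ℂ e e : ℂ) = 1 := by simp [inner_self_eq_norm_sq_to_K, he]
  have hperp : ∀ z : H, inner ℂ e (z - (inner ℂ e z : ℂ) • e) = 0 := by
    intro z
    rw [inner_sub_right, inner_smul_right, hee, mul_one, sub_self]
  refine ⟨fun z => k (inner ℂ e z) • f + V φ e f (z - (inner ℂ e z : ℂ) • e), ?_, ?_, ?_⟩
  · intro x y
    have : x + y - (inner ℂ e (x + y) : ℂ) • e =
        (x - (inner ℂ e x : ℂ) • e) + (y - (inner ℂ e y : ℂ) • e) := by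
      rw [inner_add_right]; module
    simp only [this]
    rw [V_add φ ha, inner_add_right, map_add]
    module
  · intro c x
    have : c • x - (inner ℂ e (c • x) : ℂ) • e = c • (x - (inner ℂ e x : ℂ) • e) := by
      rw [inner_smul_right]; module
    simp only [this]
    rw [hV _ _ (hperp x), inner_smul_right, map_mul]
    module
  · intro z
    have hp := hperp z
    set a : ℂ := inner ℂ e z with haa
    set x := z - a • e with hx
    change φ (R z) = R (k a • f + V φ e f x)
    by_cases h0 : a = 0
    · have : z = x := by rw [hx, h0]; simp
      rw [h0, map_zero, zero_smul, zero_add, ← phi_R_V φ ha hm hI hF e f he hf hef hp, ← this]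
    · have hz : z = a • (e + a⁻¹ • x) := by
        rw [smul_add, smul_smul, mul_inv_cancel₀ h0, one_smul, hx]; module
      have hp' : inner ℂ e (a⁻¹ • x) = 0 := by rw [inner_smul_right, hp, mul_zero]
      have hka : k a ≠ 0 := by simpa using h0
      have hT : k a • f + V φ e f x = k a • (f + V φ e f (a⁻¹ • x)) := by
        rw [hV _ _ hp, smul_add, smul_smul, ← map_mul, mul_inv_cancel₀ h0, map_one, one_smul]
      rw [hT, R_smul, hk, ← phi_R_e_add φ ha hI hF e f he hf hef hp', ← hm, ← R_smul, ← hz]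

include ha hm hI hF hef he hf in
lemma T_exists :
    ∃ k : ℂ →+* ℂ, (k = RingHom.id ℂ ∨ k = starRingEnd ℂ) ∧
    ∃ T : H → H, (∀ x y, T (x + y) = T x + T y) ∧ (∀ (c : ℂ) x, T (c • x) = k c • T x) ∧
      ∀ z, φ (R z) = R (T z) := by
  have hsplit : ∀ (c : ℂ) (x : H), V φ e f (c • x) =
      (c.re : ℂ) • V φ e f x + (c.im : ℂ) • V φ e f (Complex.I • x) := by
    intro c x
    rw [← V_smul φ hm, ← V_smul φ hm, ← V_add φ ha, smul_smul, ← add_smul, Complex.re_add_im]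
  rcases V_I_unif φ ha hm hI hF e f he hf hef with h | h
  · refine ⟨RingHom.id ℂ, Or.inl rfl,
      T_gen φ ha hm hI hF e f he hf hef (RingHom.id ℂ) (fun _ => rfl) ?_⟩
    intro c x hx
    rw [hsplit, h x hx, smul_smul, ← add_smul, Complex.re_add_im]; rfl
  · refine ⟨starRingEnd ℂ, Or.inr rfl,
      T_gen φ ha hm hI hF e f he hf hef (starRingEnd ℂ) (fun c => RCLike.norm_conj c) ?_⟩
    intro c x hx
    rw [hsplit, h x hx, smul_neg, smul_smul, ← neg_smul, ← add_smul]
    congr 1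
    apply Complex.ext <;> simp

end

end SpecPres
theorem spectrum_preserver_selfAdjoint_two_sided
    {H : Type*} [NormedAddCommGroup H] [InnerProductSpace ℂ H] [CompleteSpace H]
    (hH : ¬ FiniteDimensional ℂ H)
    (r s : ℚ) (hr : 0 < r) (hs : 0 < s) (hrs : 1 < r + s)
    (φ : selfAdjoint (H →L[ℂ] H) → selfAdjoint (H →L[ℂ] H))
    (hφ : Function.Surjective φ)
    (hspec : ∀ A : selfAdjoint (H →L[ℂ] H),
      (IsRankOneProjection (A : H →L[ℂ] H) ∨ (A : H →L[ℂ] H) = 1) →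
      ∀ B : selfAdjoint (H →L[ℂ] H),
        spectrum ℂ (absPow (A : H →L[ℂ] H) r * (B : H →L[ℂ] H) * absPow (A : H →L[ℂ] H) s) =
        spectrum ℂ (absPow (φ A : H →L[ℂ] H) r * (φ B : H →L[ℂ] H) *
          absPow (φ A : H →L[ℂ] H) s)):
    (∃ T : H ≃ₗᵢ[ℂ] H, ∀ A : selfAdjoint (H →L[ℂ] H), ∀ x : H,
        (φ A : H →L[ℂ] H) x = T ((A : H →L[ℂ] H) (T.symm x))) ∨
    (∃ T : H ≃ₛₗᵢ[starRingEnd ℂ] H, ∀ A : selfAdjoint (H →L[ℂ] H), ∀ x : H,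
        (φ A : H →L[ℂ] H) x = T ((A : H →L[ℂ] H) (T.symm x))) := by
  have hr' : (0 : ℝ) < (r : ℝ) := by exact_mod_cast hr
  have hs' : (0 : ℝ) < (s : ℝ) := by exact_mod_cast hs
  have hnt : Nontrivial H := by
    by_contra hc
    rw [not_nontrivial_iff_subsingleton] at hc
    exact hH inferInstance
  have one_sa : IsSelfAdjoint (1 : H →L[ℂ] H) := IsSelfAdjoint.one _
  have one_abs : ∀ p : ℝ, 0 < p → absPow (1 : H →L[ℂ] H) p = 1 := fun p hp =>
    SpecPres.absPow_proj one_sa (one_mul 1) hp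
  -- `φ 1 = 1`
  have hphi1 : φ 1 = 1 := by
    apply Subtype.ext
    apply SpecPres.eq_one_of_spec (φ 1).2 hr' hs'
    intro l hl
    rw [← hspec 1 (Or.inr rfl) 1] at hl
    change l ∈ spectrum ℂ (absPow (1 : H →L[ℂ] H) r * 1 * absPow (1 : H →L[ℂ] H) s) at hl
    rw [one_abs _ hr', one_abs _ hs', one_mul, one_mul, spectrum.one_eq] at hl
    exact hl
  have h1 : ∀ B : selfAdjoint (H →L[ℂ] H),
      spectrum ℂ (B : H →L[ℂ] H) = spectrum ℂ (φ B : H →L[ℂ] H) := by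
    intro B
    have h := hspec 1 (Or.inr rfl) B
    rw [hphi1] at h
    change spectrum ℂ (absPow (1 : H →L[ℂ] H) r * B * absPow (1 : H →L[ℂ] H) s) =
      spectrum ℂ (absPow (1 : H →L[ℂ] H) r * φ B * absPow (1 : H →L[ℂ] H) s) at h
    rw [one_abs _ hr', one_abs _ hs', one_mul, mul_one, one_mul, mul_one] at h
    exact h
  have h2 : ∀ z : H, ‖z‖ = 1 → ∀ B : selfAdjoint (H →L[ℂ] H),
      spectrum ℂ ((SpecPres.R z : H →L[ℂ] H) * B * (SpecPres.R z : H →L[ℂ] H)) =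
      spectrum ℂ ((φ (SpecPres.R z) : H →L[ℂ] H) * φ B * (φ (SpecPres.R z) : H →L[ℂ] H)) := by
    intro z hz B
    have h := hspec _ (Or.inl (SpecPres.R_unit_rankOne hz)) B
    have hQ : (φ (SpecPres.R z) : H →L[ℂ] H) * φ (SpecPres.R z) = φ (SpecPres.R z) := by
      apply SpecPres.proj_of_spec
      rw [← h1]
      exact SpecPres.R_spec hz
    rwa [SpecPres.absPow_proj (SpecPres.R z).2 (SpecPres.R_unit_idem hz) hr',
      SpecPres.absPow_proj (SpecPres.R z).2 (SpecPres.R_unit_idem hz) hs',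
      SpecPres.absPow_proj (φ (SpecPres.R z)).2 hQ hr',
      SpecPres.absPow_proj (φ (SpecPres.R z)).2 hQ hs'] at h
  have hF := fun z w (h : φ (SpecPres.R z) = SpecPres.R w) =>
    SpecPres.form_eq_gen φ hφ h1 h2 h
  obtain ⟨e, he⟩ := exists_norm_eq H (zero_le_one : (0 : ℝ) ≤ 1)
  obtain ⟨f, hf, hef⟩ := SpecPres.exists_image φ hφ h1 h2 he
  obtain ⟨k, hk, T, hTa, hTs, hTR⟩ := SpecPres.T_exists φ (SpecPres.phi_add φ hφ h1 h2)
    (SpecPres.phi_smul φ hφ h1 h2) (SpecPres.image_R φ hφ h1 h2) hF e f he hf hef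
  have hTn : ∀ z, ‖T z‖ = ‖z‖ := by
    intro z
    have h := hF z (T z) (hTR z) 1
    rw [hphi1] at h
    change inner ℂ z z = inner ℂ (T z) (T z) at h
    rw [inner_self_eq_norm_sq_to_K, inner_self_eq_norm_sq_to_K] at h
    have h' : ‖z‖ ^ 2 = ‖T z‖ ^ 2 := by exact_mod_cast h
    exact ((sq_eq_sq₀ (norm_nonneg _) (norm_nonneg _)).1 h').symm
  have hTsurj : Function.Surjective T := by
    intro w
    obtain ⟨z, hz⟩ := SpecPres.preimage_R φ hφ h1 h2 w
    rw [hTR] at hz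
    obtain ⟨c, -, hc⟩ := SpecPres.R_inj hz
    refine ⟨k c • z, ?_⟩
    rw [hTs, hc]
    rcases hk with rfl | rfl
    · rfl
    · simp
  rcases hk with rfl | rfl
  · left
    let L : H →ₗᵢ[ℂ] H :=
      { toFun := T, map_add' := hTa, map_smul' := hTs, norm_map' := hTn }
    let U : H ≃ₗᵢ[ℂ] H := LinearIsometryEquiv.ofSurjective L hTsurj
    have hU : ∀ z, U z = T z := fun z => rfl
    refine ⟨U, fun A x => ?_⟩
    have key : ((φ A : H →L[ℂ] H) : H →ₗ[ℂ] H) =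
        U.toLinearEquiv.toLinearMap ∘ₗ ((A : H →L[ℂ] H) : H →ₗ[ℂ] H) ∘ₗ
          U.symm.toLinearEquiv.toLinearMap := by
      rw [← ext_inner_map]
      intro x
      obtain ⟨z, rfl⟩ := U.surjective x
      change inner ℂ ((φ A : H →L[ℂ] H) (U z)) (U z) =
        inner ℂ (U ((A : H →L[ℂ] H) (U.symm (U z)))) (U z)
      rw [U.symm_apply_apply, U.inner_map_map, SpecPres.sa_symm, SpecPres.sa_symm]
      exact (hF z (T z) (hTR z) A).symm
    exact LinearMap.congr_fun key x
  · right
    let L : H →ₛₗᵢ[starRingEnd ℂ] H :=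
      { toFun := T, map_add' := hTa, map_smul' := hTs, norm_map' := hTn }
    let U : H ≃ₛₗᵢ[starRingEnd ℂ] H := LinearIsometryEquiv.ofSurjective L hTsurj
    have hU : ∀ z, U z = T z := fun z => rfl
    -- antiunitarity
    have hinner : ∀ x y : H, inner ℂ (U x) (U y) = inner ℂ y x := by
      intro x y
      have hI : Complex.I • U y = - U (Complex.I • y) := by
        rw [map_smulₛₗ]; simp
      have n1 : ‖U x + U y‖ = ‖y + x‖ := by
        rw [← map_add, U.norm_map, add_comm]
      have n2 : ‖U x - U y‖ = ‖y - x‖ := by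
        rw [← map_sub, U.norm_map, norm_sub_rev]
      have n3 : ‖U x - Complex.I • U y‖ = ‖y - Complex.I • x‖ := by
        have : Complex.I • (y - Complex.I • x) = x + Complex.I • y := by
          rw [smul_sub, smul_smul, Complex.I_mul_I]; module
        rw [hI, sub_neg_eq_add, ← map_add, U.norm_map, ← this, norm_smul, Complex.norm_I, one_mul]
      have n4 : ‖U x + Complex.I • U y‖ = ‖y + Complex.I • x‖ := by
        have : (-Complex.I) • (y + Complex.I • x) = x - Complex.I • y := by
          rw [smul_add, smul_smul, neg_mul, Complex.I_mul_I]; module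
        rw [hI, ← sub_eq_add_neg, ← map_sub, U.norm_map, ← this, norm_smul, norm_neg,
          Complex.norm_I, one_mul]
      rw [inner_eq_sum_norm_sq_div_four, inner_eq_sum_norm_sq_div_four y x]
      change ((‖U x + U y‖ : ℂ) ^ 2 - (‖U x - U y‖ : ℂ) ^ 2 +
        ((‖U x - Complex.I • U y‖ : ℂ) ^ 2 - (‖U x + Complex.I • U y‖ : ℂ) ^ 2) * Complex.I) / 4 =
        ((‖y + x‖ : ℂ) ^ 2 - (‖y - x‖ : ℂ) ^ 2 +
        ((‖y - Complex.I • x‖ : ℂ) ^ 2 - (‖y + Complex.I • x‖ : ℂ) ^ 2) * Complex.I) / 4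
      rw [n1, n2, n3, n4]
    refine ⟨U, fun A x => ?_⟩
    have key : ((φ A : H →L[ℂ] H) : H →ₗ[ℂ] H) =
        U.toLinearEquiv.toLinearMap.comp (((A : H →L[ℂ] H) : H →ₗ[ℂ] H).comp
          U.symm.toLinearEquiv.toLinearMap) := by
      rw [← ext_inner_map]
      intro x
      obtain ⟨z, rfl⟩ := U.surjective x
      change inner ℂ ((φ A : H →L[ℂ] H) (U z)) (U z) =
        inner ℂ (U ((A : H →L[ℂ] H) (U.symm (U z)))) (U z)
      rw [U.symm_apply_apply, hinner, SpecPres.sa_symm]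
      exact (hF z (T z) (hTR z) A).symm
    exact LinearMap.congr_fun key x
end

section
/- Let H be an infinite-dimensional complex Hilbert space, let r be a positive rational number with r > 1, and let φ : S(H) → S(H) be a surjective map satisfying σ(|A|^r B) = σ(|φ(A)|^r φ(B)) for every A in P₁(H) ∪ {I} and every B ∈ S(H). Then there exists a bounded linear or conjugate-linear bijection T : H → H with T* = T⁻¹ such that φ(A) = T A T* for all A ∈ S(H). -/
open scoped InnerProductSpace

section aux
set_option linter.unusedSectionVars false
variable {H : Type*} [NormedAddCommGroup H] [InnerProductSpace ℂ H] [CompleteSpace H]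

open InnerProductSpace

lemma aux_absPow_eq (C : H →L[ℂ] H) (hC : IsSelfAdjoint C) (r : ℝ) (hr : 0 < r) :
    absPow C r = cfc (fun t : ℝ => |t| ^ r) C := by
  have h1 : absOp C = cfc (fun t : ℝ => |t|) C := by
    unfold absOp
    have h2 : star C * C = cfc (fun t : ℝ => t ^ 2) C := by
      rw [hC.star_eq, cfc_pow_id (R := ℝ) C 2, sq]
    rw [h2, ← cfc_comp' (R := ℝ) (fun t => Real.sqrt t) (fun t => t ^ 2) C]
    simp_rw [Real.sqrt_sq_eq_abs]
  unfold absPow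
  rw [h1, ← cfc_comp' (R := ℝ) (fun t => t ^ r) (fun t => |t|) C
    ((Real.continuous_rpow_const hr.le).continuousOn)]

lemma aux_spec_real (C : H →L[ℂ] H) (S : Set ℝ) (h : spectrum ℂ C ⊆ (fun t : ℝ => (t : ℂ)) '' S) :
    spectrum ℝ C ⊆ S := by
  intro t ht
  have := (spectrum.algebraMap_mem_iff ℂ (a := C) (r := t)).2 ht
  obtain ⟨s, hs, hst⟩ := h this
  have : s = t := Complex.ofReal_injective hst
  exact this ▸ hs

lemma aux_absPow_proj (C : H →L[ℂ] H) (hC : IsSelfAdjoint C) (r : ℝ) (hr : 0 < r)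
    (h : spectrum ℂ C ⊆ {0, 1}) : absPow C r = C ∧ C * C = C := by
  have h' : spectrum ℝ C ⊆ {0, 1} := by
    apply aux_spec_real
    refine h.trans ?_
    simp [Set.image_pair]
  constructor
  · rw [aux_absPow_eq C hC r hr]
    conv_rhs => rw [← cfc_id' ℝ C]
    apply cfc_congr
    intro t ht
    rcases h' ht with rfl | rfl
    · simp [hr.ne']
    · simp
  · conv_rhs => rw [← cfc_id' ℝ C]
    rw [← sq, ← cfc_pow_id (R := ℝ) C 2]
    apply cfc_congr
    intro t ht
    rcases h' ht with rfl | rfl <;> simp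

lemma aux_one (C : H →L[ℂ] H) (hC : IsSelfAdjoint C) (r : ℝ) (hr : 0 < r)
    (h : spectrum ℂ (absPow C r * C) ⊆ {1}) : C = 1 := by
  have hcont : Continuous (fun t : ℝ => |t| ^ r) :=
    (Real.continuous_rpow_const hr.le).comp continuous_abs
  have h' : spectrum ℝ (absPow C r * C) ⊆ {1} := by
    apply aux_spec_real
    refine h.trans ?_
    simp
  have h2 : absPow C r * C = cfc (fun t : ℝ => |t| ^ r * t) C := by
    rw [cfc_mul (fun t : ℝ => |t| ^ r) (fun t => t) C hcont.continuousOn, cfc_id' ℝ C,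
      aux_absPow_eq C hC r hr]
  rw [h2, cfc_map_spectrum (R := ℝ) (fun t : ℝ => |t| ^ r * t) C hC
    (hcont.mul continuous_id).continuousOn] at h'
  apply CFC.eq_one_of_spectrum_subset_one (R := ℝ) C _ hC
  intro t ht
  have h3 : |t| ^ r * t = 1 := h' ⟨t, ht, rfl⟩
  have ht0 : 0 < t := by
    by_contra hneg
    have : |t| ^ r * t ≤ 0 := mul_nonpos_of_nonneg_of_nonpos (by positivity) (not_lt.1 hneg)
    linarith
  rw [abs_of_pos ht0] at h3
  have h4 : t ^ (r + 1) = 1 := by rw [Real.rpow_add ht0, Real.rpow_one, h3]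
  exact (Real.rpow_left_inj ht0.le zero_le_one (by linarith : r + 1 ≠ 0)).1 (by rw [h4, Real.one_rpow])

lemma aux_quad (T : H →L[ℂ] H) (c : ℂ) (h : T * T = c • T) : spectrum ℂ T ⊆ {0, c} := by
  intro l hl
  rcases subsingleton_or_nontrivial (H →L[ℂ] H) with hs | hs
  · simp [spectrum.of_subsingleton] at hl
  have := spectrum.subset_polynomial_aeval T (Polynomial.X ^ 2 - Polynomial.C c * Polynomial.X)
    ⟨l, hl, rfl⟩
  have h0 : (Polynomial.aeval T) (Polynomial.X ^ 2 - Polynomial.C c * Polynomial.X) = 0 := by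
    simp [sq, h, Algebra.smul_def]
  rw [h0] at this
  simp at this
  have h5 : l * (l - c) = 0 := by linear_combination this
  rcases mul_eq_zero.1 h5 with h6 | h6
  · left; exact h6
  · right; exact sub_eq_zero.1 h6

lemma aux_eig (T : H →L[ℂ] H) (c : ℂ) (x : H) (hx : x ≠ 0) (h : T x = c • x) :
    c ∈ spectrum ℂ T := by
  rw [spectrum.mem_iff]
  intro hu
  obtain ⟨S, hS⟩ := hu.exists_left_inv
  apply hx
  have := congrArg (fun A : H →L[ℂ] H => A x) hS
  simpa [h, Algebra.algebraMap_eq_smul_one] using this.symm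

lemma aux_sa (x : H) : IsSelfAdjoint (rankOne ℂ x x) := by
  rw [ContinuousLinearMap.isSelfAdjoint_iff']; simp

/-- `x ⊗ x` as a self-adjoint operator -/
noncomputable def pr (x : H) : selfAdjoint (H →L[ℂ] H) := ⟨rankOne ℂ x x, aux_sa x⟩

lemma pr_coe (x : H) : (pr x : H →L[ℂ] H) = rankOne ℂ x x := rfl

lemma pr_apply (x z : H) : (pr x : H →L[ℂ] H) z = inner ℂ x z • x := rfl

lemma pr_proj (x : H) (hx : ‖x‖ = 1) : IsRankOneProjection (pr x : H →L[ℂ] H) := by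
  refine ⟨aux_sa x, isIdempotentElem_rankOne_self hx, ?_⟩
  have hx0 : x ≠ 0 := by rintro rfl; simp at hx
  unfold IsRankOne
  rw [← Module.rank_eq_one_iff_finrank_eq_one]
  exact rank_rankOne hx0 hx0

lemma exists_fix [Nontrivial H] (Q : H →L[ℂ] H) (hQ : Q * Q = Q) (h1 : (1 : ℂ) ∈ spectrum ℂ Q) :
    ∃ u, ‖u‖ = 1 ∧ Q u = u := by
  have hne : Q ≠ 0 := by rintro rfl; simp at h1
  obtain ⟨z, hz⟩ : ∃ z, Q z ≠ 0 := by
    by_contra hcon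
    push Not at hcon
    exact hne (ContinuousLinearMap.ext hcon)
  refine ⟨((‖Q z‖ : ℂ)⁻¹) • Q z, ?_, ?_⟩
  · have := norm_ne_zero_iff.2 hz
    simp [norm_smul, this]
  · have := congrArg (fun A : H →L[ℂ] H => A z) hQ
    simp only [mul_apply_eq_comp] at this
    rw [map_smul, this]

lemma spec_pr_mul_sub (x : H) (B : H →L[ℂ] H) :
    spectrum ℂ ((pr x : H →L[ℂ] H) * B) ⊆ {0, inner ℂ x (B x)} := by
  apply aux_quad
  ext z
  simp [pr_apply, smul_smul, mul_comm]

lemma spec_pr_mul_mem (x : H) (hx : ‖x‖ = 1) (B : H →L[ℂ] H) :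
    inner ℂ x (B x) ∈ spectrum ℂ ((pr x : H →L[ℂ] H) * B) := by
  have hx0 : x ≠ 0 := by rintro rfl; simp at hx
  apply aux_eig _ _ x hx0
  simp [pr_apply]

lemma rank_one_of (Q : H →L[ℂ] H) (hQs : IsSelfAdjoint Q) (hQ : Q * Q = Q) (u : H)
    (hu : ‖u‖ = 1) (hQu : Q u = u)
    (h : ∀ C : H →L[ℂ] H, IsSelfAdjoint C → ∃ t, spectrum ℂ (Q * C) ⊆ {0, t}) :
    Q = rankOne ℂ u u := by
  have hu0 : u ≠ 0 := by rintro rfl; simp at hu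
  have huu : inner ℂ u u = 1 := by simp [inner_self_eq_norm_sq_to_K, hu]
  have key : ∀ v, Q v = v → inner ℂ u v = 0 → v = 0 := by
    intro v hv huv
    by_contra hv0
    have hvu : inner ℂ v u = 0 := inner_eq_zero_symm.1 huv
    set n : ℂ := inner ℂ v v with hn
    have hn0 : n ≠ 0 := by rw [hn]; exact inner_self_ne_zero.2 hv0
    have hnr : (starRingEnd ℂ) n = n := inner_conj_symm v v
    obtain ⟨t, ht⟩ := h (rankOne ℂ u u + (2 / n) • rankOne ℂ v v) (by
      refine (aux_sa u).add ?_
      refine IsSelfAdjoint.smul ?_ (aux_sa v)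
      change (starRingEnd ℂ) (2 / n) = 2 / n
      rw [map_div₀, hnr, map_ofNat])
    have h1 : (1 : ℂ) ∈ ({0, t} : Set ℂ) := ht (by
      apply aux_eig _ _ u hu0
      simp [hvu, hQu, hu])
    have h2 : (2 : ℂ) ∈ ({0, t} : Set ℂ) := ht (by
      apply aux_eig _ _ v hv0
      simp only [mul_apply_eq_comp, add_apply, rankOne_apply,
        smul_apply, huv, zero_smul, zero_add, ← hn, map_smul, hv, smul_smul]
      congr 1
      field_simp)
    simp at h1 h2
    rw [← h1] at h2
    norm_num at h2
  ext z
  have hQQ : Q (Q z) = Q z := by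
    have := congrArg (fun A : H →L[ℂ] H => A z) hQ
    simpa using this
  have h3 : inner ℂ u (Q z) = inner ℂ u z := by
    have := hQs.isSymmetric u z
    simp only [ContinuousLinearMap.coe_coe, hQu] at this
    exact this.symm
  have := key (Q z - inner ℂ u z • u) (by simp [hQQ, hQu]) (by
    rw [inner_sub_right, inner_smul_right, huu, h3]; simp)
  rw [rankOne_apply]
  exact sub_eq_zero.1 this


lemma sa_one_smul (A : selfAdjoint (H →L[ℂ] H)) : (1 : ℝ) • A = A :=
  Subtype.ext (one_smul ℝ (A : H →L[ℂ] H))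

lemma sa_two_smul (A : selfAdjoint (H →L[ℂ] H)) : (2 : ℝ) • A = A + A :=
  Subtype.ext (two_smul ℝ (A : H →L[ℂ] H))

lemma sa_two_cancel (A B : selfAdjoint (H →L[ℂ] H)) (h : (2 : ℝ) • A = (2 : ℝ) • B) : A = B := by
  have h1 : (2 : ℝ) • (A : H →L[ℂ] H) = (2 : ℝ) • (B : H →L[ℂ] H) := congrArg Subtype.val h
  exact Subtype.ext (smul_right_injective _ (two_ne_zero : (2 : ℝ) ≠ 0) h1)

lemma sa_ext (A B : selfAdjoint (H →L[ℂ] H))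
    (h : ∀ y, inner ℂ y ((A : H →L[ℂ] H) y) = inner ℂ y ((B : H →L[ℂ] H) y)) : A = B := by
  apply Subtype.ext
  apply ContinuousLinearMap.coe_injective
  rw [← ext_inner_map]
  intro x
  have := congrArg (starRingEnd ℂ) (h x)
  simpa only [inner_conj_symm, ContinuousLinearMap.coe_coe] using this

lemma pr_smul (a : ℂ) (x : H) : pr (a • x) = (‖a‖ ^ 2 : ℝ) • pr x := by
  apply Subtype.ext
  ext z
  have : (a * (starRingEnd ℂ) a : ℂ) = ((‖a‖ ^ 2 : ℝ) : ℂ) := by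
    rw [Complex.mul_conj, Complex.normSq_eq_norm_sq]
  have h2 : (((‖a‖ ^ 2 : ℝ) • pr x : selfAdjoint (H →L[ℂ] H)) : H →L[ℂ] H) z
    = ((‖a‖ ^ 2 : ℝ) : ℂ) • ((pr x : H →L[ℂ] H) z) := by
    rw [Complex.coe_smul]; rfl
  rw [h2, ← this, pr_apply, pr_apply, inner_smul_left, smul_smul, smul_smul]
  congr 1; ring

lemma unit_decomp (x : H) (hx : x ≠ 0) : ∃ u, ‖u‖ = 1 ∧ x = (‖x‖ : ℂ) • u := by
  have := norm_ne_zero_iff.2 hx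
  refine ⟨((‖x‖ : ℂ)⁻¹) • x, by simp [norm_smul, this], ?_⟩
  rw [smul_smul, mul_inv_cancel₀ (by exact_mod_cast this), one_smul]

lemma quad_smul (a : ℂ) (x : H) (B : H →L[ℂ] H) :
    inner ℂ (a • x) (B (a • x)) = (starRingEnd ℂ) a * a * inner ℂ x (B x) := by
  rw [map_smul, inner_smul_left, inner_smul_right]; ring

variable (r : ℝ) (φ : selfAdjoint (H →L[ℂ] H) → selfAdjoint (H →L[ℂ] H))

lemma step0 [Nontrivial H] (hr : 0 < r) 
    (hspec : ∀ A : selfAdjoint (H →L[ℂ] H),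
      (IsRankOneProjection (A : H →L[ℂ] H) ∨ (A : H →L[ℂ] H) = 1) →
      ∀ B : selfAdjoint (H →L[ℂ] H),
        spectrum ℂ (absPow (A : H →L[ℂ] H) r * (B : H →L[ℂ] H)) =
        spectrum ℂ (absPow (φ A : H →L[ℂ] H) r * (φ B : H →L[ℂ] H))) :
    φ 1 = 1 ∧ ∀ B : selfAdjoint (H →L[ℂ] H), spectrum ℂ (B : H →L[ℂ] H) = spectrum ℂ (φ B : H →L[ℂ] H) := by
  have h1 : absPow (1 : H →L[ℂ] H) r = 1 :=
    (aux_absPow_proj 1 (IsSelfAdjoint.one _) r hr (by simp)).1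
  have hs := hspec 1 (Or.inr rfl)
  have h2 : φ 1 = 1 := by
    apply Subtype.ext
    apply aux_one _ (φ 1).2 r hr
    rw [← hs 1]
    simp [h1]
  refine ⟨h2, fun B => ?_⟩
  have := hs B
  rw [h2] at this
  simpa [h1] using this

lemma step1 [Nontrivial H] (hr : 0 < r) (hφ : Function.Surjective φ)
    (hspec : ∀ A : selfAdjoint (H →L[ℂ] H),
      (IsRankOneProjection (A : H →L[ℂ] H) ∨ (A : H →L[ℂ] H) = 1) →
      ∀ B : selfAdjoint (H →L[ℂ] H),
        spectrum ℂ (absPow (A : H →L[ℂ] H) r * (B : H →L[ℂ] H)) =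
        spectrum ℂ (absPow (φ A : H →L[ℂ] H) r * (φ B : H →L[ℂ] H)))
    (x : H) (hx : ‖x‖ = 1) :
    ∃ y, ‖y‖ = 1 ∧ φ (pr x) = pr y ∧
      ∀ B : selfAdjoint (H →L[ℂ] H), inner ℂ x ((B : H →L[ℂ] H) x) = inner ℂ y ((φ B : H →L[ℂ] H) y) := by
  obtain ⟨-, hsp⟩ := step0 r φ hr hspec
  have hP := pr_proj x hx
  have hPs : spectrum ℂ (pr x : H →L[ℂ] H) ⊆ {0, 1} := IsIdempotentElem.spectrum_subset ℂ hP.2.1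
  have hQs := hPs
  rw [hsp] at hQs
  obtain ⟨ha, -⟩ := aux_absPow_proj _ (pr x).2 r hr hPs
  obtain ⟨hb, hQQ⟩ := aux_absPow_proj _ (φ (pr x)).2 r hr hQs
  have hB := hspec (pr x) (Or.inl hP)
  rw [ha, hb] at hB
  have h1 : (1 : ℂ) ∈ spectrum ℂ (φ (pr x) : H →L[ℂ] H) := by
    rw [← hsp]
    have := spec_pr_mul_mem x hx 1
    simpa [hx] using this
  obtain ⟨u, hu, hQu⟩ := exists_fix _ hQQ h1
  have hQ : φ (pr x) = pr u := by
    apply Subtype.ext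
    apply rank_one_of _ (φ (pr x)).2 hQQ u hu hQu
    intro C hC
    obtain ⟨B, hBC⟩ := hφ ⟨C, hC⟩
    refine ⟨inner ℂ x ((B : H →L[ℂ] H) x), ?_⟩
    have := hB B
    rw [hBC] at this
    rw [← this]
    exact spec_pr_mul_sub x _
  refine ⟨u, hu, hQ, fun B => ?_⟩
  have hBB := hB B
  rw [hQ] at hBB
  have e1 := spec_pr_mul_mem x hx (B : H →L[ℂ] H)
  have e2 := spec_pr_mul_mem u hu (φ B : H →L[ℂ] H)
  rw [hBB] at e1
  rw [← hBB] at e2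
  have e1' := spec_pr_mul_sub _ _ e1
  have e2' := spec_pr_mul_sub _ _ e2
  simp only [Set.mem_insert_iff, Set.mem_singleton_iff] at e1' e2'
  rcases e1' with e | e
  · rcases e2' with e' | e'
    · rw [e, e']
    · exact e'.symm
  · exact e

lemma step2 [Nontrivial H] (hr : 0 < r) (hφ : Function.Surjective φ)
    (hspec : ∀ A : selfAdjoint (H →L[ℂ] H),
      (IsRankOneProjection (A : H →L[ℂ] H) ∨ (A : H →L[ℂ] H) = 1) →
      ∀ B : selfAdjoint (H →L[ℂ] H),
        spectrum ℂ (absPow (A : H →L[ℂ] H) r * (B : H →L[ℂ] H)) =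
        spectrum ℂ (absPow (φ A : H →L[ℂ] H) r * (φ B : H →L[ℂ] H)))
    (y : H) (hy : ‖y‖ = 1) :
    ∃ x, ‖x‖ = 1 ∧ φ (pr x) = pr y ∧
      ∀ B : selfAdjoint (H →L[ℂ] H), inner ℂ x ((B : H →L[ℂ] H) x) = inner ℂ y ((φ B : H →L[ℂ] H) y) := by
  obtain ⟨-, hsp⟩ := step0 r φ hr hspec
  have hP := pr_proj y hy
  have hPs : spectrum ℂ (pr y : H →L[ℂ] H) ⊆ {0, 1} := IsIdempotentElem.spectrum_subset ℂ hP.2.1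
  have h1 : (1 : ℂ) ∈ spectrum ℂ (pr y : H →L[ℂ] H) := by
    have := spec_pr_mul_mem y hy 1
    simpa [hy] using this
  obtain ⟨B, hB⟩ := hφ (pr y)
  rw [← hB, ← hsp] at hPs h1
  obtain ⟨-, hBB⟩ := aux_absPow_proj _ B.2 r hr hPs
  obtain ⟨x, hx, hBx⟩ := exists_fix _ hBB h1
  obtain ⟨z, hz, hxz, hq⟩ := step1 r φ hr hφ hspec x hx
  have h2 := hq B
  have hzz : inner ℂ z z = 1 := by simp [inner_self_eq_norm_sq_to_K, hz]
  have hyy : inner ℂ y y = 1 := by simp [inner_self_eq_norm_sq_to_K, hy]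
  have hxx : inner ℂ x x = 1 := by simp [inner_self_eq_norm_sq_to_K, hx]
  rw [hBx, hB, pr_apply, inner_smul_right, hxx] at h2
  have h3 : z = inner ℂ y z • y := by
    rw [← sub_eq_zero, ← inner_self_eq_zero (𝕜 := ℂ)]
    simp only [inner_sub_left, inner_sub_right, inner_smul_left, inner_smul_right, hzz, hyy,
      inner_conj_symm]
    linear_combination 2 * h2 - h2
  have h4 : pr z = pr y := by
    rw [h3, pr_smul]
    have : ((‖(inner ℂ y z : ℂ)‖ ^ 2 : ℝ) : ℂ) = 1 := by
      rw [← Complex.normSq_eq_norm_sq, ← Complex.mul_conj, inner_conj_symm]; exact h2.symm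
    have : (‖(inner ℂ y z : ℂ)‖ ^ 2 : ℝ) = 1 := by exact_mod_cast this
    rw [this, sa_one_smul]
  refine ⟨x, hx, by rw [hxz, h4], fun C => ?_⟩
  have a1 : ∀ D : H →L[ℂ] H, inner ℂ z (D z) = inner ℂ y (D y) := by
    intro D
    rw [h3, quad_smul, inner_conj_symm, mul_comm (inner ℂ z y), ← h2, one_mul]
  rw [hq, a1]

lemma step3 [Nontrivial H] (hr : 0 < r) (hφ : Function.Surjective φ)
    (hspec : ∀ A : selfAdjoint (H →L[ℂ] H),
      (IsRankOneProjection (A : H →L[ℂ] H) ∨ (A : H →L[ℂ] H) = 1) →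
      ∀ B : selfAdjoint (H →L[ℂ] H),
        spectrum ℂ (absPow (A : H →L[ℂ] H) r * (B : H →L[ℂ] H)) =
        spectrum ℂ (absPow (φ A : H →L[ℂ] H) r * (φ B : H →L[ℂ] H))) :
    ∃ (L : selfAdjoint (H →L[ℂ] H) →ₗ[ℝ] selfAdjoint (H →L[ℂ] H)), (∀ A, L A = φ A) ∧
      (∀ x, ∃ y, L (pr x) = pr y ∧
        ∀ B : selfAdjoint (H →L[ℂ] H), inner ℂ x ((B : H →L[ℂ] H) x) = inner ℂ y ((L B : H →L[ℂ] H) y)) ∧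
      (∀ y, ∃ x, L (pr x) = pr y) := by
  have h1 : ∀ y : H, ∃ x : H, 
      ∀ B : selfAdjoint (H →L[ℂ] H), inner ℂ x ((B : H →L[ℂ] H) x) = inner ℂ y ((φ B : H →L[ℂ] H) y) := by
    intro y
    rcases eq_or_ne y 0 with rfl | hy
    · exact ⟨0, fun B => by simp⟩
    obtain ⟨u, hu, hyu⟩ := unit_decomp y hy
    obtain ⟨x, hx, -, hq⟩ := step2 r φ hr hφ hspec u hu
    refine ⟨(‖y‖ : ℂ) • x, fun B => ?_⟩
    generalize (‖y‖ : ℂ) = c at *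
    rw [hyu, quad_smul, quad_smul, hq]
  let L : selfAdjoint (H →L[ℂ] H) →ₗ[ℝ] selfAdjoint (H →L[ℂ] H) :=
    { toFun := φ
      map_add' := by
        intro A B
        apply sa_ext
        intro y
        obtain ⟨x, hx⟩ := h1 y
        rw [← hx]
        simp [hx]
      map_smul' := by
        intro s A
        apply sa_ext
        intro y
        obtain ⟨x, hx⟩ := h1 y
        rw [← hx]
        simp [inner_smul_right_eq_smul, hx] }
  have hL : ∀ A, L A = φ A := fun A => rfl
  refine ⟨L, hL, ?_, ?_⟩
  · intro x
    rcases eq_or_ne x 0 with rfl | hx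
    · refine ⟨0, ?_, fun B => by simp⟩
      have : (pr (0 : H)) = 0 := by apply Subtype.ext; simp [pr_coe]
      rw [this, map_zero]
    obtain ⟨u, hu, hxu⟩ := unit_decomp x hx
    obtain ⟨y, hy, hpr, hq⟩ := step1 r φ hr hφ hspec u hu
    refine ⟨(‖x‖ : ℂ) • y, ?_, fun B => ?_⟩
    · generalize (‖x‖ : ℂ) = c at *
      rw [hxu, pr_smul, pr_smul, map_smul, hL, hpr]
    · generalize (‖x‖ : ℂ) = c at *
      rw [hxu, quad_smul, quad_smul, hq, hL]
  · intro y
    rcases eq_or_ne y 0 with rfl | hy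
    · refine ⟨0, ?_⟩
      have : (pr (0 : H)) = 0 := by apply Subtype.ext; simp [pr_coe]
      rw [this, map_zero]
    obtain ⟨u, hu, hyu⟩ := unit_decomp y hy
    obtain ⟨x, hx, hpr, -⟩ := step2 r φ hr hφ hspec u hu
    refine ⟨(‖y‖ : ℂ) • x, ?_⟩
    generalize (‖y‖ : ℂ) = c at *
    rw [hyu, pr_smul, pr_smul, map_smul, hL, hpr]

lemma pr_norm {x y : H} (h : pr x = pr y) : ‖x‖ = ‖y‖ := by
  have := congrArg (fun A : selfAdjoint (H →L[ℂ] H) => ‖(A : H →L[ℂ] H)‖) h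
  simp only [pr_coe, norm_rankOne] at this
  nlinarith [norm_nonneg x, norm_nonneg y]

lemma pr_eq {x y : H} (h : pr x = pr y) : ∃ c : ℂ, x = c • y := by
  rcases eq_or_ne x 0 with rfl | hx
  · exact ⟨0, by simp⟩
  have h1 := congrArg (fun A : selfAdjoint (H →L[ℂ] H) => (A : H →L[ℂ] H) x) h
  simp only [pr_apply] at h1
  have h0 : (inner ℂ x x : ℂ) ≠ 0 := inner_self_ne_zero.2 hx
  refine ⟨(inner ℂ x x)⁻¹ * inner ℂ y x, ?_⟩
  rw [← smul_smul, ← h1, smul_smul, inv_mul_cancel₀ h0, one_smul]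

/-- `x ⊗ e + e ⊗ x` -/
noncomputable def KK (e x : H) : selfAdjoint (H →L[ℂ] H) := pr (x + e) - pr x - pr e

lemma KK_apply (e x z : H) : (KK e x : H →L[ℂ] H) z = inner ℂ e z • x + inner ℂ x z • e := by
  have : (KK e x : H →L[ℂ] H) z
    = (pr (x + e) : H →L[ℂ] H) z - (pr x : H →L[ℂ] H) z - (pr e : H →L[ℂ] H) z := rfl
  rw [this]
  simp only [pr_apply, inner_add_left, add_smul, smul_add]
  abel

lemma KK_add (e x y : H) : KK e (x + y) = KK e x + KK e y := by
  apply Subtype.ext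
  ext z
  have : ((KK e x + KK e y : selfAdjoint (H →L[ℂ] H)) : H →L[ℂ] H) z
    = (KK e x : H →L[ℂ] H) z + (KK e y : H →L[ℂ] H) z := rfl
  rw [this]
  simp only [KK_apply, inner_add_left, add_smul, smul_add]
  abel

lemma KK_smul (e x : H) (s : ℝ) : KK e ((s : ℂ) • x) = s • KK e x := by
  apply Subtype.ext
  ext z
  have : ((s • KK e x : selfAdjoint (H →L[ℂ] H)) : H →L[ℂ] H) z
    = (s : ℂ) • (KK e x : H →L[ℂ] H) z := by rw [Complex.coe_smul]; rfl
  rw [this]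
  simp only [KK_apply, inner_smul_left, smul_add, smul_smul, Complex.conj_ofReal]
  rw [mul_comm]

lemma pr_par (x y : H) : pr (x + y) + pr (-x + y) = (2 : ℝ) • pr x + (2 : ℝ) • pr y := by
  rw [sa_two_smul, sa_two_smul]
  apply Subtype.ext
  ext z
  have : ∀ A B : selfAdjoint (H →L[ℂ] H), ((A + B : selfAdjoint (H →L[ℂ] H)) : H →L[ℂ] H) z
    = (A : H →L[ℂ] H) z + (B : H →L[ℂ] H) z := fun _ _ => rfl
  simp only [this, pr_apply, inner_add_left, inner_neg_left, add_smul, smul_add, neg_smul, smul_neg]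
  abel

section wig
variable (L : selfAdjoint (H →L[ℂ] H) →ₗ[ℝ] selfAdjoint (H →L[ℂ] H)) (f : H → H)
  (hf : ∀ x, L (pr x) = pr (f x))
  (hq : ∀ x, ∀ B : selfAdjoint (H →L[ℂ] H),
    inner ℂ x ((B : H →L[ℂ] H) x) = inner ℂ (f x) ((L B : H →L[ℂ] H) (f x)))
  (e : H)

/-- the candidate map -/
noncomputable def RR (x : H) : H := (L (KK e x) : H →L[ℂ] H) (f e)

lemma RR_add (x y : H) : RR L f e (x + y) = RR L f e x + RR L f e y := by
  unfold RR
  rw [KK_add, map_add]; rfl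

lemma RR_smul (s : ℝ) (x : H) : RR L f e ((s : ℂ) • x) = (s : ℂ) • RR L f e x := by
  unfold RR
  rw [KK_smul, map_smul, Complex.coe_smul]; rfl

lemma RR_neg (x : H) : RR L f e (-x) = -RR L f e x := by
  have := RR_smul L f e (-1) x
  simpa using this

lemma RR_main (hf : ∀ x, L (pr x) = pr (f x))
    (hq : ∀ x, ∀ B : selfAdjoint (H →L[ℂ] H),
      inner ℂ x ((B : H →L[ℂ] H) x) = inner ℂ (f x) ((L B : H →L[ℂ] H) (f x)))
    (he : ‖e‖ = 1) (hg : ‖f e‖ = 1) (x : H) (hx : inner ℂ e x = 0) :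
    L (pr (x + e)) = pr (RR L f e x + f e) := by
  have hee : inner ℂ e e = 1 := by simp [inner_self_eq_norm_sq_to_K, he]
  have hgg : inner ℂ (f e) (f e) = 1 := by simp [inner_self_eq_norm_sq_to_K, hg]
  have h1 := hq (x + e) (pr e)
  have h2 := hq x (pr e)
  rw [hf, pr_apply, pr_apply, inner_smul_right, inner_smul_right] at h1 h2
  rw [hx, zero_mul] at h2
  have hxe : inner ℂ x e = 0 := inner_eq_zero_symm.1 hx
  have h3 : inner ℂ (f x) (f e) = 0 := by
    rcases mul_eq_zero.1 h2.symm with h | h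
    · exact inner_eq_zero_symm.1 h
    · exact h
  have h4 : RR L f e x + f e = inner ℂ (f (x + e)) (f e) • f (x + e) := by
    have : RR L f e x = (pr (f (x + e)) : H →L[ℂ] H) (f e) - (pr (f x) : H →L[ℂ] H) (f e)
      - (pr (f e) : H →L[ℂ] H) (f e) := by
      unfold RR KK
      rw [map_sub, map_sub, hf, hf, hf]; rfl
    rw [this, pr_apply, pr_apply, pr_apply, h3, hgg]
    simp
  rw [inner_add_left, inner_add_right, hx, hxe, hee, zero_add, one_mul] at h1
  have h5 : ((‖(inner ℂ (f (x + e)) (f e) : ℂ)‖ ^ 2 : ℝ) : ℂ) = 1 := by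
    rw [← Complex.normSq_eq_norm_sq, ← Complex.mul_conj, inner_conj_symm, h1, mul_comm]
  have h6 : (‖(inner ℂ (f (x + e)) (f e) : ℂ)‖ ^ 2 : ℝ) = 1 := by exact_mod_cast h5
  rw [h4, pr_smul, h6, sa_one_smul, hf]

lemma RR_main2 (hf : ∀ x, L (pr x) = pr (f x))
    (hq : ∀ x, ∀ B : selfAdjoint (H →L[ℂ] H),
      inner ℂ x ((B : H →L[ℂ] H) x) = inner ℂ (f x) ((L B : H →L[ℂ] H) (f x)))
    (he : ‖e‖ = 1) (hg : ‖f e‖ = 1) (x : H) (hx : inner ℂ e x = 0) :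
    L (pr x) = pr (RR L f e x) := by
  have h1 := RR_main L f e hf hq he hg x hx
  have h2 := RR_main L f e hf hq he hg (-x) (by simp [hx])
  have h3 := congrArg L (pr_par x e)
  rw [map_add, h1, h2, RR_neg, pr_par, map_add, map_smul, map_smul, hf e] at h3
  have h4 := add_right_cancel h3
  exact (sa_two_cancel _ _ h4).symm

lemma RR_I (hf : ∀ x, L (pr x) = pr (f x)) (hn : ∀ x, ‖f x‖ = ‖x‖)
    (hq : ∀ x, ∀ B : selfAdjoint (H →L[ℂ] H),
      inner ℂ x ((B : H →L[ℂ] H) x) = inner ℂ (f x) ((L B : H →L[ℂ] H) (f x)))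
    (he : ‖e‖ = 1) (x : H) (hx : inner ℂ e x = 0) :
    RR L f e (Complex.I • x) = Complex.I • RR L f e x ∨
    RR L f e (Complex.I • x) = -(Complex.I • RR L f e x) := by
  have hg : ‖f e‖ = 1 := by rw [hn, he]
  have hm := RR_main2 L f e hf hq he hg
  have hnm : ∀ x, inner ℂ e x = 0 → ‖RR L f e x‖ = ‖x‖ := by
    intro x hx
    rw [← hn x]
    apply pr_norm
    rw [← hf, hm x hx]
  rcases eq_or_ne x 0 with rfl | hx0
  · have : RR L f e 0 = 0 := by
      have := RR_smul L f e 0 0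
      simpa using this
    left; simp [this]
  have hIx : inner ℂ e (Complex.I • x) = 0 := by simp [hx]
  have h1 : pr (RR L f e (Complex.I • x)) = pr (RR L f e x) := by
    rw [← hm _ hIx, ← hm _ hx, pr_smul, Complex.norm_I, one_pow, sa_one_smul]
  obtain ⟨c, hc⟩ := pr_eq h1
  have h2 : ‖c‖ = 1 := by
    have := hnm _ hIx
    rw [hc, norm_smul, norm_smul, hnm x hx, Complex.norm_I] at this
    exact mul_right_cancel₀ (norm_ne_zero_iff.2 hx0) this
  have h3 : ‖1 + c‖ = ‖1 + Complex.I‖ := by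
    have := hnm (x + Complex.I • x) (by rw [inner_add_right, hx, hIx, add_zero])
    rw [RR_add, hc] at this
    have a1 : RR L f e x + c • RR L f e x = (1 + c) • RR L f e x := by rw [add_smul, one_smul]
    have a2 : x + Complex.I • x = (1 + Complex.I) • x := by rw [add_smul, one_smul]
    rw [a1, a2, norm_smul, norm_smul, hnm x hx] at this
    exact mul_right_cancel₀ (norm_ne_zero_iff.2 hx0) this
  have h2' : c.re * c.re + c.im * c.im = 1 := by
    have := Complex.normSq_eq_norm_sq c
    rw [h2, Complex.normSq_apply] at this
    simpa using this
  have h3' : (1 + c.re) * (1 + c.re) + c.im * c.im = 2 := by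
    have a := Complex.normSq_eq_norm_sq (1 + c)
    rw [h3, ← Complex.normSq_eq_norm_sq, Complex.normSq_apply, Complex.normSq_apply] at a
    simp at a
    linarith
  have hre : c.re = 0 := by linarith
  rw [hre] at h2'
  have him : (c.im - 1) * (c.im + 1) = 0 := by linarith
  rw [hc]
  rcases mul_eq_zero.1 him with h | h
  · left
    have : c = Complex.I := by apply Complex.ext <;> simp <;> linarith
    rw [this]
  · right
    have : c = -Complex.I := by apply Complex.ext <;> simp <;> linarith
    rw [this, neg_smul]

lemma final (hf : ∀ x, L (pr x) = pr (f x)) (hn : ∀ x, ‖f x‖ = ‖x‖)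
    (hq : ∀ x, ∀ B : selfAdjoint (H →L[ℂ] H),
      inner ℂ x ((B : H →L[ℂ] H) x) = inner ℂ (f x) ((L B : H →L[ℂ] H) (f x)))
    (hsurj : ∀ y, ∃ x, L (pr x) = pr y)
    (he : ‖e‖ = 1) (σ : ℂ →+* ℂ) [RingHomInvPair σ σ] (hσ : ∀ a, ‖σ a‖ = ‖a‖)
    (hR : ∀ (a : ℂ) (x : H), inner ℂ e x = 0 → RR L f e (a • x) = σ a • RR L f e x) :
    ∃ T : H ≃ₛₗᵢ[σ] H, ∀ A : selfAdjoint (H →L[ℂ] H), ∀ x : H,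
        (L A : H →L[ℂ] H) x = T ((A : H →L[ℂ] H) (T.symm x)) := by
  have hg : ‖f e‖ = 1 := by rw [hn, he]
  have hee : inner ℂ e e = 1 := by simp [inner_self_eq_norm_sq_to_K, he]
  have hm := RR_main L f e hf hq he hg
  have hm2 := RR_main2 L f e hf hq he hg
  have horth : ∀ z, inner ℂ e (z - inner ℂ e z • e) = 0 := by
    intro z
    rw [inner_sub_right, inner_smul_right, hee]; simp
  let T₀ : H →ₛₗ[σ] H :=
    { toFun := fun z => RR L f e (z - inner ℂ e z • e) + σ (inner ℂ e z) • f e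
      map_add' := by
        intro x y
        have : x + y - inner ℂ e (x + y) • e
          = (x - inner ℂ e x • e) + (y - inner ℂ e y • e) := by
          rw [inner_add_right, add_smul]; abel
        rw [this, RR_add, inner_add_right, map_add, add_smul]; abel
      map_smul' := by
        intro a x
        have : a • x - inner ℂ e (a • x) • e = a • (x - inner ℂ e x • e) := by
          rw [inner_smul_right, smul_sub, smul_smul]
        rw [this, hR _ _ (horth x), inner_smul_right, map_mul, smul_add, smul_smul] }
  have hT₀ : ∀ z, T₀ z = RR L f e (z - inner ℂ e z • e) + σ (inner ℂ e z) • f e := fun z => rfl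
  have hT : ∀ z, L (pr z) = pr (T₀ z) := by
    intro z
    rw [hT₀]
    generalize hx : z - inner ℂ e z • e = x
    generalize ha : (inner ℂ e z : ℂ) = a
    have hxo : inner ℂ e x = 0 := by rw [← hx]; exact horth z
    have hz : z = x + a • e := by rw [← hx, ← ha]; abel
    rcases eq_or_ne a 0 with h0 | h0
    · rw [hz, h0]; simp [hm2 x hxo]
    · have h1 : z = a • (a⁻¹ • x + e) := by
        rw [hz, smul_add, smul_smul, mul_inv_cancel₀ h0, one_smul]
      have hxo' : inner ℂ e (a⁻¹ • x) = 0 := by rw [inner_smul_right, hxo, mul_zero]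
      have h2 : RR L f e x = σ a • RR L f e (a⁻¹ • x) := by
        rw [← hR _ _ hxo', smul_smul, mul_inv_cancel₀ h0, one_smul]
      rw [h1, h2, ← smul_add, pr_smul, pr_smul, map_smul, hm _ hxo', hσ]
  have hTn : ∀ z, ‖T₀ z‖ = ‖z‖ := by
    intro z
    rw [← hn z]
    apply pr_norm
    rw [← hf, hT]
  have hTs : Function.Surjective T₀ := by
    intro y
    obtain ⟨x, hx⟩ := hsurj y
    obtain ⟨c, hc⟩ := pr_eq (hx.symm.trans (hT x))
    refine ⟨σ c • x, ?_⟩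
    rw [map_smulₛₗ, RingHomInvPair.comp_apply_eq, ← hc]
  have hTq : ∀ z, ∀ B : selfAdjoint (H →L[ℂ] H),
      inner ℂ z ((B : H →L[ℂ] H) z) = inner ℂ (T₀ z) ((L B : H →L[ℂ] H) (T₀ z)) := by
    intro z B
    obtain h1 := (hf z).symm.trans (hT z)
    obtain ⟨c, hc⟩ := pr_eq h1
    have hnz : ‖c‖ * ‖T₀ z‖ = ‖T₀ z‖ := by
      rw [← norm_smul, ← hc, pr_norm h1]
    rw [hq, hc, quad_smul, mul_comm ((starRingEnd ℂ) c), Complex.mul_conj,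
      Complex.normSq_eq_norm_sq]
    rcases eq_or_ne (T₀ z) 0 with h0 | h0
    · rw [h0]; simp
    · have : ‖c‖ = 1 := by
        apply mul_right_cancel₀ (norm_ne_zero_iff.2 h0)
        rw [hnz, one_mul]
      rw [this]; simp
  let T : H ≃ₛₗᵢ[σ] H := LinearIsometryEquiv.ofSurjective ⟨T₀, hTn⟩ hTs
  have hTT : ∀ z, T z = T₀ z := fun z => rfl
  refine ⟨T, fun A x => ?_⟩
  obtain ⟨z, rfl⟩ := T.surjective x
  rw [LinearIsometryEquiv.symm_apply_apply, hTT, hTT]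
  -- real polarization
  have hre : ∀ x y, (inner ℂ (T₀ x) (T₀ y) : ℂ).re = (inner ℂ x y : ℂ).re := by
    intro x y
    have a1 := norm_add_sq (𝕜 := ℂ) x y
    have a2 := norm_add_sq (𝕜 := ℂ) (T₀ x) (T₀ y)
    rw [← map_add, hTn, hTn, hTn] at a2
    simp only [RCLike.re_to_complex] at a1 a2
    linarith
  have hsym : ∀ (B : selfAdjoint (H →L[ℂ] H)) (x y : H),
      (inner ℂ y ((B : H →L[ℂ] H) x) : ℂ).re = (inner ℂ x ((B : H →L[ℂ] H) y) : ℂ).re := by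
    intro B x y
    have h1 : inner ℂ ((B : H →L[ℂ] H) y) x = inner ℂ y ((B : H →L[ℂ] H) x) :=
      (show IsSelfAdjoint (B : H →L[ℂ] H) from B.2).isSymmetric y x
    rw [← h1, ← inner_conj_symm, Complex.conj_re]
  have hbil : ∀ x y, (inner ℂ (T₀ y) ((L A : H →L[ℂ] H) (T₀ x)) : ℂ).re
      = (inner ℂ y ((A : H →L[ℂ] H) x) : ℂ).re := by
    intro x y
    have b0 := congrArg Complex.re (hTq (x + y) A)
    have b1 := congrArg Complex.re (hTq x A)
    have b2 := congrArg Complex.re (hTq y A)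
    simp only [map_add, inner_add_left, inner_add_right, Complex.add_re] at b0
    have b3 := hsym A x y
    have b4 := hsym (L A) (T₀ x) (T₀ y)
    linarith
  obtain ⟨y, hy⟩ := hTs ((L A : H →L[ℂ] H) (T₀ z) - T₀ ((A : H →L[ℂ] H) z))
  have h0 : (inner ℂ (T₀ y) (T₀ y) : ℂ).re = 0 := by
    nth_rw 2 [hy]
    rw [inner_sub_right, Complex.sub_re, hbil, hre, sub_self]
  have h1 : T₀ y = 0 := by
    have := inner_self_eq_norm_sq (𝕜 := ℂ) (T₀ y)
    rw [RCLike.re_to_complex, h0] at this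
    exact norm_eq_zero.1 (pow_eq_zero_iff two_ne_zero |>.1 this.symm)
  rw [h1] at hy
  exact sub_eq_zero.1 hy.symm

end wig
end aux

theorem spectrum_preserver_selfAdjoint_one_sided
    {H : Type*} [NormedAddCommGroup H] [InnerProductSpace ℂ H] [CompleteSpace H]
    (hH : ¬ FiniteDimensional ℂ H)
    (r : ℚ) (hr : 1 < r)
    (φ : selfAdjoint (H →L[ℂ] H) → selfAdjoint (H →L[ℂ] H))
    (hφ : Function.Surjective φ)
    (hspec : ∀ A : selfAdjoint (H →L[ℂ] H),
      (IsRankOneProjection (A : H →L[ℂ] H) ∨ (A : H →L[ℂ] H) = 1) →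
      ∀ B : selfAdjoint (H →L[ℂ] H),
        spectrum ℂ (absPow (A : H →L[ℂ] H) r * (B : H →L[ℂ] H)) =
        spectrum ℂ (absPow (φ A : H →L[ℂ] H) r * (φ B : H →L[ℂ] H))):
    (∃ T : H ≃ₗᵢ[ℂ] H, ∀ A : selfAdjoint (H →L[ℂ] H), ∀ x : H,
        (φ A : H →L[ℂ] H) x = T ((A : H →L[ℂ] H) (T.symm x))) ∨
    (∃ T : H ≃ₛₗᵢ[starRingEnd ℂ] H, ∀ A : selfAdjoint (H →L[ℂ] H), ∀ x : H,
        (φ A : H →L[ℂ] H) x = T ((A : H →L[ℂ] H) (T.symm x))) := by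
  have : Nontrivial H := by
    by_contra hcon
    rw [not_nontrivial_iff_subsingleton] at hcon
    exact hH inferInstance
  have hr0 : (0 : ℝ) < (r : ℝ) := by
    have : (0 : ℚ) < r := by linarith
    exact_mod_cast this
  obtain ⟨h1, -⟩ := step0 (r : ℝ) φ hr0 hspec
  obtain ⟨L, hL, hx, hy⟩ := step3 (r : ℝ) φ hr0 hφ hspec
  choose f hf hq using hx
  have hn : ∀ x, ‖f x‖ = ‖x‖ := by
    intro x
    have := hq x 1
    rw [hL, h1] at this
    have a : inner ℂ x x = inner ℂ (f x) (f x) := this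
    rw [inner_self_eq_norm_sq_to_K, inner_self_eq_norm_sq_to_K] at a
    have b : ‖x‖ ^ 2 = ‖f x‖ ^ 2 := by exact_mod_cast a
    exact ((sq_eq_sq₀ (norm_nonneg _) (norm_nonneg _)).1 b).symm
  obtain ⟨e, he⟩ := exists_norm_eq H zero_le_one
  have hI := RR_I L f e hf hn hq he
  have hdec : ∀ (a : ℂ) (x : H), RR L f e (a • x)
      = (a.re : ℂ) • RR L f e x + (a.im : ℂ) • RR L f e (Complex.I • x) := by
    intro a x
    conv_lhs => rw [← Complex.re_add_im a]
    rw [add_smul, ← smul_smul, RR_add, RR_smul, RR_smul]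
  simp only [← hL]
  by_cases hlin : ∀ x, inner ℂ e x = 0 → RR L f e (Complex.I • x) = Complex.I • RR L f e x
  · left
    refine final L f e hf hn hq hy he (RingHom.id ℂ) (fun a => rfl) ?_
    intro a x hx
    rw [hdec, hlin x hx, smul_smul, ← add_smul, Complex.re_add_im]; rfl
  · right
    have hanti : ∀ x, inner ℂ e x = 0 →
        RR L f e (Complex.I • x) = -(Complex.I • RR L f e x) := by
      push Not at hlin
      obtain ⟨p, hp, hpn⟩ := hlin
      intro q hqo
      by_contra hqn
      have p1 := (hI p hp).resolve_left hpn
      have q1 := (hI q hqo).resolve_right hqn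
      have hIne := Complex.I_ne_zero
      rcases hI (p + q) (by rw [inner_add_right, hp, hqo, add_zero]) with h | h
      · rw [smul_add, RR_add, RR_add, q1, smul_add] at h
        exact hpn (add_right_cancel h)
      · rw [smul_add, RR_add, RR_add, p1, smul_add, neg_add] at h
        exact hqn (add_left_cancel h)
    refine final L f e hf hn hq hy he (starRingEnd ℂ) (fun a => by simp) ?_
    intro a x hx
    rw [hdec, hanti x hx, smul_neg, smul_smul, ← neg_smul, ← add_smul]
    congr 1
    apply Complex.ext <;> simp
end

section
/- Let H be an infinite-dimensional complex Hilbert space, let r be a positive rational number with r > 1, and let φ : B(H) → B(H) be a surjective map satisfying σ(|A|^r B) = σ(|φ(A)|^r φ(B)) for all A, B ∈ B(H). Then there exists a bounded linear or conjugate-linear bijection T : H → H with T* = T⁻¹ such that φ(A) = T A T* for all A ∈ B(H). -/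
open scoped InnerProductSpace

open InnerProductSpace in
lemma sp_cfc_proj {H : Type*} [NormedAddCommGroup H] [InnerProductSpace ℂ H]
    [CompleteSpace H] (p : H →L[ℂ] H) (hp : IsSelfAdjoint p) (hi : p * p = p)
    (f : ℝ → ℝ) (h0 : f 0 = 0) (h1 : f 1 = 1) : cfc f p = p := by
  have hs := IsIdempotentElem.spectrum_subset ℝ (p := p) hi
  calc cfc f p = cfc id p := cfc_congr (fun x hx => by
        rcases hs hx with h | h
        · rw [h, h0]; rfl
        · rw [Set.mem_singleton_iff] at h; rw [h, h1]; rfl)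
    _ = p := cfc_id ℝ p

lemma sp_star_mul {H : Type*} [NormedAddCommGroup H] [InnerProductSpace ℂ H]
    [CompleteSpace H] (A : H →L[ℂ] H) (r : ℝ) (hr : 0 < r) :
    star A * A = cfc (fun t : ℝ => t ^ (2 / r)) (absPow A r) := by
  have hN : IsSelfAdjoint (star A * A) := IsSelfAdjoint.star_mul_self A
  have hpos : ∀ x ∈ spectrum ℝ (star A * A), 0 ≤ x := fun x hx =>
    spectrum_nonneg_of_nonneg (star_mul_self_nonneg A) hx
  have hc1 : Continuous (fun t : ℝ => t ^ r) := Real.continuous_rpow_const hr.le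
  have hc2 : Continuous (fun t : ℝ => t ^ (2 / r)) := Real.continuous_rpow_const (by positivity)
  unfold absPow absOp
  rw [← cfc_comp' (fun t : ℝ => t ^ r) (fun t : ℝ => Real.sqrt t) _ hc1.continuousOn
      Real.continuous_sqrt.continuousOn hN,
    ← cfc_comp' (fun t : ℝ => t ^ (2 / r)) (fun t : ℝ => (Real.sqrt t) ^ r) _ hc2.continuousOn
      (hc1.comp Real.continuous_sqrt).continuousOn hN]
  conv_lhs => rw [← cfc_id ℝ (star A * A)]
  refine cfc_congr (fun x hx => ?_)
  have hx0 := hpos x hx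
  simp only [id]
  rw [← Real.rpow_mul (Real.sqrt_nonneg _), mul_div_cancel₀ _ hr.ne', Real.rpow_two, Real.sq_sqrt hx0]

lemma sp_absPow_nonneg {H : Type*} [NormedAddCommGroup H] [InnerProductSpace ℂ H]
    [CompleteSpace H] (A : H →L[ℂ] H) (r : ℝ) : 0 ≤ absPow A r := by
  have h : 0 ≤ absOp A := cfc_nonneg (fun x _ => Real.sqrt_nonneg x)
  exact cfc_nonneg (fun x hx => Real.rpow_nonneg (spectrum_nonneg_of_nonneg h hx) _)

open InnerProductSpace in
lemma sp_proj {H : Type*} [NormedAddCommGroup H] [InnerProductSpace ℂ H]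
    [CompleteSpace H] (z : H) (hz : ‖z‖ = 1) :
    IsSelfAdjoint (rankOne ℂ z z) ∧ rankOne ℂ z z * rankOne ℂ z z = rankOne ℂ z z :=
  ⟨(isStarProjection_rankOne_self hz).isSelfAdjoint, (isStarProjection_rankOne_self hz).isIdempotentElem⟩

open InnerProductSpace in
lemma sp_absPow_rankOne {H : Type*} [NormedAddCommGroup H] [InnerProductSpace ℂ H]
    [CompleteSpace H] (x z : H) (hx : ‖x‖ = 1) (hz : ‖z‖ = 1) (r : ℝ) (hr : 0 < r) :
    absPow (rankOne ℂ x z) r = rankOne ℂ z z := by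
  obtain ⟨h1, h2⟩ := sp_proj z hz
  have h3 : star (rankOne ℂ x z) * rankOne ℂ x z = rankOne ℂ z z := by
    rw [ContinuousLinearMap.star_eq_adjoint, adjoint_rankOne]
    ext v
    simp [inner_self_eq_norm_sq_to_K, hx]
  unfold absPow absOp
  rw [h3, sp_cfc_proj _ h1 h2 _ (by simp) (by simp),
    sp_cfc_proj _ h1 h2 _ (by simp [hr.ne']) (by simp)]

open InnerProductSpace in
lemma sp_star_mul_proj {H : Type*} [NormedAddCommGroup H] [InnerProductSpace ℂ H]
    [CompleteSpace H] (A : H →L[ℂ] H) (y : H) (hy : ‖y‖ = 1) (r : ℝ) (hr : 0 < r)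
    (h : absPow A r = rankOne ℂ y y) : star A * A = rankOne ℂ y y := by
  obtain ⟨h1, h2⟩ := sp_proj y hy
  have : (2 / r) ≠ 0 := by positivity
  rw [sp_star_mul A r hr, h, sp_cfc_proj _ h1 h2 _ (by simp [hr.ne']) (by simp)]

open InnerProductSpace in
lemma sp_norm_le {H : Type*} [NormedAddCommGroup H] [InnerProductSpace ℂ H]
    [CompleteSpace H] (A : H →L[ℂ] H) (y : H) (hy : ‖y‖ ≤ 1) (r : ℝ) (hr : 0 < r)
    (h : absPow A r = rankOne ℂ y y) : ‖A‖ ≤ 1 := by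
  have h0 := sp_absPow_nonneg A r
  have h1 : ‖star A * A‖ ≤ 1 := by
    rw [sp_star_mul A r hr]
    refine norm_cfc_le zero_le_one (fun x hx => ?_)
    have hx0 : 0 ≤ x := spectrum_nonneg_of_nonneg h0 hx
    have hH : Nontrivial (H →L[ℂ] H) := by
      by_contra hn
      rw [not_nontrivial_iff_subsingleton] at hn
      simp [spectrum.of_subsingleton] at hx
    have hx1 : ‖x‖ ≤ ‖absPow A r‖ := spectrum.norm_le_norm_of_mem hx
    rw [h, norm_rankOne] at hx1
    rw [Real.norm_of_nonneg hx0] at hx1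
    rw [Real.norm_of_nonneg (Real.rpow_nonneg hx0 _)]
    exact Real.rpow_le_one hx0 (hx1.trans (mul_le_one₀ hy (norm_nonneg _) hy)) (by positivity)
  rw [CStarRing.norm_star_mul_self] at h1
  nlinarith [norm_nonneg A]

open InnerProductSpace in
lemma sp_mem_spec {H : Type*} [NormedAddCommGroup H] [InnerProductSpace ℂ H]
    [CompleteSpace H] (A : H →L[ℂ] H) (v : H) (hv : v ≠ 0) (c : ℂ) (h : A v = c • v) :
    c ∈ spectrum ℂ A := by
  rw [spectrum.mem_iff]
  rintro ⟨u, hu⟩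
  apply hv
  have h1 : (u : H →L[ℂ] H) v = 0 := by
    rw [hu]; simp [Algebra.algebraMap_eq_smul_one, h]
  have h2 : ((↑u⁻¹ : H →L[ℂ] H) * (u : H →L[ℂ] H)) v = v := by simp
  rw [← h2, mul_apply_eq_comp, h1, map_zero]

open InnerProductSpace in
lemma sp_spec_rankOne {H : Type*} [NormedAddCommGroup H] [InnerProductSpace ℂ H]
    [CompleteSpace H] (y : H) (B : H →L[ℂ] H) (c : ℂ) (hc : c ≠ 0) :
    c ∈ spectrum ℂ (rankOne ℂ y y * B) ↔ c = inner ℂ y (B y) := by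
  constructor
  · intro h
    by_contra hne
    apply h
    set R := rankOne ℂ y y * B with hR
    have hRR : R * R = (inner ℂ y (B y)) • R := by
      ext v
      simp [hR, smul_smul, mul_comm]
    set m := inner ℂ y (B y)
    have hcm : c - m ≠ 0 := sub_ne_zero.mpr hne
    have e1 : (c • (1 : H →L[ℂ] H) - R) * (c⁻¹ • (1 + (c - m)⁻¹ • R)) = 1 := by
      have : (c • (1 : H →L[ℂ] H) - R) * (c⁻¹ • (1 + (c - m)⁻¹ • R))
        = (c * c⁻¹) • (1 : H →L[ℂ] H) + (c * c⁻¹ * (c-m)⁻¹) • R - c⁻¹ • R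
          - (c⁻¹ * (c-m)⁻¹) • (R * R) := by
        simp only [sub_mul, mul_smul_comm, mul_add, smul_mul_assoc, one_mul, mul_one]
        module
      rw [this, hRR, mul_inv_cancel₀ hc]
      have : (1 * (c - m)⁻¹ - c⁻¹ - c⁻¹ * (c - m)⁻¹ * m) = 0 := by
        field_simp; ring
      calc _ = (1 : H →L[ℂ] H) + (1 * (c - m)⁻¹ - c⁻¹ - c⁻¹ * (c - m)⁻¹ * m) • R := by module
        _ = 1 := by rw [this]; simp
    have e2 : (c⁻¹ • (1 + (c - m)⁻¹ • R)) * (c • (1 : H →L[ℂ] H) - R) = 1 := by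
      refine Eq.trans ?_ e1
      simp only [sub_mul, mul_sub, mul_smul_comm, mul_add, add_mul, smul_mul_assoc, one_mul, mul_one]
      module
    show IsUnit (algebraMap ℂ _ c - R)
    rw [Algebra.algebraMap_eq_smul_one]
    exact ⟨⟨_, _, e1, e2⟩, rfl⟩
  · intro h
    refine sp_mem_spec _ y ?_ c ?_
    · rintro rfl; simp at h; exact hc h
    · simp [h]

open InnerProductSpace in
lemma sp_inner_eq {H : Type*} [NormedAddCommGroup H] [InnerProductSpace ℂ H]
    [CompleteSpace H] (z y : H) (B C : H →L[ℂ] H)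
    (h : spectrum ℂ (rankOne ℂ z z * B) = spectrum ℂ (rankOne ℂ y y * C)) :
    inner ℂ z (B z) = inner ℂ y (C y) := by
  by_cases h1 : inner ℂ z (B z) = 0
  · by_cases h2 : inner ℂ y (C y) = 0
    · rw [h1, h2]
    · exact ((sp_spec_rankOne z B _ h2).1 (h ▸ (sp_spec_rankOne y C _ h2).2 rfl)).symm
  · exact ((sp_spec_rankOne y C _ h1).1 (h ▸ (sp_spec_rankOne z B _ h1).2 rfl))

open InnerProductSpace in
lemma sp_rank {H : Type*} [NormedAddCommGroup H] [InnerProductSpace ℂ H]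
    [CompleteSpace H] (Q : H →L[ℂ] H) (hQ : 0 ≤ Q)
    (h : ∀ C : H →L[ℂ] H, ∀ a ∈ spectrum ℂ (Q * C), ∀ b ∈ spectrum ℂ (Q * C),
      a ≠ 0 → b ≠ 0 → a = b) : ∃ y : H, Q = rankOne ℂ y y := by
  rw [ContinuousLinearMap.nonneg_iff_isPositive] at hQ
  by_cases hz : Q = 0
  · exact ⟨0, by simp [hz]⟩
  obtain ⟨u, hu⟩ : ∃ u, Q u ≠ 0 := by
    by_contra hn; push Not at hn
    exact hz (ContinuousLinearMap.ext hn)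
  set a := Q u with ha
  have haa : inner ℂ a a ≠ 0 := inner_self_ne_zero.mpr hu
  have key : ∀ v, Q v = (inner ℂ a (Q v) / inner ℂ a a) • a := by
    intro v
    by_contra hne
    set c := inner ℂ a (Q v) / inner ℂ a a with hc
    set w := v - c • u with hw
    have hb : Q w = Q v - c • a := by simp [hw, ha]
    have hb0 : Q w ≠ 0 := by rw [hb]; exact sub_ne_zero.mpr hne
    have hbb : inner ℂ (Q w) (Q w) ≠ 0 := inner_self_ne_zero.mpr hb0
    have hab : inner ℂ a (Q w) = 0 := by
      rw [hb, inner_sub_right, inner_smul_right, hc]; field_simp; simp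
    have hba : inner ℂ (Q w) a = 0 := inner_eq_zero_symm.mp hab
    set C : H →L[ℂ] H := (inner ℂ a a)⁻¹ • rankOne ℂ u a
      + (2 * (inner ℂ (Q w) (Q w))⁻¹) • rankOne ℂ w (Q w) with hC
    have h1 : (1 : ℂ) ∈ spectrum ℂ (Q * C) := by
      refine sp_mem_spec _ a hu 1 ?_
      simp only [hC, mul_apply_eq_comp, add_apply,
        smul_apply, rankOne_apply, hba, zero_smul, smul_zero, add_zero,
        smul_smul, inv_mul_cancel₀ haa, one_smul, ← ha]
    have h2 : (2 : ℂ) ∈ spectrum ℂ (Q * C) := by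
      refine sp_mem_spec _ (Q w) hb0 2 ?_
      simp only [hC, mul_apply_eq_comp, add_apply,
        smul_apply, rankOne_apply, hab, zero_smul, smul_zero, zero_add,
        smul_smul, mul_assoc, inv_mul_cancel₀ hbb, mul_one, map_smul]
    have := h C 1 h1 2 h2 one_ne_zero two_ne_zero
    norm_num at this
  have hsym : ∀ x y, inner ℂ (Q x) y = inner ℂ x (Q y) := fun x y => hQ.isSymmetric x y
  have hre : ∃ t : ℝ, 0 ≤ t ∧ inner ℂ a (Q a) = (t : ℂ) := by
    have h1 := hQ.inner_nonneg_right a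
    rw [Complex.nonneg_iff] at h1
    exact ⟨_, h1.1, by apply Complex.ext <;> simp [h1.2.symm]⟩
  obtain ⟨t, ht, hta⟩ := hre
  have haan : inner ℂ a a = ((‖a‖ ^ 2 : ℝ) : ℂ) := by
    rw [inner_self_eq_norm_sq_to_K]; simp
  have hna : 0 < ‖a‖ := norm_pos_iff.mpr hu
  refine ⟨((Real.sqrt t / ‖a‖ ^ 2 : ℝ) : ℂ) • a, ?_⟩
  ext v
  have hQa : Q a = ((t / ‖a‖^2 : ℝ) : ℂ) • a := by
    conv_lhs => rw [key a, hta, haan, ← Complex.ofReal_div]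
  rw [key v, ← hsym a v, hQa, haan]
  simp only [rankOne_apply, inner_smul_left, Complex.conj_ofReal, smul_smul]
  congr 1
  have : (Real.sqrt t : ℂ) * Real.sqrt t = t := by
    rw [← Complex.ofReal_mul, Real.mul_self_sqrt ht]
  have hna' : (‖a‖ : ℂ) ≠ 0 := by exact_mod_cast hna.ne'
  push_cast
  field_simp
  rw [pow_two, this, mul_comm]

open InnerProductSpace in
lemma sp_L1 {H : Type*} [NormedAddCommGroup H] [InnerProductSpace ℂ H] [CompleteSpace H]
    (r : ℝ) (φ : (H →L[ℂ] H) → (H →L[ℂ] H)) (hφ : Function.Surjective φ)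
    (hspec : ∀ A B : H →L[ℂ] H,
      spectrum ℂ (absPow A r * B) = spectrum ℂ (absPow (φ A) r * φ B))
    (A : H →L[ℂ] H) (z : H) (hA : absPow A r = rankOne ℂ z z) :
    ∃ y : H, absPow (φ A) r = rankOne ℂ y y ∧ ∀ B, inner ℂ z (B z) = inner ℂ y (φ B y) := by
  obtain ⟨y, hy⟩ := sp_rank (absPow (φ A) r) (sp_absPow_nonneg _ _) (by
    intro C a ha b hb ha0 hb0
    obtain ⟨B, rfl⟩ := hφ C
    rw [← hspec, hA] at ha hb
    rw [(sp_spec_rankOne z B a ha0).1 ha, (sp_spec_rankOne z B b hb0).1 hb])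
  refine ⟨y, hy, fun B => sp_inner_eq _ _ _ _ ?_⟩
  rw [← hA, hspec, hy]

lemma sp_ext {H : Type*} [NormedAddCommGroup H] [InnerProductSpace ℂ H]
    (S T : H →L[ℂ] H) (h : ∀ x : H, ‖x‖ = 1 → inner ℂ x (S x) = inner ℂ x (T x)) : S = T := by
  have : (S : H →ₗ[ℂ] H) = (T : H →ₗ[ℂ] H) := by
    rw [← ext_inner_map]
    intro x
    show inner ℂ (S x) x = inner ℂ (T x) x
    rw [← inner_conj_symm, ← inner_conj_symm (T x)]
    congr 1
    by_cases hx : x = 0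
    · simp [hx]
    have hn : (‖x‖ : ℂ) ≠ 0 := by exact_mod_cast (norm_pos_iff.mpr hx).ne'
    have h1 := h ((‖x‖ : ℂ)⁻¹ • x) (by
      rw [norm_smul, norm_inv, Complex.norm_real, norm_norm, inv_mul_cancel₀ (norm_pos_iff.mpr hx).ne'])
    simp only [map_smul, inner_smul_left, inner_smul_right] at h1
    have hn' : (starRingEnd ℂ) (‖x‖ : ℂ)⁻¹ ≠ 0 := by simpa using hx
    exact mul_left_cancel₀ (inv_ne_zero hn) (mul_left_cancel₀ hn' (by linear_combination h1))
  exact ContinuousLinearMap.coe_injective this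

open InnerProductSpace in
lemma sp_inj {H : Type*} [NormedAddCommGroup H] [InnerProductSpace ℂ H] [CompleteSpace H]
    (r : ℝ) (hr : 0 < r) (φ : (H →L[ℂ] H) → (H →L[ℂ] H)) (hφ : Function.Surjective φ)
    (hspec : ∀ A B : H →L[ℂ] H,
      spectrum ℂ (absPow A r * B) = spectrum ℂ (absPow (φ A) r * φ B)) :
    Function.Injective φ := by
  intro B C hBC
  refine sp_ext _ _ (fun z hz => ?_)
  obtain ⟨y, -, hy⟩ := sp_L1 r φ hφ hspec _ z (sp_absPow_rankOne z z hz hz r hr)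
  rw [hy, hy, hBC]

open InnerProductSpace in
lemma sp_L3 {H : Type*} [NormedAddCommGroup H] [InnerProductSpace ℂ H] [CompleteSpace H]
    (r : ℝ) (hr : 0 < r) (φ : (H →L[ℂ] H) → (H →L[ℂ] H)) (hφ : Function.Surjective φ)
    (hspec : ∀ A B : H →L[ℂ] H,
      spectrum ℂ (absPow A r * B) = spectrum ℂ (absPow (φ A) r * φ B))
    (z : H) (hz : ‖z‖ = 1) :
    ∃ y : H, 1 ≤ ‖y‖ ∧ ∀ B, inner ℂ z (B z) = inner ℂ y (φ B y) := by
  obtain ⟨y, hy1, hy⟩ := sp_L1 r φ hφ hspec _ z (sp_absPow_rankOne z z hz hz r hr)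
  refine ⟨y, ?_, hy⟩
  by_contra hlt
  push Not at hlt
  have h1 := sp_norm_le _ y hlt.le r hr hy1
  have h2 := hy (rankOne ℂ z z)
  have h3 : inner ℂ z (rankOne ℂ z z z) = (1 : ℂ) := by
    simp [inner_self_eq_norm_sq_to_K, hz]
  rw [h3] at h2
  have h4 : (1 : ℝ) ≤ ‖y‖ * (‖φ (rankOne ℂ z z)‖ * ‖y‖) := by
    calc (1 : ℝ) = ‖(1 : ℂ)‖ := by simp
      _ ≤ _ := by
        rw [h2]
        exact (norm_inner_le_norm _ _).trans
          (mul_le_mul_of_nonneg_left (ContinuousLinearMap.le_opNorm _ _) (norm_nonneg _))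
  have h5 : ‖φ (rankOne ℂ z z)‖ * ‖y‖ ≤ ‖y‖ := mul_le_of_le_one_left (norm_nonneg _) h1
  nlinarith [norm_nonneg y]

open InnerProductSpace in
lemma sp_inv {H : Type*} [NormedAddCommGroup H] [InnerProductSpace ℂ H] [CompleteSpace H]
    (r : ℝ) (hr : 0 < r) (φ : (H →L[ℂ] H) → (H →L[ℂ] H)) (hφ : Function.Surjective φ)
    (hspec : ∀ A B : H →L[ℂ] H,
      spectrum ℂ (absPow A r * B) = spectrum ℂ (absPow (φ A) r * φ B)) :
    ∃ ψ : (H →L[ℂ] H) → (H →L[ℂ] H), Function.Surjective ψ ∧ (∀ B, φ (ψ B) = B) ∧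
      (∀ B, ψ (φ B) = B) ∧
      ∀ A B : H →L[ℂ] H, spectrum ℂ (absPow A r * B) = spectrum ℂ (absPow (ψ A) r * ψ B) := by
  have hinj := sp_inj r hr φ hφ hspec
  refine ⟨Function.surjInv hφ, ?_, Function.surjInv_eq hφ, Function.leftInverse_surjInv ⟨hinj, hφ⟩, ?_⟩
  · exact (Function.leftInverse_surjInv ⟨hinj, hφ⟩).surjective
  · intro A B
    rw [hspec (Function.surjInv hφ A), Function.surjInv_eq hφ, Function.surjInv_eq hφ]

open InnerProductSpace in
lemma sp_L4 {H : Type*} [NormedAddCommGroup H] [InnerProductSpace ℂ H] [CompleteSpace H]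
    (r : ℝ) (hr : 0 < r) (φ : (H →L[ℂ] H) → (H →L[ℂ] H)) (hφ : Function.Surjective φ)
    (hspec : ∀ A B : H →L[ℂ] H,
      spectrum ℂ (absPow A r * B) = spectrum ℂ (absPow (φ A) r * φ B))
    (z : H) (hz : ‖z‖ = 1) :
    ∃ y : H, ‖y‖ = 1 ∧ ∀ B, inner ℂ z (B z) = inner ℂ y (φ B y) := by
  obtain ⟨y, hy1, hy⟩ := sp_L3 r hr φ hφ hspec z hz
  refine ⟨y, ?_, hy⟩
  obtain ⟨ψ, hψ, h1, h2, hs⟩ := sp_inv r hr φ hφ hspec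
  have hn0 : ‖y‖ ≠ 0 := by positivity
  have hn : (‖y‖ : ℂ) ≠ 0 := by exact_mod_cast hn0
  obtain ⟨w, hw1, hw⟩ := sp_L3 r hr ψ hψ hs ((‖y‖ : ℂ)⁻¹ • y) (by
      rw [norm_smul, norm_inv, Complex.norm_real, norm_norm, inv_mul_cancel₀ hn0])
  have h3 := hw (φ 1)
  rw [h2] at h3
  simp only [map_smul, inner_smul_left, inner_smul_right] at h3
  rw [← hy 1] at h3
  simp only [one_apply_eq_self, inner_self_eq_norm_sq_to_K, hz] at h3
  have h4 : (‖y‖⁻¹ * ‖y‖⁻¹ : ℝ) = ‖w‖ ^ 2 := by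
    apply Complex.ofReal_injective
    push_cast
    simpa using h3
  have h5 : 1 ≤ ‖y‖⁻¹ * ‖y‖⁻¹ := by rw [h4]; nlinarith
  have h6 : ‖y‖⁻¹ ≤ 1 := inv_le_one_of_one_le₀ hy1
  have h7 : 0 < ‖y‖⁻¹ := by positivity
  have h8 : ‖y‖⁻¹ = 1 := le_antisymm h6 (by nlinarith)
  simpa using h8

open InnerProductSpace in
lemma sp_L4' {H : Type*} [NormedAddCommGroup H] [InnerProductSpace ℂ H] [CompleteSpace H]
    (r : ℝ) (hr : 0 < r) (φ : (H →L[ℂ] H) → (H →L[ℂ] H)) (hφ : Function.Surjective φ)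
    (hspec : ∀ A B : H →L[ℂ] H,
      spectrum ℂ (absPow A r * B) = spectrum ℂ (absPow (φ A) r * φ B))
    (y : H) (hy : ‖y‖ = 1) :
    ∃ z : H, ‖z‖ = 1 ∧ ∀ B, inner ℂ z (B z) = inner ℂ y (φ B y) := by
  obtain ⟨ψ, hψ, h1, h2, hs⟩ := sp_inv r hr φ hφ hspec
  obtain ⟨z, hz, h⟩ := sp_L4 r hr ψ hψ hs y hy
  exact ⟨z, hz, fun B => by rw [h, h2]⟩

open InnerProductSpace in
lemma sp_L5 {H : Type*} [NormedAddCommGroup H] [InnerProductSpace ℂ H] [CompleteSpace H]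
    (r : ℝ) (hr : 0 < r) (φ : (H →L[ℂ] H) → (H →L[ℂ] H)) (hφ : Function.Surjective φ)
    (hspec : ∀ A B : H →L[ℂ] H,
      spectrum ℂ (absPow A r * B) = spectrum ℂ (absPow (φ A) r * φ B))
    (x z y : H) (hx : ‖x‖ = 1) (hz : ‖z‖ = 1) (hy : ‖y‖ = 1)
    (h : ∀ B, inner ℂ z (B z) = inner ℂ y (φ B y)) :
    ‖φ (rankOne ℂ x z) y‖ = 1 ∧ ∀ v, φ (rankOne ℂ x z) v = inner ℂ y v • φ (rankOne ℂ x z) y := by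
  obtain ⟨y', hy1, hy'⟩ := sp_L1 r φ hφ hspec _ z (sp_absPow_rankOne x z hx hz r hr)
  have e : rankOne ℂ y' y' = rankOne ℂ y y := by
    ext u
    refine ext_inner_left ℂ (fun v => ?_)
    obtain ⟨B, hB⟩ := hφ (rankOne ℂ u v)
    have := (h B).symm.trans (hy' B)
    rw [hB] at this
    simp only [rankOne_apply, inner_smul_right] at this ⊢
    linear_combination -this
  set A := φ (rankOne ℂ x z) with hA
  have hAA : star A * A = rankOne ℂ y y := sp_star_mul_proj A y hy r hr (by rw [hy1, e])
  have hin : ∀ u v, inner ℂ (A u) (A v) = inner ℂ u y * inner ℂ y v := by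
    intro u v
    have : inner ℂ u ((star A * A) v) = inner ℂ (A u) (A v) := by
      rw [ContinuousLinearMap.star_eq_adjoint, mul_apply_eq_comp,
        ContinuousLinearMap.adjoint_inner_right]
    rw [← this, hAA, rankOne_apply, inner_smul_right, mul_comm]
  have hyy : inner ℂ y y = (1 : ℂ) := by simp [inner_self_eq_norm_sq_to_K, hy]
  constructor
  · have := hin y y
    rw [hyy, inner_self_eq_norm_sq_to_K] at this
    have h2 : ‖A y‖ ^ 2 = 1 := by
      apply Complex.ofReal_injective
      push_cast
      simpa using this
    exact (pow_eq_one_iff_of_nonneg (norm_nonneg _) two_ne_zero).1 h2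
  · intro v
    have : A (v - inner ℂ y v • y) = 0 := by
      rw [← inner_self_eq_zero (𝕜 := ℂ), hin]
      simp [hy]
    rw [map_sub, map_smul, sub_eq_zero] at this
    exact this

open InnerProductSpace in
lemma sp_main {H : Type*} [NormedAddCommGroup H] [InnerProductSpace ℂ H] [CompleteSpace H]
    [Nontrivial H]
    (r : ℝ) (hr : 0 < r) (φ : (H →L[ℂ] H) → (H →L[ℂ] H)) (hφ : Function.Surjective φ)
    (hspec : ∀ A B : H →L[ℂ] H,
      spectrum ℂ (absPow A r * B) = spectrum ℂ (absPow (φ A) r * φ B)) :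
    ∃ T : H ≃ₗᵢ[ℂ] H, ∀ A : H →L[ℂ] H, ∀ x : H, φ A x = T (A (T.symm x)) := by
  have hadd : ∀ B C, φ (B + C) = φ B + φ C := by
    intro B C
    refine sp_ext _ _ (fun y hy => ?_)
    obtain ⟨z, hz, h⟩ := sp_L4' r hr φ hφ hspec y hy
    rw [add_apply, inner_add_right, ← h, ← h, ← h, add_apply, inner_add_right]
  have hsmul : ∀ (c : ℂ) B, φ (c • B) = c • φ B := by
    intro c B
    refine sp_ext _ _ (fun y hy => ?_)
    obtain ⟨z, hz, h⟩ := sp_L4' r hr φ hφ hspec y hy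
    rw [smul_apply, inner_smul_right, ← h, ← h, smul_apply, inner_smul_right]
  obtain ⟨e, he⟩ := exists_norm_eq H zero_le_one
  obtain ⟨f, hf, hef⟩ := sp_L4 r hr φ hφ hspec e he
  have hee : inner ℂ e e = (1 : ℂ) := by simp [inner_self_eq_norm_sq_to_K, he]
  let V0 : H →ₗ[ℂ] H :=
    { toFun := fun x => φ (rankOne ℂ x e) f
      map_add' := fun x y => by simp [hadd]
      map_smul' := fun c x => by simp [hsmul] }
  have hV0 : ∀ x, V0 x = φ (rankOne ℂ x e) f := fun x => rfl
  have hscale : ∀ x : H, x ≠ 0 → ‖((‖x‖ : ℂ)⁻¹ • x)‖ = 1 := fun x hx => by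
    rw [norm_smul, norm_inv, Complex.norm_real, norm_norm, inv_mul_cancel₀ (norm_pos_iff.mpr hx).ne']
  have hnorm : ∀ x, ‖V0 x‖ = ‖x‖ := by
    intro x
    by_cases hx : x = 0
    · simp [hx]
    have h1 := (sp_L5 r hr φ hφ hspec _ e f (hscale x hx) he hf hef).1
    rw [← hV0, map_smul, norm_smul, norm_inv, Complex.norm_real, norm_norm] at h1
    have := (norm_pos_iff.mpr hx).ne'
    field_simp at h1
    exact h1
  have hrank : ∀ x v, φ (rankOne ℂ x e) v = inner ℂ f v • V0 x := by
    intro x v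
    by_cases hx : x = 0
    · have : φ 0 = 0 := by simpa using hsmul 0 0
      simp [hx, this]
    have h1 := (sp_L5 r hr φ hφ hspec _ e f (hscale x hx) he hf hef).2 v
    have hn : (‖x‖ : ℂ) ≠ 0 := by exact_mod_cast (norm_pos_iff.mpr hx).ne'
    rw [← hV0, map_smul, map_smul, smul_apply, hsmul, smul_apply, smul_comm] at h1
    exact smul_right_injective H (inv_ne_zero hn) h1
  let V : H →ₗᵢ[ℂ] H := ⟨V0, hnorm⟩
  have hrel : ∀ z y, ‖z‖ = 1 → ‖y‖ = 1 → (∀ B, inner ℂ z (B z) = inner ℂ y (φ B y)) →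
      ∀ x, inner ℂ e z * inner ℂ z x = inner ℂ f y * inner ℂ y (V x) := by
    intro z y hz hy h x
    have := h (rankOne ℂ x e)
    rw [hrank, rankOne_apply, inner_smul_right, inner_smul_right] at this
    exact this
  have hVe : V e = f := by
    have h1 := hrel e f he hf hef e
    have hff : inner ℂ f f = (1 : ℂ) := by simp [inner_self_eq_norm_sq_to_K, hf]
    rw [hee, hff, one_mul, one_mul] at h1
    exact ((inner_eq_one_iff_of_norm_eq_one hf (by rw [V.norm_map, he])).1 h1.symm).symm
  -- unit vectors not orthogonal to e
  have hq1 : ∀ B z, ‖z‖ = 1 → inner ℂ e z ≠ 0 →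
      inner ℂ (V z) (φ B (V z)) = inner ℂ z (B z) := by
    intro B z hz hez
    obtain ⟨y, hy, h⟩ := sp_L4 r hr φ hφ hspec z hz
    have h1 := congrArg norm (hrel z y hz hy h e)
    have h2 := congrArg norm (hrel z y hz hy h z)
    rw [hVe] at h1
    simp only [norm_mul, norm_inner_symm z e, norm_inner_symm y f] at h1 h2
    have hzz : ‖inner ℂ z z‖ = (1 : ℝ) := by simp [inner_self_eq_norm_sq_to_K, hz]
    have h3 : ‖inner ℂ e z‖ = ‖inner ℂ f y‖ := by
      nlinarith [norm_pos_iff.mpr hez, norm_nonneg (inner ℂ f y)]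
    have h4 : ‖inner ℂ y (V z)‖ = ‖y‖ * ‖V z‖ := by
      rw [V.norm_map, hy, hz, mul_one]
      rw [hzz, ← h3] at h2
      exact (mul_left_cancel₀ (norm_pos_iff.mpr hez).ne' h2).symm
    have hy0 : y ≠ 0 := by rintro rfl; simp at hy
    have hVz0 : V z ≠ 0 := by
      intro h0
      have := V.norm_map z
      rw [h0, hz] at this; simp at this
    obtain ⟨c, hc0, hc⟩ := (norm_inner_eq_norm_iff hy0 hVz0).1 h4
    have hcn : ‖c‖ = 1 := by
      have := congrArg norm hc
      rw [V.norm_map, norm_smul, hy, hz] at this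
      linarith
    rw [hc, map_smul, inner_smul_left, inner_smul_right, ← mul_assoc, Complex.conj_mul', hcn, h B]
    simp
  have hq2 : ∀ B z, inner ℂ e z ≠ 0 → inner ℂ (V z) (φ B (V z)) = inner ℂ z (B z) := by
    intro B z hez
    have hz : z ≠ 0 := by rintro rfl; simp at hez
    have hn : (‖z‖ : ℂ) ≠ 0 := by exact_mod_cast (norm_pos_iff.mpr hz).ne'
    have h1 := hq1 B _ (hscale z hz) (by rw [inner_smul_right]; exact mul_ne_zero (inv_ne_zero hn) hez)
    simp only [map_smul, inner_smul_left, inner_smul_right] at h1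
    have hn' : (starRingEnd ℂ) (‖z‖ : ℂ)⁻¹ ≠ 0 := by simpa using hz
    exact mul_left_cancel₀ (inv_ne_zero hn) (mul_left_cancel₀ hn' (by linear_combination h1))
  have hq3 : ∀ B z, inner ℂ (V z) (φ B (V z)) = inner ℂ z (B z) := by
    intro B z
    by_cases hez : inner ℂ e z = 0
    · have h1 := hq2 B (z + e) (by rw [inner_add_right, hez, hee]; simp)
      have h2 := hq2 B (z - e) (by rw [inner_sub_right, hez, hee]; simp)
      have h3 := hq2 B e (by rw [hee]; simp)
      simp only [map_add, map_sub, inner_add_left, inner_add_right, inner_sub_left,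
        inner_sub_right] at h1 h2
      linear_combination (h1 + h2) / 2 - h3
    · exact hq2 B z hez
  have hsurj : Function.Surjective V := by
    have hc : IsClosed (LinearMap.range V.toLinearMap : Set H) := by
      have := V.isometry.isClosedEmbedding.isClosed_range
      rw [LinearMap.coe_range]
      exact this
    have : CompleteSpace (LinearMap.range V.toLinearMap) := hc.completeSpace_coe
    have htop : LinearMap.range V.toLinearMap = ⊤ := by
      rw [← Submodule.orthogonal_eq_bot_iff, Submodule.eq_bot_iff]
      intro w hw
      by_contra hw0
      have hw' : ∀ x, inner ℂ w (V x) = 0 := fun x =>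
        Submodule.inner_left_of_mem_orthogonal (LinearMap.mem_range_self V.toLinearMap x) hw
      obtain ⟨z, hz, h⟩ := sp_L4' r hr φ hφ hspec _ (hscale w hw0)
      have h1 := (sp_L5 r hr φ hφ hspec z z _ hz hz (hscale w hw0) h).2 (V z)
      rw [inner_smul_left, hw', mul_zero, zero_smul] at h1
      have h2 := hq3 (rankOne ℂ z z) z
      rw [h1] at h2
      simp [inner_self_eq_norm_sq_to_K, hz] at h2
    exact LinearMap.range_eq_top.1 htop
  refine ⟨LinearIsometryEquiv.ofSurjective V hsurj, fun A x => ?_⟩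
  set T := LinearIsometryEquiv.ofSurjective V hsurj with hT
  have hTV : ∀ x, T x = V x := fun x => rfl
  have key : φ A = (T.toContinuousLinearEquiv : H →L[ℂ] H) * A *
      (T.symm.toContinuousLinearEquiv : H →L[ℂ] H) := by
    refine sp_ext _ _ (fun y hy => ?_)
    obtain ⟨z, rfl⟩ := hsurj y
    rw [hq3, ← hTV]
    show _ = inner ℂ (T z) (T (A (T.symm (T z))))
    rw [T.symm_apply_apply, T.inner_map_map]
  rw [key]
  rfl


theorem spectrum_preserver_bounded_one_sided
    {H : Type*} [NormedAddCommGroup H] [InnerProductSpace ℂ H] [CompleteSpace H]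
    (hH : ¬ FiniteDimensional ℂ H)
    (r : ℚ) (hr : 1 < r)
    (φ : (H →L[ℂ] H) → (H →L[ℂ] H))
    (hφ : Function.Surjective φ)
    (hspec : ∀ A B : H →L[ℂ] H,
      spectrum ℂ (absPow A r * B) = spectrum ℂ (absPow (φ A) r * φ B)):
    (∃ T : H ≃ₗᵢ[ℂ] H, ∀ A : H →L[ℂ] H, ∀ x : H,
        φ A x = T (A (T.symm x))) ∨
    (∃ T : H ≃ₛₗᵢ[starRingEnd ℂ] H, ∀ A : H →L[ℂ] H, ∀ x : H,
        φ A x = T (A (T.symm x))) := by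
  left
  have hN : Nontrivial H := by
    by_contra hn
    rw [not_nontrivial_iff_subsingleton] at hn
    exact hH inferInstance
  exact sp_main (r : ℝ) (by exact_mod_cast (zero_lt_one.trans hr)) φ hφ hspec
end

section
/- Let H be an infinite-dimensional complex Hilbert space, let r and s be positive rational numbers with r + s > 1, and let φ : B(H) → B(H) be a surjective map satisfying σ(|A|^r B |A|^s) = σ(|φ(A)|^r φ(B) |φ(A)|^s) for all A, B ∈ B(H). Then there exists a bounded linear or conjugate-linear bijection T : H → H with T* = T⁻¹ such that φ(A) = T A T* for all A ∈ B(H). -/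
open scoped InnerProductSpace


section aux
open InnerProductSpace
variable {H : Type*} [NormedAddCommGroup H] [InnerProductSpace ℂ H] [CompleteSpace H]

lemma aux_absOp_sa (A : H →L[ℂ] H) : IsSelfAdjoint (absOp A) := by
  unfold absOp; exact cfc_predicate _ _

lemma aux_absOp_nonneg (A : H →L[ℂ] H) : 0 ≤ absOp A := by
  unfold absOp; exact cfc_nonneg (fun x _ => Real.sqrt_nonneg x)

lemma aux_absOp_sq (A : H →L[ℂ] H) : absOp A * absOp A = star A * A := by
  unfold absOp
  have hp : (0 : H →L[ℂ] H) ≤ star A * A := star_mul_self_nonneg A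
  have hsa : IsSelfAdjoint (star A * A) := IsSelfAdjoint.star_mul_self A
  rw [← cfc_mul (R := ℝ) _ _ _ (by fun_prop) (by fun_prop)]
  conv_rhs => rw [← cfc_id' ℝ (star A * A)]
  apply cfc_congr
  intro x hx
  exact Real.mul_self_sqrt (spectrum_nonneg_of_nonneg hp hx)

lemma aux_inner_sa {a : H →L[ℂ] H} (ha : IsSelfAdjoint a) (x y : H) :
    inner ℂ (a x) y = inner ℂ x (a y) := by
  have := ContinuousLinearMap.adjoint_inner_right a x y
  rw [← ContinuousLinearMap.star_eq_adjoint, ha.star_eq] at this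
  exact this.symm

lemma aux_absOp_ker (A : H →L[ℂ] H) (x : H) (h : absOp A x = 0) : A x = 0 := by
  have h1 : (star A * A) x = 0 := by
    rw [← aux_absOp_sq]; simp [h]
  have h2 : inner ℂ (A x) (A x) = 0 := by
    have := ContinuousLinearMap.adjoint_inner_right A x (A x)
    rw [← this, ← ContinuousLinearMap.star_eq_adjoint]
    have h3 : (star A) (A x) = 0 := h1
    rw [h3]; simp
  exact inner_self_eq_zero.mp h2

lemma aux_pow_ker {a : H →L[ℂ] H} (ha : IsSelfAdjoint a) (n : ℕ) (x : H)
    (h : (a ^ (2 ^ n)) x = 0) : a x = 0 := by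
  induction n with
  | zero => simpa using h
  | succ n ih =>
    apply ih
    rw [pow_succ, pow_mul, sq] at h
    have hsa : IsSelfAdjoint (a ^ (2 ^ n)) := ha.pow _
    have h2 : inner ℂ ((a ^ (2 ^ n)) x) ((a ^ (2 ^ n)) x) = 0 := by
      rw [aux_inner_sa hsa]
      have h3 : (a ^ (2 ^ n)) ((a ^ (2 ^ n)) x) = 0 := h
      rw [h3]; simp
    exact inner_self_eq_zero.mp h2

lemma aux_ker (A : H →L[ℂ] H) {r s : ℝ} (hr : 0 < r) (hs : 0 < s) (x : H)
    (h : absPow A s (absPow A r x) = 0) : A x = 0 := by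
  apply aux_absOp_ker
  obtain ⟨n, hn⟩ : ∃ n : ℕ, r + s < (2 : ℝ) ^ n := pow_unbounded_of_one_lt _ (by norm_num)
  have hsa := aux_absOp_sa A
  apply aux_pow_ker hsa n
  set a := absOp A with hadef
  have hnn : ∀ t ∈ spectrum ℝ a, 0 ≤ t := fun t ht =>
    spectrum_nonneg_of_nonneg (aux_absOp_nonneg A) ht
  have hc : ∀ p : ℝ, 0 < p → ContinuousOn (fun t : ℝ => t ^ p) (spectrum ℝ a) :=
    fun p hp => (Real.continuous_rpow_const hp.le).continuousOn
  have key : a ^ (2 ^ n) = cfc (fun t : ℝ => t ^ ((2 : ℝ) ^ n - (r + s))) a *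
      (cfc (fun t : ℝ => t ^ s) a * cfc (fun t : ℝ => t ^ r) a) := by
    rw [← cfc_mul (R := ℝ) _ _ _ (hc s hs) (hc r hr)]
    rw [← cfc_mul (R := ℝ) _ _ _ (hc _ (by linarith))
      (show ContinuousOn (fun t : ℝ => t ^ s * t ^ r) _ from (hc s hs).mul (hc r hr))]
    rw [← cfc_pow_id (R := ℝ) a]
    apply cfc_congr
    intro t ht
    have h0 := hnn t ht
    simp only
    rw [← Real.rpow_add_of_nonneg h0 hs.le hr.le, ← Real.rpow_add_of_nonneg h0 (by linarith) (by linarith),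
      ← Real.rpow_natCast]
    congr 1
    push_cast; ring
  rw [key]
  have h' : (cfc (fun t : ℝ => t ^ s) a) ((cfc (fun t : ℝ => t ^ r) a) x) = 0 := h
  simp [h']

lemma aux_cfc_smul_proj {P : H →L[ℂ] H} (hP : IsStarProjection P) (c : ℝ) (f : ℝ → ℝ)
    (hf : Continuous f) (h0 : f 0 = 0) : cfc f (c • P) = f c • P := by
  have hsa : IsSelfAdjoint P := hP.isSelfAdjoint
  rw [← cfc_comp_smul c f P hf.continuousOn hsa]
  rw [← cfc_const_mul_id (f c) P]
  apply cfc_congr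
  intro t ht
  rcases hP.isIdempotentElem.spectrum_subset ℝ ht with h | h
  · subst h; simp [h0]
  · rw [Set.mem_singleton_iff] at h; subst h; simp

lemma aux_absPow_rankOne (c : ℝ) (hc : 0 ≤ c) (u v : H) (hu : ‖u‖ = 1) (hv : ‖v‖ = 1) (r : ℝ)
    (hr : 0 < r) :
    absPow ((c : ℂ) • rankOne ℂ u v) r = ((c ^ r : ℝ) : ℂ) • rankOne ℂ v v := by
  have hP : IsStarProjection (rankOne ℂ v v) := isStarProjection_rankOne_self hv
  have h1 : star ((c : ℂ) • rankOne ℂ u v) * ((c : ℂ) • rankOne ℂ u v)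
      = (c ^ 2 : ℝ) • rankOne ℂ v v := by
    rw [ContinuousLinearMap.star_eq_adjoint, map_smulₛₗ, adjoint_rankOne, smul_mul_smul_comm,
      ContinuousLinearMap.mul_def, rankOne_comp_rankOne, inner_self_eq_norm_sq_to_K, hu]
    ext x
    have e1 : ((c ^ 2 : ℝ) • rankOne ℂ v v) x = ((c ^ 2 : ℝ) : ℂ) • (rankOne ℂ v v) x := by
      rw [Complex.coe_smul]; rfl
    rw [e1]
    simp [sq, smul_smul, -Complex.coe_smul]
  have h2 : absOp ((c : ℂ) • rankOne ℂ u v) = c • rankOne ℂ v v := by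
    unfold absOp
    rw [h1, aux_cfc_smul_proj hP _ _ Real.continuous_sqrt Real.sqrt_zero, Real.sqrt_sq hc]
  unfold absPow
  rw [h2, aux_cfc_smul_proj hP _ _ (Real.continuous_rpow_const hr.le) (Real.zero_rpow hr.ne')]
  ext x; simp

lemma aux_spec_proj {P : H →L[ℂ] H} (hP : IsIdempotentElem P) (hP0 : P ≠ 0) (k : ℂ) :
    spectrum ℂ (k • P) \ {0} = {k} \ {0} := by
  ext z
  simp only [Set.mem_sdiff, Set.mem_singleton_iff]
  refine and_congr_left fun hz => ?_
  by_cases hk : k = 0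
  · subst hk
    constructor
    · intro h
      simp only [zero_smul] at h
      have : Nontrivial (H →L[ℂ] H) := ⟨P, 0, hP0⟩
      rw [spectrum.zero_eq] at h
      exact h
    · intro h; exact absurd h hz
  · have : z ∈ spectrum ℂ (k • P) ↔ z / k ∈ spectrum ℂ P := by
      have := spectrum.smul_mem_smul_iff (a := P) (s := z / k) (r := Units.mk0 k hk)
      rw [← this]
      simp [Units.smul_def, mul_div_cancel₀ _ hk]
    rw [this]
    constructor
    · intro h
      rcases hP.spectrum_subset ℂ h with h | h
      · simp [hz, hk] at h
      · rw [Set.mem_singleton_iff] at h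
        field_simp at h; exact h
    · rintro rfl
      rw [div_self hk, spectrum.mem_iff]
      intro hu
      apply hP0
      have : (algebraMap ℂ (H →L[ℂ] H) 1 - P) * P = (algebraMap ℂ (H →L[ℂ] H) 1 - P) * 0 := by
        simp [sub_mul, hP.eq]
      exact hu.mul_left_cancel this

lemma aux_spec_rankOne (c : ℝ) (hc : 0 ≤ c) (u v : H) (hu : ‖u‖ = 1) (hv : ‖v‖ = 1) (r s : ℝ)
    (hr : 0 < r) (hs : 0 < s) (B : H →L[ℂ] H) :
    spectrum ℂ (absPow ((c : ℂ) • rankOne ℂ u v) r * B * absPow ((c : ℂ) • rankOne ℂ u v) s) \ {0}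
      = {((c ^ (r + s) : ℝ) : ℂ) * inner ℂ v (B v)} \ {0} := by
  rw [aux_absPow_rankOne c hc u v hu hv r hr, aux_absPow_rankOne c hc u v hu hv s hs]
  have hv0 : v ≠ 0 := by rintro rfl; simp at hv
  rw [← aux_spec_proj (isIdempotentElem_rankOne_self hv) (rankOne_ne_zero hv0 hv0)]
  congr 2
  ext x
  rw [Real.rpow_add_of_nonneg hc hr.le hs.le]
  simp [smul_smul, -Complex.coe_smul]
  congr 1
  ring

lemma aux_eigen (M : H →L[ℂ] H) (z : ℂ) (x : H) (hx : x ≠ 0) (h : M x = z • x) :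
    z ∈ spectrum ℂ M := by
  rw [spectrum.mem_iff]
  intro hu
  apply hx
  obtain ⟨w, hw⟩ := hu
  have h1 : (w : H →L[ℂ] H) x = 0 := by
    rw [hw]; simp [h, Algebra.algebraMap_eq_smul_one]
  have h2 : ((↑w⁻¹ : H →L[ℂ] H) * (w : H →L[ℂ] H)) x = x := by simp
  rw [← h2]
  change (↑w⁻¹ : H →L[ℂ] H) ((w : H →L[ℂ] H) x) = 0
  rw [h1, map_zero]

lemma aux_rank (hH : ∃ e : H, ‖e‖ = 1) (A : H →L[ℂ] H) {r s : ℝ} (hr : 0 < r) (hs : 0 < s)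
    (h : ∀ B, (spectrum ℂ (absPow A r * B * absPow A s) \ {0}).Subsingleton) :
    ∃ (c : ℝ) (u v : H), 0 ≤ c ∧ ‖u‖ = 1 ∧ ‖v‖ = 1 ∧ A = (c : ℂ) • rankOne ℂ u v := by
  obtain ⟨e, he⟩ := hH
  set p := absPow A r with hp
  set q := absPow A s with hq
  by_cases h0 : A = 0
  · exact ⟨0, e, e, le_rfl, he, he, by simp [h0]⟩
  have hk : ∀ x, q (p x) = 0 → A x = 0 := fun x hx => aux_ker A hr hs x hx
  obtain ⟨u, hu⟩ : ∃ u, A u ≠ 0 := by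
    by_contra! hcon
    exact h0 (by ext x; simpa using hcon x)
  set a := q * p with ha
  have hau : a u ≠ 0 := fun hx => hu (hk u hx)
  have hn : (inner ℂ (a u) (a u) : ℂ) ≠ 0 := fun hx => hau (inner_self_eq_zero.mp hx)
  have claim : ∀ v, A v = (inner ℂ (a u) (a v) / inner ℂ (a u) (a u) : ℂ) • A u := by
    intro v
    set k : ℂ := inner ℂ (a u) (a v) / inner ℂ (a u) (a u) with hkdef
    set w := v - k • u with hw
    have horth : (inner ℂ (a u) (a w) : ℂ) = 0 := by
      rw [hw, map_sub, map_smul, inner_sub_right, inner_smul_right, hkdef]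
      field_simp
      simp
    have haw : a w = 0 := by
      by_contra haw
      have hnw : (inner ℂ (a w) (a w) : ℂ) ≠ 0 := fun hx => haw (inner_self_eq_zero.mp hx)
      have horth2 : (inner ℂ (a w) (a u) : ℂ) = 0 := inner_eq_zero_symm.mp horth
      set B : H →L[ℂ] H := (inner ℂ (a u) (a u) : ℂ)⁻¹ • rankOne ℂ u (a u) +
        (2 * (inner ℂ (a w) (a w) : ℂ)⁻¹) • rankOne ℂ w (a w) with hB
      have hBu : B (a u) = u := by
        simp [hB, horth2, smul_smul, -inner_self_eq_norm_sq_to_K, inv_mul_cancel₀ hn]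
      have hBw : B (a w) = (2 : ℂ) • w := by
        simp [hB, horth, smul_smul, -inner_self_eq_norm_sq_to_K, mul_assoc, inv_mul_cancel₀ hnw]
      have hpu : p u ≠ 0 := fun hx => hau (by simp [ha, hx])
      have hpw : p w ≠ 0 := fun hx => haw (by simp [ha, hx])
      have e1 : (1 : ℂ) ∈ spectrum ℂ (p * B * q) := by
        apply aux_eigen _ _ _ hpu
        change p (B (a u)) = _
        rw [hBu, one_smul]
      have e2 : (2 : ℂ) ∈ spectrum ℂ (p * B * q) := by
        apply aux_eigen _ _ _ hpw
        change p (B (a w)) = _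
        rw [hBw, map_smul]
      have := h B ⟨e1, by simp⟩ ⟨e2, by simp⟩
      norm_num at this
    have := hk w haw
    rw [hw, map_sub, map_smul, sub_eq_zero] at this
    exact this
  set y := (starRingEnd ℂ (inner ℂ (a u) (a u) : ℂ)⁻¹) • (ContinuousLinearMap.adjoint a) (a u) with hy
  have hA : A = rankOne ℂ (A u) y := by
    ext v
    rw [claim v, rankOne_apply, hy, inner_smul_left, ContinuousLinearMap.adjoint_inner_left]
    simp [-inner_self_eq_norm_sq_to_K, div_eq_inv_mul]
  have hy0 : y ≠ 0 := by
    intro hy0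
    apply h0
    rw [hA, hy0]; simp
  have hnu : ‖A u‖ ≠ 0 := norm_ne_zero_iff.mpr hu
  have hny : ‖y‖ ≠ 0 := norm_ne_zero_iff.mpr hy0
  refine ⟨‖A u‖ * ‖y‖, ((‖A u‖ : ℂ)⁻¹) • A u, ((‖y‖ : ℂ)⁻¹) • y, by positivity, ?_, ?_, ?_⟩
  · simp [norm_smul, hnu]
  · simp [norm_smul, hny]
  · conv_lhs => rw [hA]
    have : (‖A u‖ : ℂ) ≠ 0 := by exact_mod_cast hnu
    have : (‖y‖ : ℂ) ≠ 0 := by exact_mod_cast hny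
    ext v
    simp [smul_smul, inner_smul_left]
    congr 1
    field_simp

lemma aux_ext {C D : H →L[ℂ] H}
    (h : ∀ y : H, ‖y‖ = 1 → (inner ℂ y (C y) : ℂ) = inner ℂ y (D y)) : C = D := by
  have h1 : ∀ y : H, (inner ℂ y (C y) : ℂ) = inner ℂ y (D y) := by
    intro y
    by_cases hy : y = 0
    · simp [hy]
    have hn : (‖y‖ : ℂ) ≠ 0 := by exact_mod_cast norm_ne_zero_iff.mpr hy
    have := h (((‖y‖ : ℂ)⁻¹) • y) (by simp [norm_smul, norm_ne_zero_iff.mpr hy])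
    simp only [map_smul, inner_smul_left, inner_smul_right, map_inv₀, Complex.conj_ofReal] at this
    have hi : ((‖y‖ : ℂ)⁻¹) ≠ 0 := inv_ne_zero hn
    exact mul_left_cancel₀ hi (mul_left_cancel₀ hi this)
  have h2 : (C : H →ₗ[ℂ] H) = D := by
    rw [← ext_inner_map]
    intro x
    rw [← inner_conj_symm, ← inner_conj_symm (_ : H) x]
    exact congrArg _ (h1 x)
  ext x
  exact congrArg (fun f : H →ₗ[ℂ] H => f x) h2

lemma aux_phase {x y : H} (hx : ‖x‖ = 1) (hy : ‖y‖ = 1) (h : ‖(inner ℂ y x : ℂ)‖ = 1) :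
    ∃ k : ℂ, ‖k‖ = 1 ∧ x = k • y := by
  have hx0 : x ≠ 0 := by rintro rfl; simp at hx
  have hy0 : y ≠ 0 := by rintro rfl; simp at hy
  obtain ⟨k, hk, he⟩ := (norm_inner_eq_norm_iff (𝕜 := ℂ) hy0 hx0).mp (by rw [h, hx, hy, mul_one])
  refine ⟨k, ?_, he⟩
  have := congrArg norm he
  rw [norm_smul, hx, hy, mul_one] at this
  exact this.symm

lemma aux_phase2 {x u v : H} (hx : ‖x‖ = 1) (hu : ‖u‖ = 1) (hv : ‖v‖ = 1)
    (h : (inner ℂ x (rankOne ℂ u v x) : ℂ) = 1) : ∃ k : ℂ, ‖k‖ = 1 ∧ x = k • v := by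
  apply aux_phase hx hv
  rw [inner_right_rankOne_apply] at h
  have h1 := congrArg norm h
  rw [norm_mul, norm_one] at h1
  have h2 : ‖(inner ℂ x u : ℂ)‖ ≤ 1 := by simpa [hx, hu] using norm_inner_le_norm (𝕜 := ℂ) x u
  have h3 : ‖(inner ℂ v x : ℂ)‖ ≤ 1 := by simpa [hx, hv] using norm_inner_le_norm (𝕜 := ℂ) v x
  have h4 := norm_nonneg (inner ℂ x u : ℂ)
  have h5 := norm_nonneg (inner ℂ v x : ℂ)
  nlinarith

lemma aux_phase_inner {x y : H} {k : ℂ} (hk : ‖k‖ = 1) (h : x = k • y) (C : H →L[ℂ] H) :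
    (inner ℂ x (C x) : ℂ) = inner ℂ y (C y) := by
  rw [h, map_smul, inner_smul_left, inner_smul_right, ← mul_assoc, mul_comm (starRingEnd ℂ k),
    Complex.mul_conj, Complex.normSq_eq_norm_sq, hk]
  simp

lemma aux_set {a b : ℂ} (h : ({a} : Set ℂ) \ {0} = {b} \ {0}) : a = b := by
  by_cases ha : a = 0
  · by_contra hb
    have : b ∈ ({a} : Set ℂ) \ {0} := by
      rw [h]; exact ⟨rfl, fun h0 => hb (by rw [ha]; exact h0.symm)⟩
    exact hb this.1.symm
  · have : a ∈ ({b} : Set ℂ) \ {0} := by rw [← h]; exact ⟨rfl, ha⟩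
    exact this.1

lemma aux_rpow_one {c t : ℝ} (hc : 0 ≤ c) (ht : 0 < t) (h : c ^ t = 1) : c = 1 := by
  have := Real.rpow_left_injOn ht.ne' (Set.mem_setOf.mpr hc) (Set.mem_setOf.mpr zero_le_one)
    (by simpa using h)
  exact this

theorem aux_main (hH : ∃ e : H, ‖e‖ = 1) (r s : ℝ) (hr : 0 < r) (hs : 0 < s)
    (φ : (H →L[ℂ] H) → (H →L[ℂ] H)) (hφ : Function.Surjective φ)
    (hspec : ∀ A B : H →L[ℂ] H,
      spectrum ℂ (absPow A r * B * absPow A s) =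
      spectrum ℂ (absPow (φ A) r * φ B * absPow (φ A) s)) :
    ∃ T : H ≃ₗᵢ[ℂ] H, ∀ A : H →L[ℂ] H, ∀ x : H, φ A x = T (A (T.symm x)) := by
  have ht : 0 < r + s := by linarith
  -- forward
  have fwd : ∀ (c : ℝ) (u v : H), 0 ≤ c → ‖u‖ = 1 → ‖v‖ = 1 →
      ∃ (d : ℝ) (u' v' : H), 0 ≤ d ∧ ‖u'‖ = 1 ∧ ‖v'‖ = 1 ∧
        φ ((c : ℂ) • rankOne ℂ u v) = (d : ℂ) • rankOne ℂ u' v' ∧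
        ∀ B, ((c ^ (r + s) : ℝ) : ℂ) * inner ℂ v (B v) =
          ((d ^ (r + s) : ℝ) : ℂ) * inner ℂ v' (φ B v') := by
    intro c u v hc hu hv
    obtain ⟨d, u', v', hd, hu', hv', he⟩ := aux_rank hH (φ ((c : ℂ) • rankOne ℂ u v)) hr hs (by
      intro B'
      obtain ⟨B, rfl⟩ := hφ B'
      rw [← hspec, aux_spec_rankOne c hc u v hu hv r s hr hs B]
      exact Set.subsingleton_singleton.anti Set.sdiff_subset)
    refine ⟨d, u', v', hd, hu', hv', he, fun B => aux_set ?_⟩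
    rw [← aux_spec_rankOne c hc u v hu hv r s hr hs B,
      ← aux_spec_rankOne d hd u' v' hu' hv' r s hr hs (φ B), ← he, hspec]
  have bwd : ∀ (u' v' : H), ‖u'‖ = 1 → ‖v'‖ = 1 →
      ∃ (c : ℝ) (u v : H), 0 ≤ c ∧ ‖u‖ = 1 ∧ ‖v‖ = 1 ∧
        φ ((c : ℂ) • rankOne ℂ u v) = rankOne ℂ u' v' ∧
        ∀ B, ((c ^ (r + s) : ℝ) : ℂ) * inner ℂ v (B v) = inner ℂ v' (φ B v') := by
    intro u' v' hu' hv'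
    obtain ⟨A, hA⟩ := hφ (((1 : ℝ) : ℂ) • rankOne ℂ u' v')
    obtain ⟨c, u, v, hc, hu, hv, he⟩ := aux_rank hH A hr hs (by
      intro B
      rw [hspec, hA, aux_spec_rankOne 1 zero_le_one u' v' hu' hv' r s hr hs]
      exact Set.subsingleton_singleton.anti Set.sdiff_subset)
    refine ⟨c, u, v, hc, hu, hv, by rw [← he, hA]; simp, fun B => aux_set ?_⟩
    rw [← aux_spec_rankOne c hc u v hu hv r s hr hs B, ← he, hspec, hA,
      aux_spec_rankOne 1 zero_le_one u' v' hu' hv' r s hr hs]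
    simp
  -- linearity
  have hadd : ∀ B C, φ (B + C) = φ B + φ C := by
    intro B C
    apply aux_ext
    intro y hy
    obtain ⟨c, u, v, hc, hu, hv, -, he⟩ := bwd y y hy hy
    simp only [ContinuousLinearMap.add_apply, inner_add_right, ← he, mul_add]
  have hsmul : ∀ (k : ℂ) B, φ (k • B) = k • φ B := by
    intro k B
    apply aux_ext
    intro y hy
    obtain ⟨c, u, v, hc, hu, hv, -, he⟩ := bwd y y hy hy
    simp only [ContinuousLinearMap.smul_apply, inner_smul_right, ← he]
    ring
  have hstar : ∀ B, φ (star B) = star (φ B) := by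
    intro B
    apply aux_ext
    intro y hy
    obtain ⟨c, u, v, hc, hu, hv, -, he⟩ := bwd y y hy hy
    rw [← he, ContinuousLinearMap.star_eq_adjoint, ContinuousLinearMap.star_eq_adjoint,
      ContinuousLinearMap.adjoint_inner_right, ContinuousLinearMap.adjoint_inner_right,
      ← inner_conj_symm, ← inner_conj_symm (φ B y), ← he, map_mul, Complex.conj_ofReal]
  have hinj : Function.Injective φ := by
    intro B C h
    apply aux_ext
    intro e he
    obtain ⟨d, u', v', hd, hu', hv', -, h2⟩ := fwd 1 e e zero_le_one he he
    have h3 := h2 B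
    rw [h, ← h2 C] at h3
    simpa using h3
  -- normalised surjectivity
  have sur : ∀ y : H, ‖y‖ = 1 → ∃ v : H, ‖v‖ = 1 ∧
      ∀ B, (inner ℂ v (B v) : ℂ) = inner ℂ y (φ B y) := by
    intro y hy
    obtain ⟨c, u, v, hc, hu, hv, hA, he⟩ := bwd y y hy hy
    refine ⟨v, hv, ?_⟩
    have hsa : (c : ℂ) • rankOne ℂ u v = (c : ℂ) • rankOne ℂ v u := by
      apply hinj
      have h1 : star ((c : ℂ) • rankOne ℂ u v) = (c : ℂ) • rankOne ℂ v u := by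
        rw [ContinuousLinearMap.star_eq_adjoint, map_smulₛₗ, adjoint_rankOne, Complex.conj_ofReal]
      rw [← h1, hstar, hA, ContinuousLinearMap.star_eq_adjoint, adjoint_rankOne]
    have h1 := he ((c : ℂ) • rankOne ℂ u v)
    rw [hA] at h1
    have h2 : (inner ℂ y (rankOne ℂ y y y) : ℂ) = 1 := by simp [hy]
    rw [h2] at h1
    have hc0 : c ≠ 0 := by
      rintro rfl
      simp at h1
    have hc0' : (c : ℂ) ≠ 0 := by exact_mod_cast hc0
    have h3 := congrArg (fun f : H →L[ℂ] H => f v) hsa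
    simp [hv, -Complex.coe_smul, hc0'] at h3
    have h4 : ‖(inner ℂ u v : ℂ)‖ = 1 := by
      have := congrArg norm h3
      rw [norm_smul, hu, hv, mul_one] at this
      exact this.symm
    have h5 := congrArg norm h1
    have h6 : ‖(inner ℂ v u : ℂ)‖ = 1 := by rw [norm_inner_symm]; exact h4
    have h7 : ‖((c ^ (r + s) : ℝ) : ℂ)‖ = c ^ (r + s) := by
      rw [Complex.norm_real, Real.norm_of_nonneg (Real.rpow_nonneg hc _)]
    have h8 : ‖(c : ℂ)‖ = c := by rw [Complex.norm_real, Real.norm_of_nonneg hc]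
    simp only [ContinuousLinearMap.smul_apply, inner_smul_right, rankOne_apply, norm_mul, h6, h7, h8,
      norm_one, mul_one, inner_self_eq_norm_sq_to_K, hv] at h5
    have h9 : c ^ (r + s + 1) = 1 := by
      rw [Real.rpow_add_of_nonneg hc ht.le zero_le_one, Real.rpow_one]
      simpa using h5
    have h10 : c = 1 := aux_rpow_one hc (by linarith) h9
    intro B
    rw [← he B, h10]
    simp
  have hone : φ 1 = 1 := by
    apply aux_ext
    intro y hy
    obtain ⟨v, hv, he⟩ := sur y hy
    rw [← he]
    simp [hv, hy]
  have fwd1 : ∀ (u v : H), ‖u‖ = 1 → ‖v‖ = 1 →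
      ∃ (u' v' : H), ‖u'‖ = 1 ∧ ‖v'‖ = 1 ∧ φ (rankOne ℂ u v) = rankOne ℂ u' v' ∧
        ∀ B, (inner ℂ v (B v) : ℂ) = inner ℂ v' (φ B v') := by
    intro u v hu hv
    obtain ⟨d, u', v', hd, hu', hv', h1, h2⟩ := fwd 1 u v zero_le_one hu hv
    have h3 := h2 1
    rw [hone] at h3
    simp [hv, hv'] at h3
    have h4 : d ^ (r + s) = 1 := by exact_mod_cast h3.symm
    have h5 := aux_rpow_one hd ht h4
    subst h5
    refine ⟨u', v', hu', hv', by simpa using h1, fun B => by simpa using h2 B⟩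
  obtain ⟨f, hf⟩ := hH
  obtain ⟨g, h, hg, hh, hfe, hfB⟩ := fwd1 f f hf hf
  have hff : (inner ℂ f (rankOne ℂ f f f) : ℂ) = 1 := by simp [hf]
  have hT1 : ∀ e : H, ‖e‖ = 1 → ∃ w : H, ‖w‖ = 1 ∧ φ (rankOne ℂ e f) = rankOne ℂ w h := by
    intro e he
    obtain ⟨u, v, hu, hv, h1, h2⟩ := fwd1 e f he hf
    have h3 := h2 (rankOne ℂ f f)
    rw [hff, hfe] at h3
    obtain ⟨k, hk, hvk⟩ := aux_phase2 hv hg hh h3.symm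
    refine ⟨(starRingEnd ℂ k) • u, by simp [norm_smul, hk, hu], ?_⟩
    rw [h1, hvk]
    ext x
    simp [inner_smul_left, smul_smul, mul_comm]
  let T0 : H →ₗ[ℂ] H :=
    { toFun := fun e => φ (rankOne ℂ e f) h
      map_add' := fun a b => by
        have : rankOne ℂ (a + b) f = rankOne ℂ a f + rankOne ℂ b f := by simp
        rw [this, hadd]; rfl
      map_smul' := fun k a => by
        have : rankOne ℂ (k • a) f = k • rankOne ℂ a f := by simp
        rw [this, hsmul]; rfl }
  have hT0 : ∀ e, T0 e = φ (rankOne ℂ e f) h := fun e => rfl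
  have hT2 : ∀ e : H, ‖e‖ = 1 → ‖T0 e‖ = 1 ∧ φ (rankOne ℂ e f) = rankOne ℂ (T0 e) h := by
    intro e he
    obtain ⟨w, hw, h1⟩ := hT1 e he
    have : T0 e = w := by rw [hT0, h1]; simp [hh]
    rw [this]; exact ⟨hw, h1⟩
  have hnorm : ∀ e, ‖T0 e‖ = ‖e‖ := by
    intro e
    by_cases he : e = 0
    · simp [he]
    have hn : ‖e‖ ≠ 0 := norm_ne_zero_iff.mpr he
    have := (hT2 (((‖e‖ : ℂ)⁻¹) • e) (by simp [norm_smul, hn])).1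
    rw [map_smul, norm_smul] at this
    simp at this
    field_simp at this
    exact this
  have hquad : ∀ e : H, ‖e‖ = 1 → ∀ B, (inner ℂ e (B e) : ℂ) = inner ℂ (T0 e) (φ B (T0 e)) := by
    intro e he B
    obtain ⟨hn, h1⟩ := hT2 e he
    obtain ⟨u, v, hu, hv, h2, h3⟩ := fwd1 f e hf he
    have h4 : rankOne ℂ h (T0 e) = rankOne ℂ u v := by
      rw [← h2, ← adjoint_rankOne e f, ← ContinuousLinearMap.star_eq_adjoint, hstar, h1,
        ContinuousLinearMap.star_eq_adjoint, adjoint_rankOne]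
    have h5 := congrArg (fun A => ContinuousLinearMap.adjoint A h) h4
    simp only [adjoint_rankOne, rankOne_apply, inner_self_eq_norm_sq_to_K, hh] at h5
    simp at h5
    have h6 : ‖(inner ℂ u h : ℂ)‖ = 1 := by
      have := congrArg norm h5
      rw [norm_smul, hn, hv, mul_one] at this
      exact this.symm
    rw [aux_phase_inner h6 h5, h3]
  have hsurj : Function.Surjective T0 := by
    have h1 : ∀ y : H, ‖y‖ = 1 → ∃ x, T0 x = y := by
      intro y hy
      obtain ⟨v, hv, he⟩ := sur y hy
      obtain ⟨u', v', hu', hv', h2, -⟩ := fwd1 v v hv hv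
      have hvv : (inner ℂ v (rankOne ℂ v v v) : ℂ) = 1 := by simp [hv]
      have e1 := he (rankOne ℂ v v)
      have e2 := hquad v hv (rankOne ℂ v v)
      rw [hvv, h2] at e1 e2
      obtain ⟨k, hk, hyk⟩ := aux_phase2 hy hu' hv' e1.symm
      obtain ⟨l, hl, hyl⟩ := aux_phase2 (hT2 v hv).1 hu' hv' e2.symm
      have hl0 : l ≠ 0 := by rintro rfl; simp at hl
      refine ⟨(k * l⁻¹) • v, ?_⟩
      rw [map_smul, hyl, smul_smul, mul_assoc, inv_mul_cancel₀ hl0, mul_one, hyk]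
    intro y
    by_cases hy : y = 0
    · exact ⟨0, by simp [hy]⟩
    have hn : ‖y‖ ≠ 0 := norm_ne_zero_iff.mpr hy
    have hn' : (‖y‖ : ℂ) ≠ 0 := by exact_mod_cast hn
    obtain ⟨x, hx⟩ := h1 (((‖y‖ : ℂ)⁻¹) • y) (by simp [norm_smul, hn])
    refine ⟨(‖y‖ : ℂ) • x, ?_⟩
    rw [map_smul, hx, smul_smul, mul_inv_cancel₀ hn', one_smul]
  let Ti : H →ₗᵢ[ℂ] H := ⟨T0, hnorm⟩
  let T : H ≃ₗᵢ[ℂ] H := LinearIsometryEquiv.ofSurjective Ti hsurj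
  have hTT : ∀ e, T e = T0 e := fun e => rfl
  refine ⟨T, fun A x => ?_⟩
  let C : H →L[ℂ] H := (T.toContinuousLinearEquiv : H →L[ℂ] H) ∘L A ∘L
    (T.symm.toContinuousLinearEquiv : H →L[ℂ] H)
  have hC : φ A = C := by
    apply aux_ext
    intro y hy
    obtain ⟨e, rfl⟩ := T.surjective y
    have he : ‖e‖ = 1 := by rw [← T.norm_map e]; exact hy
    have := hquad e he A
    rw [← hTT] at this
    rw [← this]
    simp [C]
  rw [hC]
  rfl

end aux

theorem spectrum_preserver_bounded_two_sided
    {H : Type*} [NormedAddCommGroup H] [InnerProductSpace ℂ H] [CompleteSpace H]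
    (hH : ¬ FiniteDimensional ℂ H)
    (r s : ℚ) (hr : 0 < r) (hs : 0 < s) (hrs : 1 < r + s)
    (φ : (H →L[ℂ] H) → (H →L[ℂ] H))
    (hφ : Function.Surjective φ)
    (hspec : ∀ A B : H →L[ℂ] H,
      spectrum ℂ (absPow A r * B * absPow A s) =
      spectrum ℂ (absPow (φ A) r * φ B * absPow (φ A) s)):
    (∃ T : H ≃ₗᵢ[ℂ] H, ∀ A : H →L[ℂ] H, ∀ x : H,
        φ A x = T (A (T.symm x))) ∨
    (∃ T : H ≃ₛₗᵢ[starRingEnd ℂ] H, ∀ A : H →L[ℂ] H, ∀ x : H,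
        φ A x = T (A (T.symm x))) := by
  left
  have hne : ∃ e : H, ‖e‖ = 1 := by
    by_contra! hcon
    apply hH
    have : Subsingleton H := by
      refine ⟨fun a b => ?_⟩
      have hz : ∀ x : H, x = 0 := by
        intro x
        by_contra hx
        exact hcon (((‖x‖ : ℂ)⁻¹) • x) (by simp [norm_smul, norm_ne_zero_iff.mpr hx])
      rw [hz a, hz b]
    infer_instance
  exact aux_main hne (r : ℝ) (s : ℝ) (by exact_mod_cast hr) (by exact_mod_cast hs) φ hφ hspec
end

section
/- Let H be a complex Hilbert space and let A ∈ B(H) be a projection (self-adjoint idempotent). Then A has rank one if and only if A ≠ 0 and for every self-adjoint operator T ∈ B(H) the set σ(AT) \ {0} contains at most one element. -/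
open scoped InnerProductSpace

theorem aux_mem_spec {H : Type*} [NormedAddCommGroup H] [InnerProductSpace ℂ H]
    (B : H →L[ℂ] H) (v : H) (l : ℂ) (hv : v ≠ 0) (h : B v = l • v) : l ∈ spectrum ℂ B := by
  rw [spectrum.mem_iff]
  intro hu
  obtain ⟨C, hC⟩ := hu.exists_left_inv
  apply hv
  have h1 := congrArg (fun F : H →L[ℂ] H => F v) hC
  have h2 : (algebraMap ℂ (H →L[ℂ] H) l - B) v = 0 := by
    simp [Algebra.algebraMap_eq_smul_one, h]
  simp only [ContinuousLinearMap.mul_apply, h2] at h1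
  simpa using h1.symm

theorem aux_unit {H : Type*} [NormedAddCommGroup H] [InnerProductSpace ℂ H]
    (B : H →L[ℂ] H) (m l : ℂ) (hB : B * B = m • B) (hl : l ∈ spectrum ℂ B) (h0 : l ≠ 0) :
    l = m := by
  by_contra hne
  have hd : l - m ≠ 0 := sub_ne_zero.2 hne
  have key : l * (l⁻¹ * (l - m)⁻¹) - l⁻¹ - m * (l⁻¹ * (l - m)⁻¹) = 0 := by
    field_simp
    ring
  refine hl (spectrum.mem_resolventSet_of_left_right_inverse
    (b := l⁻¹ • (1 : H →L[ℂ] H) + (l⁻¹ * (l - m)⁻¹) • B)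
    (c := l⁻¹ • (1 : H →L[ℂ] H) + (l⁻¹ * (l - m)⁻¹) • B) ?_ ?_)
  all_goals
    rw [Algebra.algebraMap_eq_smul_one]
    simp only [sub_mul, mul_sub, mul_add, add_mul, smul_mul_assoc, mul_smul_comm, one_mul, mul_one, hB,
      smul_smul]
    have : l * l⁻¹ = 1 := mul_inv_cancel₀ h0
    have k1 := congrArg (fun z : ℂ => z • (1 : H →L[ℂ] H)) this
    have k2 := congrArg (fun z : ℂ => z • B) key
    simp only [one_smul, zero_smul, sub_smul] at k1 k2
    rw [← sub_eq_zero] at k1 ⊢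
    refine Eq.trans ?_ ((congrArg₂ (· + ·) k1 k2).trans (add_zero 0))
    module

theorem projection_rankOne_iff
    {H : Type*} [NormedAddCommGroup H] [InnerProductSpace ℂ H] [CompleteSpace H]
    (A : H →L[ℂ] H) (hA : IsSelfAdjoint A) (hA2 : A * A = A) :
    IsRankOne A ↔
      (A ≠ 0 ∧ ∀ T : H →L[ℂ] H, IsSelfAdjoint T →
        (spectrum ℂ (A * T) \ {0}).Subsingleton) := by
  unfold IsRankOne
  constructor
  · intro h
    refine ⟨?_, ?_⟩
    · intro hz
      obtain ⟨⟨v, ⟨x, hv⟩⟩, hv0, hs⟩ := finrank_eq_one_iff'.1 h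
      refine hv0 (Subtype.ext ?_)
      change v = 0
      rw [← hv, hz]
      rfl
    · intro T _
      obtain ⟨⟨v, hv⟩, hv0, hs⟩ := finrank_eq_one_iff'.1 h
      have hs' : ∀ x, ∃ c : ℂ, c • v = A x := fun x => by
        obtain ⟨c, hc⟩ := hs ⟨A x, ⟨x, rfl⟩⟩
        exact ⟨c, congrArg Subtype.val hc⟩
      obtain ⟨m, hm⟩ := hs' (T v)
      have hB : (A * T) * (A * T) = m • (A * T) := by
        ext x
        obtain ⟨c, hc⟩ := hs' (T x)
        simp only [ContinuousLinearMap.mul_apply, ContinuousLinearMap.smul_apply]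
        rw [← hc, map_smul, map_smul, ← hm, smul_comm]
      rintro a ⟨ha, ha0⟩ b ⟨hb, hb0⟩
      rw [aux_unit _ m a hB ha ha0, aux_unit _ m b hB hb hb0]
  · rintro ⟨h0, hT⟩
    have : ∃ x, A x ≠ 0 := by
      by_contra! hc
      exact h0 (by ext x; simpa using hc x)
    obtain ⟨x, hx⟩ := this
    have hAA : ∀ y, A (A y) = A y := fun y => congrArg (fun F : H →L[ℂ] H => F y) hA2
    set v := A x with hv
    have hvv : ⟪v, v⟫_ℂ ≠ 0 := inner_self_ne_zero.2 hx
    refine finrank_eq_one_iff'.2 ⟨⟨v, ⟨x, rfl⟩⟩, fun h => hx (congrArg Subtype.val h), ?_⟩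
    rintro ⟨_, ⟨y, rfl⟩⟩
    refine ⟨⟪v, A y⟫_ℂ / ⟪v, v⟫_ℂ, Subtype.ext ?_⟩
    change (⟪v, A y⟫_ℂ / ⟪v, v⟫_ℂ) • v = A y
    by_contra hne
    have hw0 : A y - (⟪v, A y⟫_ℂ / ⟪v, v⟫_ℂ) • v ≠ 0 := fun h => hne (sub_eq_zero.1 h).symm
    have hAw : A (A y - (⟪v, A y⟫_ℂ / ⟪v, v⟫_ℂ) • v) = A y - (⟪v, A y⟫_ℂ / ⟪v, v⟫_ℂ) • v := by
      rw [map_sub, map_smul, hAA, hv, hAA]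
    have hort : ⟪v, A y - (⟪v, A y⟫_ℂ / ⟪v, v⟫_ℂ) • v⟫_ℂ = 0 := by
      rw [inner_sub_right, inner_smul_right, div_mul_cancel₀ _ hvv, sub_self]
    generalize A y - (⟪v, A y⟫_ℂ / ⟪v, v⟫_ℂ) • v = w at *
    have hAv : A v = v := hAA x
    have hR : IsSelfAdjoint (InnerProductSpace.rankOne ℂ v v) := by
      rw [ContinuousLinearMap.isSelfAdjoint_iff_isSymmetric]
      intro a b
      simp [inner_smul_left, inner_smul_right, mul_comm]
    have e1 : (1 : ℂ) ∈ spectrum ℂ (A * (A + InnerProductSpace.rankOne ℂ v v)) := by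
      refine aux_mem_spec _ w _ hw0 ?_
      simp [hAw, hort]
    have e2 : (1 + ⟪v, v⟫_ℂ) ∈ spectrum ℂ (A * (A + InnerProductSpace.rankOne ℂ v v)) := by
      refine aux_mem_spec _ v _ hx ?_
      rw [ContinuousLinearMap.mul_apply, ContinuousLinearMap.add_apply,
        InnerProductSpace.rankOne_apply, map_add, map_smul, hAv, hAv, add_smul, one_smul]
    have hn : (1 + ⟪v, v⟫_ℂ) ≠ 0 := by
      rw [inner_self_eq_norm_sq_to_K]
      have h1 : (0:ℝ) < 1 + ‖v‖ ^ 2 := by positivity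
      intro h2
      have h3 := congrArg Complex.re h2
      have h4 : ((1 : ℂ) + ((‖v‖ : ℝ) : ℂ) ^ 2).re = 1 + ‖v‖ ^ 2 := by
        rw [← Complex.ofReal_pow, Complex.add_re, Complex.one_re, Complex.ofReal_re]
      exact h1.ne' (h4.symm.trans h3)
    have := hT _ (hA.add hR) ⟨e1, one_ne_zero⟩ ⟨e2, hn⟩
    exact hvv (by simpa using this)
end

section
/- Let H be an infinite-dimensional complex Hilbert space, let r and s be positive rational numbers with r + s > 1, and let φ : S(H) → S(H) be a surjective map satisfying σ(|A|^r B |A|^s) = σ(|φ(A)|^r φ(B) |φ(A)|^s) for every A in P₁(H) ∪ {I} and every B ∈ S(H). Then for every B ∈ S(H), φ(B) = 0 if and only if B = 0. -/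
open scoped InnerProductSpace

theorem preserver_zero
    {H : Type*} [NormedAddCommGroup H] [InnerProductSpace ℂ H] [CompleteSpace H]
    (hH : ¬ FiniteDimensional ℂ H)
    (r s : ℚ) (hr : 0 < r) (hs : 0 < s) (hrs : 1 < r + s)
    (φ : selfAdjoint (H →L[ℂ] H) → selfAdjoint (H →L[ℂ] H))
    (hφ : Function.Surjective φ)
    (hspec : ∀ A : selfAdjoint (H →L[ℂ] H),
      (IsRankOneProjection (A : H →L[ℂ] H) ∨ (A : H →L[ℂ] H) = 1) →
      ∀ B : selfAdjoint (H →L[ℂ] H),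
        spectrum ℂ (absPow (A : H →L[ℂ] H) r * (B : H →L[ℂ] H) * absPow (A : H →L[ℂ] H) s) =
        spectrum ℂ (absPow (φ A : H →L[ℂ] H) r * (φ B : H →L[ℂ] H) *
          absPow (φ A : H →L[ℂ] H) s)):
    ∀ B : selfAdjoint (H →L[ℂ] H), φ B = 0 ↔ B = 0 := by
  have hnt : Nontrivial H := by
    by_contra h
    rw [not_nontrivial_iff_subsingleton] at h
    exact hH inferInstance
  have habs : absOp (1 : H →L[ℂ] H) = 1 := by
    unfold absOp
    rw [star_one, one_mul, cfc_apply_one]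
    simp
  have hpow : ∀ q : ℝ, absPow (1 : H →L[ℂ] H) q = 1 := by
    intro q
    unfold absPow
    rw [habs, cfc_apply_one]
    simp
  have key : ∀ B : selfAdjoint (H →L[ℂ] H), φ B = 0 → B = 0 := by
    intro B hB
    have h := hspec 1 (Or.inr rfl) B
    rw [hB] at h
    simp only [selfAdjoint.val_one, hpow, one_mul, mul_one, ZeroMemClass.coe_zero, mul_zero,
      zero_mul, spectrum.zero_eq] at h
    have h2 := CFC.eq_zero_of_spectrum_subset_zero (R := ℂ) (B : H →L[ℂ] H) h.le
      B.2.isStarNormal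
    exact Subtype.ext h2
  intro B
  refine ⟨key B, ?_⟩
  rintro rfl
  obtain ⟨C, hC⟩ := hφ 0
  have := key C hC
  rwa [this] at hC
end

section
/- Let H be an infinite-dimensional complex Hilbert space, let r and s be positive rational numbers with r + s > 1, and let φ : S(H) → S(H) be a surjective map satisfying σ(|A|^r B |A|^s) = σ(|φ(A)|^r φ(B) |φ(A)|^s) for every A in P₁(H) ∪ {I} and every B ∈ S(H). Then φ(I) = I. -/
open scoped InnerProductSpace

lemma absPow_eq {H : Type*} [NormedAddCommGroup H] [InnerProductSpace ℂ H] [CompleteSpace H]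
    (T : H →L[ℂ] H) (hT : IsSelfAdjoint T) (r : ℝ) (hr : 0 < r) :
    absPow T r = cfc (fun t : ℝ => |t| ^ r) T := by
  have h1 : star T * T = cfc (fun t : ℝ => t * t) T := by
    rw [hT.star_eq, cfc_mul (fun t : ℝ => t) (fun t : ℝ => t) T, cfc_id' ℝ T]
  have h2 : absOp T = cfc (fun t : ℝ => |t|) T := by
    unfold absOp
    rw [h1, ← cfc_comp' (fun t : ℝ => Real.sqrt t) (fun t : ℝ => t * t) T]
    simp only [Real.sqrt_mul_self_eq_abs]
  have hc : Continuous (fun t : ℝ => t ^ r) := Real.continuous_rpow_const hr.le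
  unfold absPow
  rw [h2, ← cfc_comp' (fun t : ℝ => t ^ r) (fun t : ℝ => |t|) T hc.continuousOn]

theorem preserver_one
    {H : Type*} [NormedAddCommGroup H] [InnerProductSpace ℂ H] [CompleteSpace H]
    (hH : ¬ FiniteDimensional ℂ H)
    (r s : ℚ) (hr : 0 < r) (hs : 0 < s) (hrs : 1 < r + s)
    (φ : selfAdjoint (H →L[ℂ] H) → selfAdjoint (H →L[ℂ] H))
    (hφ : Function.Surjective φ)
    (hspec : ∀ A : selfAdjoint (H →L[ℂ] H),
      (IsRankOneProjection (A : H →L[ℂ] H) ∨ (A : H →L[ℂ] H) = 1) →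
      ∀ B : selfAdjoint (H →L[ℂ] H),
        spectrum ℂ (absPow (A : H →L[ℂ] H) r * (B : H →L[ℂ] H) * absPow (A : H →L[ℂ] H) s) =
        spectrum ℂ (absPow (φ A : H →L[ℂ] H) r * (φ B : H →L[ℂ] H) *
          absPow (φ A : H →L[ℂ] H) s)):
    φ 1 = 1 := by
  have hN : Nontrivial H := by
    by_contra h
    rw [not_nontrivial_iff_subsingleton] at h
    exact hH inferInstance
  have hr' : (0 : ℝ) < r := by exact_mod_cast hr
  have hs' : (0 : ℝ) < s := by exact_mod_cast hs
  have key := hspec 1 (Or.inr rfl) 1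
  obtain ⟨T, hT⟩ : ∃ T, T = φ 1 := ⟨_, rfl⟩
  rw [← hT] at key ⊢
  have hTs : IsSelfAdjoint (T : H →L[ℂ] H) := T.2
  have h1s : IsSelfAdjoint (1 : H →L[ℂ] H) := IsSelfAdjoint.one _
  have hcr : Continuous (fun t : ℝ => |t| ^ (r : ℝ)) :=
    (Real.continuous_rpow_const hr'.le).comp continuous_abs
  have hcs : Continuous (fun t : ℝ => |t| ^ (s : ℝ)) :=
    (Real.continuous_rpow_const hs'.le).comp continuous_abs
  have hone : ∀ x : ℝ, 0 < x → absPow (1 : H →L[ℂ] H) x = 1 := by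
    intro x hx
    rw [absPow_eq _ h1s x hx, cfc_apply_one]
    simp
  have hprod : absPow (T : H →L[ℂ] H) r * (T : H →L[ℂ] H) * absPow (T : H →L[ℂ] H) s
      = cfc (fun t : ℝ => |t| ^ (r : ℝ) * t * |t| ^ (s : ℝ)) (T : H →L[ℂ] H) := by
    rw [absPow_eq _ hTs _ hr', absPow_eq _ hTs _ hs',
      cfc_mul (fun t : ℝ => |t| ^ (r : ℝ) * t) (fun t : ℝ => |t| ^ (s : ℝ)) _
        (hcr.mul continuous_id).continuousOn hcs.continuousOn,
      cfc_mul (fun t : ℝ => |t| ^ (r : ℝ)) (fun t : ℝ => t) _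
        hcr.continuousOn continuous_id.continuousOn, cfc_id' ℝ (T : H →L[ℂ] H)]
  have hcoe : ((1 : selfAdjoint (H →L[ℂ] H)) : H →L[ℂ] H) = 1 := rfl
  rw [hprod, hcoe, hone _ hr', hone _ hs', mul_one, mul_one, spectrum.one_eq] at key
  have hspT : ∀ t ∈ spectrum ℝ (T : H →L[ℂ] H), t = 1 := by
    intro t ht
    have hm : |t| ^ (r : ℝ) * t * |t| ^ (s : ℝ) ∈ spectrum ℝ
        (cfc (fun t : ℝ => |t| ^ (r : ℝ) * t * |t| ^ (s : ℝ)) (T : H →L[ℂ] H)) := by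
      rw [cfc_map_spectrum (fun t : ℝ => |t| ^ (r : ℝ) * t * |t| ^ (s : ℝ)) _ hTs
        ((hcr.mul continuous_id).mul hcs).continuousOn]
      exact ⟨t, ht, rfl⟩
    have hm2 := spectrum.algebraMap_mem ℂ hm
    rw [← key, Set.mem_singleton_iff] at hm2
    have hm3 : |t| ^ (r : ℝ) * t * |t| ^ (s : ℝ) = 1 := by
      have : ((|t| ^ (r : ℝ) * t * |t| ^ (s : ℝ) : ℝ) : ℂ) = 1 := hm2
      exact_mod_cast this
    have a0 : 0 ≤ |t| ^ (r : ℝ) := by positivity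
    have b0 : 0 ≤ |t| ^ (s : ℝ) := by positivity
    have tpos : 0 < t := by
      by_contra h
      push Not at h
      nlinarith [mul_nonneg (mul_nonneg a0 b0) (neg_nonneg.2 h)]
    rw [abs_of_pos tpos] at hm3 a0 b0
    rcases lt_trichotomy t 1 with h | h | h
    · have h1 := Real.rpow_lt_one tpos.le h hr'
      have h2 := Real.rpow_lt_one tpos.le h hs'
      have h3 := mul_lt_one_of_nonneg_of_lt_one_left a0 h1 h.le
      have h4 := mul_lt_one_of_nonneg_of_lt_one_left (mul_nonneg a0 tpos.le) h3 h2.le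
      linarith
    · exact h
    · have h1 := Real.one_lt_rpow h hr'
      have h2 := Real.one_lt_rpow h hs'
      have h3 := one_lt_mul_of_lt_of_le h1 h.le
      have h4 := one_lt_mul_of_lt_of_le h3 h2.le
      linarith
  apply Subtype.ext
  rw [hcoe, ← cfc_id' ℝ (T : H →L[ℂ] H) hTs, cfc_congr (g := fun _ => (1 : ℝ)) hspT]
  exact cfc_const_one ℝ (T : H →L[ℂ] H)
end

section
/- Let H be an infinite-dimensional complex Hilbert space, let r and s be positive rational numbers with r + s > 1, and let φ : S(H) → S(H) be a surjective map satisfying σ(|A|^r B |A|^s) = σ(|φ(A)|^r φ(B) |φ(A)|^s) for every A in P₁(H) ∪ {I} and every B ∈ S(H). Then φ is injective. -/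
open scoped InnerProductSpace

lemma aux_absPow {H : Type*} [NormedAddCommGroup H] [InnerProductSpace ℂ H]
    [CompleteSpace H] (P : H →L[ℂ] H) (h1 : IsSelfAdjoint P) (h2 : P * P = P)
    (r : ℝ) (hr : 0 < r) : absPow P r = P := by
  have hsp : spectrum ℝ P ⊆ {0, 1} := IsIdempotentElem.spectrum_subset ℝ h2
  have ha : absOp P = P := by
    unfold absOp
    rw [h1.star_eq, h2]
    conv_rhs => rw [← cfc_id ℝ P]
    apply cfc_congr
    intro t ht
    rcases hsp ht with h | h
    · subst h; simp
    · have h : t = 1 := h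
      subst h; simp
  unfold absPow
  rw [ha]
  conv_rhs => rw [← cfc_id ℝ P]
  apply cfc_congr
  intro t ht
  rcases hsp ht with h | h
  · subst h; simp [Real.zero_rpow hr.ne']
  · have h : t = 1 := h
    subst h; simp

lemma aux_mem {H : Type*} [NormedAddCommGroup H] [InnerProductSpace ℂ H]
    (P : H →L[ℂ] H) (x : H) (hx : x ≠ 0) (hP : P x = x) (a : ℂ) :
    a ∈ spectrum ℂ (a • P) := by
  rw [spectrum.mem_iff]
  rintro ⟨u, hu⟩
  apply hx
  have h : (u : H →L[ℂ] H) x = 0 := by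
    rw [hu]; simp [Algebra.algebraMap_eq_smul_one, hP]
  have h3 : ((↑u⁻¹ : H →L[ℂ] H) * (u : H →L[ℂ] H)) x = 0 := by
    rw [ContinuousLinearMap.mul_apply, h, map_zero]
  rw [Units.inv_mul] at h3
  simpa using h3

lemma aux_sub {H : Type*} [NormedAddCommGroup H] [InnerProductSpace ℂ H]
    [CompleteSpace H] [Nontrivial H]
    (P : H →L[ℂ] H) (h2 : P * P = P) (a b : ℂ) (h : a ∈ spectrum ℂ (b • P)) :
    a = 0 ∨ a = b := by
  rw [spectrum.smul_eq_smul _ _ (spectrum.nonempty P)] at h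
  obtain ⟨t, ht, rfl⟩ := h
  rcases IsIdempotentElem.spectrum_subset ℂ h2 ht with h | h
  · left; simp [h]
  · right
    have h : t = 1 := h
    simp [h]

theorem preserver_injective
    {H : Type*} [NormedAddCommGroup H] [InnerProductSpace ℂ H] [CompleteSpace H]
    (hH : ¬ FiniteDimensional ℂ H)
    (r s : ℚ) (hr : 0 < r) (hs : 0 < s) (hrs : 1 < r + s)
    (φ : selfAdjoint (H →L[ℂ] H) → selfAdjoint (H →L[ℂ] H))
    (hφ : Function.Surjective φ)
    (hspec : ∀ A : selfAdjoint (H →L[ℂ] H),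
      (IsRankOneProjection (A : H →L[ℂ] H) ∨ (A : H →L[ℂ] H) = 1) →
      ∀ B : selfAdjoint (H →L[ℂ] H),
        spectrum ℂ (absPow (A : H →L[ℂ] H) r * (B : H →L[ℂ] H) * absPow (A : H →L[ℂ] H) s) =
        spectrum ℂ (absPow (φ A : H →L[ℂ] H) r * (φ B : H →L[ℂ] H) *
          absPow (φ A : H →L[ℂ] H) s)):
    Function.Injective φ := by
  intro B C hBC
  have key : ∀ x : H, ‖x‖ = 1 → ⟪x, (B : H →L[ℂ] H) x⟫_ℂ = ⟪x, (C : H →L[ℂ] H) x⟫_ℂ := by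
    intro x hx
    have hx0 : x ≠ 0 := by
      rintro rfl
      simp at hx
    haveI : Nontrivial H := ⟨x, 0, hx0⟩
    set P : H →L[ℂ] H := (ℂ ∙ x).starProjection with hPdef
    have h1 : IsSelfAdjoint P := isSelfAdjoint_starProjection _
    have h2 : P * P = P := Submodule.isIdempotentElem_starProjection _
    have hPw : ∀ w, P w = ⟪x, w⟫_ℂ • x := fun w =>
      Submodule.starProjection_unit_singleton ℂ hx w
    have hPx : P x = x := by
      rw [hPw, inner_self_eq_norm_sq_to_K, hx]; simp
    have h3 : IsRankOne P := by
      unfold IsRankOne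
      have : LinearMap.range (P : H →ₗ[ℂ] H) = ℂ ∙ x := Submodule.range_starProjection _
      rw [this]
      exact finrank_span_singleton hx0
    have hsm : ∀ D : H →L[ℂ] H, P * D * P = ⟪x, D x⟫_ℂ • P := by
      intro D
      ext w
      simp [hPw, smul_smul, inner_smul_right, mul_comm]
    have e := fun D => hspec ⟨P, h1⟩ (Or.inl ⟨h1, h2, h3⟩) D
    have hr' : (0:ℝ) < (r:ℝ) := by exact_mod_cast hr
    have hs' : (0:ℝ) < (s:ℝ) := by exact_mod_cast hs
    have e2 := (e B).trans ((hBC ▸ rfl : _ = _).trans (e C).symm)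
    simp only [aux_absPow P h1 h2 _ hr', aux_absPow P h1 h2 _ hs', hsm] at e2
    have m1 := aux_sub P h2 _ _ (e2 ▸ aux_mem P x hx0 hPx ⟪x, (B : H →L[ℂ] H) x⟫_ℂ)
    have m2 := aux_sub P h2 _ _ (e2.symm ▸ aux_mem P x hx0 hPx ⟪x, (C : H →L[ℂ] H) x⟫_ℂ)
    rcases m1 with m1 | m1
    · rcases m2 with m2 | m2
      · rw [m1, m2]
      · exact m2.symm
    · exact m1
  apply Subtype.ext
  have hlin : ((B : H →L[ℂ] H) : H →ₗ[ℂ] H) = ((C : H →L[ℂ] H) : H →ₗ[ℂ] H) := by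
    rw [← ext_inner_map]
    intro x
    by_cases hx0 : x = 0
    · simp [hx0]
    have hn : (‖x‖ : ℂ) ≠ 0 := by exact_mod_cast norm_ne_zero_iff.mpr hx0
    have k := key ((‖x‖ : ℂ)⁻¹ • x) (by
      rw [norm_smul, norm_inv, Complex.norm_real, norm_norm]
      exact inv_mul_cancel₀ (norm_ne_zero_iff.mpr hx0))
    simp only [map_smul, inner_smul_left, inner_smul_right] at k
    have k2 : ⟪x, (B : H →L[ℂ] H) x⟫_ℂ = ⟪x, (C : H →L[ℂ] H) x⟫_ℂ := by
      simpa [hn, hx0] using k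
    have k3 := congrArg (starRingEnd ℂ) k2
    rw [inner_conj_symm, inner_conj_symm] at k3
    exact k3
  exact ContinuousLinearMap.coe_injective hlin
end
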